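/- Let K be a number field. Then the set {(x, y) ∈ K² : x is not a norm from K(√y) to K, i.e. there do not exist u, v ∈ K with x = u² − y·v²} is diophantine over K. -/

import Mathlib

/-- A subset `S ⊆ K^ι` is diophantine over `K` if there are `m ∈ ℕ` and a polynomial
`f` in the variables `y_i` (`i : ι`) and `x_1, …, x_m` with coefficients in `K` such that
`a ∈ S` iff `f(a, x) = 0` has a solution `x ∈ K^m`. -/
def IsDiophantine {K : Type*} [Field K] {ι : Type*} [Fintype ι] (S : Set (ι → K)) : Prop :=
  ∃ (m : ℕ) (f : MvPolynomial (ι ⊕ Fin m) K),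
    ∀ a : ι → K, a ∈ S ↔ ∃ x : Fin m → K, MvPolynomial.eval (Sum.elim a x) f = 0

section

namespace NND
set_option linter.unusedSectionVars false
set_option linter.unusedVariables false

section FieldLevel
variable {F : Type*} [Field F] [CharZero F]

/-- `x` is a norm from `F(√y)`. -/
def Spl (x y : F) : Prop := ∃ u v : F, x = u ^ 2 - y * v ^ 2

theorem spl_symm {x y : F} (hx : x ≠ 0) (h : Spl x y) : Spl y x := by
  obtain ⟨u, v, h⟩ := h
  by_cases hv : v = 0
  · subst hv
    have hu : u ≠ 0 := by rintro rfl; apply hx; rw [h]; ring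
    refine ⟨(y + 1) / 2, (y - 1) / (2 * u), ?_⟩
    rw [h]; field_simp; ring
  · refine ⟨u / v, 1 / v, ?_⟩
    rw [h]; field_simp; ring

theorem spl_mul {x x' y : F} (h : Spl x y) (h' : Spl x' y) : Spl (x * x') y := by
  obtain ⟨u, v, h⟩ := h
  obtain ⟨u', v', h'⟩ := h'
  exact ⟨u * u' + y * v * v', u * v' + v * u', by rw [h, h']; ring⟩

theorem spl_inv {x y : F} (h : Spl x y) : Spl x⁻¹ y := by
  by_cases hx : x = 0
  · subst hx; simpa using h
  obtain ⟨u, v, h⟩ := h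
  refine ⟨u / x, v / x, ?_⟩
  field_simp
  rw [← h]

theorem spl_of_sq {x y : F} (hx : IsSquare x) : Spl x y := by
  obtain ⟨r, rfl⟩ := hx
  exact ⟨r, 0, by ring⟩

/-- If `(x,y)` splits, the form `⟨x, y, -xy⟩` is universal. -/
theorem universal_of_spl {x y : F} (hx : x ≠ 0) (hy : y ≠ 0) (h : Spl x y) (m : F) :
    ∃ p q r : F, m = x * p ^ 2 + y * q ^ 2 - x * y * r ^ 2 := by
  obtain ⟨u, v, h⟩ := h
  set k : F := (m / y - 1) / 2 with hk
  set q : F := (m / y + 1) / 2 with hq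
  have e1 : m = y * (q ^ 2 - k ^ 2) := by rw [hk, hq]; field_simp; ring
  refine ⟨k * y * v / x, q, k * u / x, ?_⟩
  rw [e1]
  have : x * (k * y * v / x) ^ 2 + y * q ^ 2 - x * y * (k * u / x) ^ 2
    = y * q ^ 2 - k ^ 2 * y * (u ^ 2 - y * v ^ 2) / x := by field_simp; ring
  rw [this, ← h]; field_simp

/-- The cross product identity: descent of splitting from a quadratic extension, in coordinates. -/
theorem rep_of_quad {x y m u0 u1 v0 v1 : F} (hx : x ≠ 0) (hy : y ≠ 0)
    (h1 : x = u0 ^ 2 + m * u1 ^ 2 - y * (v0 ^ 2 + m * v1 ^ 2))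
    (h2 : u0 * u1 = y * (v0 * v1)) :
    ∃ p q r : F, m = x * p ^ 2 + y * q ^ 2 - x * y * r ^ 2 := by
  by_cases hn : u1 ^ 2 - y * v1 ^ 2 = 0
  · by_cases hv : v1 = 0
    · have hu : u1 = 0 := by simpa [hv] using hn
      exact universal_of_spl hx hy ⟨u0, v0, by rw [h1, hu, hv]; ring⟩ m
    · refine universal_of_spl hx hy (spl_symm hy (spl_of_sq ⟨u1 / v1, ?_⟩)) m
      field_simp
      linear_combination -hn
  · set n := u1 ^ 2 - y * v1 ^ 2 with hnd
    refine ⟨u1 / n, (v0 * u1 - u0 * v1) / n, v1 / n, ?_⟩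
    field_simp
    have hm : m * n = x + y * v0 ^ 2 - u0 ^ 2 := by rw [hnd]; linear_combination -h1
    have : m * n ^ 2 = n * (x + y * v0 ^ 2 - u0 ^ 2) := by rw [← hm]; ring
    rw [this, hnd]
    linear_combination (-(u0 * u1) + y * v0 * v1) * h2

/-- Elementary moves between symbols `(x,y)`. -/
def Mv (x y x' y' : F) : Prop :=
  ∃ u w : F, u ^ 2 - x * w ^ 2 ≠ 0 ∧
    ((x' = y * (u ^ 2 - x * w ^ 2) ∧ y' = x) ∨ (x' = x ∧ y' = y * (u ^ 2 - x * w ^ 2)))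

/-- Chains of moves -/
def Chain : ℕ → F → F → F → F → Prop
  | 0, x, y, x', y' => x = x' ∧ y = y'
  | n + 1, x, y, x', y' => ∃ x1 y1, Mv x y x1 y1 ∧ Chain n x1 y1 x' y'

theorem mv_refl (x y : F) : Mv x y x y := ⟨1, 0, by simp, Or.inr ⟨rfl, by ring⟩⟩
theorem mv_swap (x y : F) : Mv x y y x := ⟨1, 0, by simp, Or.inl ⟨by ring, rfl⟩⟩

theorem chain_trans {m n : ℕ} {x y x1 y1 x2 y2 : F} (h : Chain m x y x1 y1)
    (h' : Chain n x1 y1 x2 y2) : Chain (m + n) x y x2 y2 := by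
  induction m generalizing x y with
  | zero => obtain ⟨rfl, rfl⟩ := h; simpa using h'
  | succ k ih =>
    obtain ⟨a, b, hm, hc⟩ := h
    rw [Nat.succ_add]
    exact ⟨a, b, hm, ih hc⟩

theorem chain_one {x y x1 y1 : F} (h : Mv x y x1 y1) : Chain 1 x y x1 y1 := ⟨_, _, h, rfl, rfl⟩

theorem chain_refl (n : ℕ) (x y : F) : Chain n x y x y := by
  induction n with
  | zero => exact ⟨rfl, rfl⟩
  | succ k ih => exact ⟨x, y, mv_refl x y, ih⟩

theorem chain_mono {m n : ℕ} (hmn : m ≤ n) {x y x1 y1 : F} (h : Chain m x y x1 y1) :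
    Chain n x y x1 y1 := by
  obtain ⟨k, rfl⟩ := Nat.exists_eq_add_of_le hmn
  exact chain_trans h (chain_refl k _ _)

theorem chain_of_rep {x y m p q r : F} (hx : x ≠ 0) (hy : y ≠ 0) (hm : m ≠ 0)
    (h : m = x * p ^ 2 + y * q ^ 2 - x * y * r ^ 2) : ∃ c, Chain 3 x y m c := by
  by_cases hN : q ^ 2 - x * r ^ 2 = 0
  · by_cases hr : r = 0
    · have hq : q = 0 := by simpa [hr] using hN
      have hp : p ≠ 0 := by rintro rfl; apply hm; rw [h, hr, hq]; ring
      refine ⟨y, chain_mono (m := 2) (by norm_num)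
        ⟨y, x, mv_swap x y, _, _, ⟨p, 0, by simpa using hp, Or.inl ⟨?_, rfl⟩⟩, rfl, rfl⟩⟩
      rw [h, hr, hq]; ring
    · refine ⟨x, chain_mono (m := 1) (by norm_num) (chain_one ?_)⟩
      by_cases hq0 : q = 0
      · exfalso; subst hq0; apply hx; 
        have : x * r ^ 2 = 0 := by linear_combination -hN
        simpa [hr] using this
      have hxs : x = (q / r) ^ 2 := by field_simp; linear_combination -hN
      have key : ((m / y + 1) / 2) ^ 2 - x * ((m / y - 1) / 2 * (r / q)) ^ 2 = m / y := by
        rw [hxs]; field_simp; ring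
      refine ⟨(m / y + 1) / 2, (m / y - 1) / 2 * (r / q), ?_, Or.inl ⟨?_, rfl⟩⟩
      · rw [key]; exact div_ne_zero hm hy
      · rw [key]; field_simp
  · set N := q ^ 2 - x * r ^ 2 with hNd
    have hm' : m = x * p ^ 2 + y * N := by rw [h, hNd]; ring
    have m1 : Mv x y (y * N) x := ⟨q, r, hN, Or.inl ⟨rfl, rfl⟩⟩
    by_cases hp : p = 0
    · refine ⟨x, chain_mono (m := 1) (by norm_num) (chain_one ?_)⟩
      have : m = y * N := by rw [hm', hp]; ring
      rw [this]; exact m1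
    · set y1 := y * N with hy1
      have hy10 : y1 ≠ 0 := mul_ne_zero hy hN
      refine ⟨x * (0 ^ 2 - y1 * p ^ 2), _, _, m1, _, _, ⟨0, p, ?_, Or.inl ⟨rfl, rfl⟩⟩, _, _,
        ⟨1, 1 / y1, ?_, Or.inl ⟨rfl, rfl⟩⟩, ?_, rfl⟩
      · simp [hy10, hp]
      · have : (1:F) ^ 2 - x * (0 ^ 2 - y1 * p ^ 2) * (1 / y1) ^ 2 = m / y1 := by
          rw [hm']; field_simp; ring
        rw [this]; exact div_ne_zero hm hy10
      · rw [hm']; field_simp; ring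

/-- nonzero-ness is preserved along moves -/
theorem mv_ne {x y x' y' : F} (hx : x ≠ 0) (hy : y ≠ 0) (h : Mv x y x' y') : x' ≠ 0 ∧ y' ≠ 0 := by
  obtain ⟨u, w, hN, ⟨rfl, rfl⟩ | ⟨rfl, rfl⟩⟩ := h
  · exact ⟨mul_ne_zero hy hN, hx⟩
  · exact ⟨hx, mul_ne_zero hy hN⟩

theorem chain_ne {n : ℕ} {x y x' y' : F} (hx : x ≠ 0) (hy : y ≠ 0) (h : Chain n x y x' y') :
    x' ≠ 0 ∧ y' ≠ 0 := by
  induction n generalizing x y with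
  | zero => obtain ⟨rfl, rfl⟩ := h; exact ⟨hx, hy⟩
  | succ k ih =>
    obtain ⟨a, b, hm, hc⟩ := h
    obtain ⟨ha, hb⟩ := mv_ne hx hy hm
    exact ih ha hb hc

/-- An abstract splitting notion invariant under moves. -/
theorem chain_iff {P : F → F → Prop} (hs : ∀ x y, x ≠ 0 → y ≠ 0 → P x y → P y x)
    (hm : ∀ x y N, x ≠ 0 → y ≠ 0 → N ≠ 0 → (∃ u w, N = u ^ 2 - x * w ^ 2) →
      (P x y ↔ P x (y * N))) {n : ℕ}
    {x y x' y' : F} (hx : x ≠ 0) (hy : y ≠ 0) (h : Chain n x y x' y') : P x y ↔ P x' y' := by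
  induction n generalizing x y with
  | zero => obtain ⟨rfl, rfl⟩ := h; rfl
  | succ k ih =>
    obtain ⟨a, b, hmv, hc⟩ := h
    obtain ⟨ha, hb⟩ := mv_ne hx hy hmv
    rw [← ih ha hb hc]
    obtain ⟨u, w, hN, ⟨rfl, rfl⟩ | ⟨rfl, rfl⟩⟩ := hmv
    · rw [hm _ _ _ hx hy hN ⟨u, w, rfl⟩]
      exact ⟨hs _ _ hx ha, hs _ _ ha hx⟩
    · exact hm _ _ _ hx hy hN ⟨u, w, rfl⟩

theorem chain_spl {n : ℕ} {x y x' y' : F} (hx : x ≠ 0) (hy : y ≠ 0) (h : Chain n x y x' y') :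
    Spl x y ↔ Spl x' y' := by
  refine chain_iff (P := Spl) (fun x y hx _ => spl_symm hx) ?_ hx hy h
  intro x y N hx hy hN ⟨u, w, hNe⟩
  have hs : Spl N x := ⟨u, w, hNe⟩
  constructor
  · intro h
    exact spl_symm (mul_ne_zero hy hN) (spl_mul (spl_symm hx h) hs)
  · intro h
    have := spl_mul (spl_symm hx h) (spl_inv hs)
    rw [mul_inv_cancel_right₀ hN] at this
    exact spl_symm hy this

/-- if `(x,y)` and `(x,y')` are such that `(x, y*y')` splits then they are related by a move -/
theorem mv_of_spl {x y y' : F} (hx : x ≠ 0) (hy : y ≠ 0) (hy' : y' ≠ 0) (h : Spl (y * y') x) :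
    Mv x y x y' := by
  have h2 : Spl (y' / y) x := by
    have := spl_mul h (spl_of_sq (y := x) (x := (y⁻¹) * y⁻¹) ⟨_, rfl⟩)
    convert this using 1
    field_simp
  obtain ⟨u, w, h3⟩ := h2
  refine ⟨u, w, ?_, Or.inr ⟨rfl, ?_⟩⟩
  · rw [← h3]; exact div_ne_zero hy' hy
  · rw [← h3]; field_simp

end FieldLevel
end NND

end

section

namespace NND
set_option linter.unusedSectionVars false
set_option linter.unusedVariables false

section AbsLevel
variable {K : Type*} [Field K] [CharZero K]

/-- `x` is a square in the completion at `v`. -/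
def LSq (v : AbsoluteValue K ℝ) (x : K) : Prop :=
  x ≠ 0 ∧ ∀ ε : ℝ, 0 < ε → ∃ y : K, v (x * y ^ 2 - 1) < ε

theorem lsq_sq (v : AbsoluteValue K ℝ) {z : K} (hz : z ≠ 0) : LSq v (z ^ 2) :=
  ⟨pow_ne_zero 2 hz, fun ε hε => ⟨z⁻¹, by
    have : z ^ 2 * z⁻¹ ^ 2 - 1 = 0 := by field_simp; ring
    rw [this, map_zero]; exact hε⟩⟩

theorem lsq_one (v : AbsoluteValue K ℝ) : LSq v 1 := by
  simpa using lsq_sq v (one_ne_zero (α := K))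

theorem lsq_mul {v : AbsoluteValue K ℝ} {x x' : K} (h : LSq v x) (h' : LSq v x') :
    LSq v (x * x') := by
  refine ⟨mul_ne_zero h.1 h'.1, fun ε hε => ?_⟩
  set η := min (ε / 3) 1
  have hη : 0 < η := by positivity
  obtain ⟨y, hy⟩ := h.2 η hη
  obtain ⟨y', hy'⟩ := h'.2 η hη
  refine ⟨y * y', ?_⟩
  have e : x * x' * (y * y') ^ 2 - 1 = (x * y ^ 2 - 1) * (x' * y' ^ 2 - 1) + (x * y ^ 2 - 1)
      + (x' * y' ^ 2 - 1) := by ring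
  rw [e]
  refine lt_of_le_of_lt ((v.add_le _ _).trans (add_le_add_left (v.add_le _ _) _)) ?_
  rw [v.map_mul]
  have h1 : η ≤ ε / 3 := min_le_left _ _
  have h2 : η ≤ 1 := min_le_right _ _
  have := v.nonneg (x * y ^ 2 - 1)
  have := v.nonneg (x' * y' ^ 2 - 1)
  nlinarith

theorem lsq_inv {v : AbsoluteValue K ℝ} {x : K} (h : LSq v x) : LSq v x⁻¹ := by
  have := lsq_mul h (lsq_sq v (inv_ne_zero h.1))
  convert this using 1
  have := h.1
  field_simp

theorem lsq_div {v : AbsoluteValue K ℝ} {x y : K} (h : LSq v x) (h' : LSq v y) : LSq v (x / y) := by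
  rw [div_eq_mul_inv]; exact lsq_mul h (lsq_inv h')


noncomputable def rad (v : AbsoluteValue K ℝ) : ℝ := min (1 / 2) (v 4 / 8)

theorem rad_pos (v : AbsoluteValue K ℝ) : 0 < rad v := by
  have : 0 < v 4 := v.pos (by norm_num)
  unfold rad; positivity

theorem abs_nat_le (v : AbsoluteValue K ℝ) (n : ℕ) : v n ≤ n := by
  induction n with
  | zero => simp
  | succ k ih =>
    push_cast
    refine (v.add_le _ _).trans ?_
    rw [v.map_one]; linarith

theorem lsq_of_close {v : AbsoluteValue K ℝ} {x : K} (h : v (x - 1) < rad v) : LSq v x := by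
  have h12 : rad v ≤ 1 / 2 := min_le_left _ _
  have h48 : rad v ≤ v 4 / 8 := min_le_right _ _
  have h4 : 0 < v 4 := v.pos (by norm_num)
  refine ⟨?_, ?_⟩
  · rintro rfl
    have : v ((0:K) - 1) = 1 := by rw [zero_sub, v.map_neg, v.map_one]
    rw [this] at h; linarith
  have key : ∀ n : ℕ, ∃ y : K, v (x * y ^ 2 - 1) ≤ rad v / 2 ^ n := by
    intro n
    induction n with
    | zero => exact ⟨1, by simpa using h.le⟩
    | succ k ih =>
      obtain ⟨y, hy⟩ := ih
      set e := x * y ^ 2 - 1 with he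
      refine ⟨y * (1 - e / 2), ?_⟩
      have e1 : x * (y * (1 - e / 2)) ^ 2 - 1 = - (e ^ 2 * (3 - e) / 4) := by
        have : x * y ^ 2 = 1 + e := by rw [he]; ring
        have : x * (y * (1 - e / 2)) ^ 2 - 1 = (x * y ^ 2) * (1 - e / 2) ^ 2 - 1 := by ring
        rw [this, ‹x * y ^ 2 = 1 + e›]; ring
      have hv : v (- (e ^ 2 * (3 - e) / 4)) = v e ^ 2 * v (3 - e) / v 4 := by
        rw [v.map_neg, map_div₀, v.map_mul, map_pow]
      rw [e1, hv]
      have h0 := v.nonneg e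
      have hpow : (1:ℝ) ≤ 2 ^ k := one_le_pow₀ (by norm_num)
      have hr : rad v / 2 ^ k ≤ rad v := div_le_self (rad_pos v).le hpow
      have h3 : v (3 - e) ≤ 4 := by
        have h31 : v (3 : K) ≤ 3 := by exact_mod_cast abs_nat_le v 3
        have : v (3 - e) ≤ v 3 + v e := by
          rw [sub_eq_add_neg]; refine (v.add_le _ _).trans ?_; rw [v.map_neg]
        linarith
      have h3' := v.nonneg (3 - e)
      have : v e ^ 2 * v (3 - e) / v 4 ≤ v e / 2 := by
        rw [div_le_iff₀ h4]
        have : v e ≤ v 4 / 8 := by linarith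
        nlinarith
      refine this.trans ?_
      rw [pow_succ]
      have : rad v / (2 ^ k * 2) = rad v / 2 ^ k / 2 := by field_simp
      rw [this]; linarith
  intro ε hε
  obtain ⟨n, hn⟩ := exists_pow_lt_of_lt_one (div_pos hε (rad_pos v)) (by norm_num : (1/2:ℝ) < 1)
  obtain ⟨y, hy⟩ := key n
  refine ⟨y, hy.trans_lt ?_⟩
  rw [lt_div_iff₀ (rad_pos v)] at hn
  rw [one_div, inv_pow] at hn
  rw [div_eq_mul_inv, mul_comm]; exact hn

theorem lsq_of_near {v : AbsoluteValue K ℝ} {x y : K} (hx : x ≠ 0)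
    (h : v (y - x) < rad v * v x) : LSq v (y / x) := by
  apply lsq_of_close
  have : y / x - 1 = (y - x) / x := by field_simp
  rw [this, map_div₀, div_lt_iff₀ (v.pos hx)]; exact h

/-- local splitting of the symbol `(a,b)` at `v` -/
def SplAt (v : AbsoluteValue K ℝ) (a b : K) : Prop :=
  ∃ p q z : K, LSq v z ∧ b * z = p ^ 2 - a * q ^ 2

theorem splAt_of_spl (v : AbsoluteValue K ℝ) {a b : K} (h : Spl b a) : SplAt v a b := by
  obtain ⟨p, q, h⟩ := h
  exact ⟨p, q, 1, lsq_one v, by rw [mul_one, h]⟩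

theorem splAt_of_lsq {v : AbsoluteValue K ℝ} {b : K} (a : K) (h : LSq v b) : SplAt v a b :=
  ⟨1, 0, b⁻¹, lsq_inv h, by rw [mul_inv_cancel₀ h.1]; ring⟩

theorem splAt_mul {v : AbsoluteValue K ℝ} {a b b' : K} (h : SplAt v a b) (h' : SplAt v a b') :
    SplAt v a (b * b') := by
  obtain ⟨p, q, z, hz, e⟩ := h
  obtain ⟨p', q', z', hz', e'⟩ := h'
  refine ⟨p * p' + a * q * q', p * q' + q * p', z * z', lsq_mul hz hz', ?_⟩
  have : b * b' * (z * z') = (b * z) * (b' * z') := by ring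
  rw [this, e, e']; ring

theorem splAt_inv {v : AbsoluteValue K ℝ} {a b : K} (hb : b ≠ 0) (h : SplAt v a b) :
    SplAt v a b⁻¹ := by
  have := splAt_mul h (splAt_of_lsq a (lsq_sq v (inv_ne_zero hb)))
  convert this using 1
  field_simp

theorem splAt_mul_iff {v : AbsoluteValue K ℝ} {a b b' : K} (hb' : b' ≠ 0) (h' : SplAt v a b') :
    SplAt v a (b * b') ↔ SplAt v a b := by
  refine ⟨fun h => ?_, fun h => splAt_mul h h'⟩
  have := splAt_mul h (splAt_inv hb' h')
  rwa [mul_inv_cancel_right₀ hb'] at this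

theorem splAt_symm {v : AbsoluteValue K ℝ} {a b : K} (ha : a ≠ 0) (hb : b ≠ 0) (h : SplAt v a b) :
    SplAt v b a := by
  obtain ⟨p, q, z, hz, e⟩ := h
  by_cases hq : q = 0
  · -- `b` is a local square
    subst hq
    have hp : p ≠ 0 := by
      rintro rfl
      have : b * z = 0 := by rw [e]; ring
      rcases mul_eq_zero.1 this with h | h
      · exact hb h
      · exact hz.1 h
    have hbl : LSq v b := by
      have : b = p ^ 2 / z := by rw [eq_div_iff hz.1, e]; ring
      rw [this]; exact lsq_div (lsq_sq v hp) hz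
    set C := v ((a - 1) / 2) ^ 2 + 1 with hC
    have hC0 : 0 < C := by positivity
    obtain ⟨y, hy⟩ := hbl.2 (rad v * v a / C) (div_pos (mul_pos (rad_pos v) (v.pos ha)) hC0)
    set n := ((a + 1) / 2) ^ 2 - b * (y * ((a - 1) / 2)) ^ 2 with hn
    refine ⟨(a + 1) / 2, y * ((a - 1) / 2), n / a, lsq_of_near ha ?_, by field_simp; rw [hn]; ring⟩
    have : n - a = - ((b * y ^ 2 - 1) * ((a - 1) / 2) ^ 2) := by rw [hn]; ring
    rw [this, v.map_neg, v.map_mul, map_pow]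
    rw [lt_div_iff₀ hC0] at hy
    have := v.nonneg (b * y ^ 2 - 1)
    nlinarith
  · -- general case
    have hbz : b * z ≠ 0 := mul_ne_zero hb hz.1
    set C := v (b * z / q ^ 2) with hC
    have hC0 : 0 < C := v.pos (div_ne_zero hbz (pow_ne_zero 2 hq))
    -- approximate `z⁻¹` by a square
    obtain ⟨y, hy⟩ := (lsq_inv hz).2 (rad v * v a / C)
      (div_pos (mul_pos (rad_pos v) (v.pos ha)) hC0)
    set n := (p / q) ^ 2 - b * (y / q) ^ 2 with hn
    refine ⟨p / q, y / q, n / a, lsq_of_near ha ?_, by field_simp; rw [hn]; field_simp⟩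
    have : n - a = - ((z⁻¹ * y ^ 2 - 1) * (b * z / q ^ 2)) := by
      have hz0 := hz.1
      rw [hn]; field_simp; linear_combination -e
    rw [this, v.map_neg, v.map_mul]
    rwa [lt_div_iff₀ hC0] at hy

theorem splAt_neg_self (v : AbsoluteValue K ℝ) (a : K) : SplAt v a (-a) :=
  splAt_of_spl v ⟨0, 1, by ring⟩

theorem splAt_of_lsq_left {v : AbsoluteValue K ℝ} {a b : K} (hb : b ≠ 0) (h : LSq v a) :
    SplAt v a b := splAt_symm hb h.1 (splAt_of_lsq b h)

/-- congruence in second slot -/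
theorem splAt_congr {v : AbsoluteValue K ℝ} {a b b' : K} (hb : b ≠ 0) (hb' : b' ≠ 0)
    (h : LSq v (b * b')) : SplAt v a b ↔ SplAt v a b' := by
  have h2 : LSq v (b / b') := by
    have := lsq_mul h (lsq_sq v (inv_ne_zero hb'))
    convert this using 1; field_simp
  have e : b = b' * (b / b') := by field_simp
  rw [e, splAt_mul_iff h2.1 (splAt_of_lsq a h2)]

theorem splAt_congr_left {v : AbsoluteValue K ℝ} {a a' b : K} (ha : a ≠ 0) (ha' : a' ≠ 0)
    (hb : b ≠ 0) (h : LSq v (a * a')) : SplAt v a b ↔ SplAt v a' b := by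
  have := splAt_congr (a := b) ha ha' h
  exact ⟨fun h => splAt_symm hb ha' (this.1 (splAt_symm ha hb h)),
    fun h => splAt_symm hb ha (this.2 (splAt_symm ha' hb h))⟩

theorem chain_splAt (v : AbsoluteValue K ℝ) {n : ℕ} {x y x' y' : K} (hx : x ≠ 0) (hy : y ≠ 0)
    (h : Chain n x y x' y') : SplAt v x y ↔ SplAt v x' y' := by
  refine chain_iff (P := SplAt v) (fun x y hx hy => splAt_symm hx hy) ?_ hx hy h
  intro x y N hx hy hN ⟨u, w, hNe⟩
  exact (splAt_mul_iff hN (splAt_of_spl v ⟨u, w, hNe⟩)).symm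

/-- local squares as a subgroup -/
def LSg (v : AbsoluteValue K ℝ) : Subgroup Kˣ where
  carrier := {x | LSq v (x : K)}
  one_mem' := by simpa using lsq_one v
  mul_mem' := by intro a b ha hb; simpa using lsq_mul ha hb
  inv_mem' := by intro a ha; simpa using lsq_inv ha

/-- local norms as a subgroup -/
def Nm (v : AbsoluteValue K ℝ) (a : K) : Subgroup Kˣ where
  carrier := {x | SplAt v a (x : K)}
  one_mem' := by simpa using splAt_of_lsq a (lsq_one v)
  mul_mem' := by intro a b ha hb; simpa using splAt_mul ha hb
  inv_mem' := by intro a ha; simpa using splAt_inv a.ne_zero ha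

theorem mem_LSg {v : AbsoluteValue K ℝ} {x : Kˣ} : x ∈ LSg v ↔ LSq v (x : K) := Iff.rfl
theorem mem_Nm {v : AbsoluteValue K ℝ} {a : K} {x : Kˣ} : x ∈ Nm v a ↔ SplAt v a (x : K) := Iff.rfl

theorem LSg_le_Nm (v : AbsoluteValue K ℝ) (a : K) : LSg v ≤ Nm v a :=
  fun _ hx => splAt_of_lsq a hx

/-- transfer to an extension -/
theorem lsq_map {L : Type*} [Field L] [CharZero L] [Algebra K L] {v : AbsoluteValue K ℝ}
    {w : AbsoluteValue L ℝ}
    (h : ∀ ε : ℝ, 0 < ε → ∃ δ : ℝ, 0 < δ ∧ ∀ x : K, v x < δ → w (algebraMap K L x) < ε)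
    {x : K} (hx : LSq v x) : LSq w (algebraMap K L x) := by
  refine ⟨by simpa using hx.1, fun ε hε => ?_⟩
  obtain ⟨δ, hδ, H⟩ := h ε hε
  obtain ⟨y, hy⟩ := hx.2 δ hδ
  exact ⟨algebraMap K L y, by simpa using H _ hy⟩

theorem splAt_map {L : Type*} [Field L] [CharZero L] [Algebra K L] {v : AbsoluteValue K ℝ}
    {w : AbsoluteValue L ℝ}
    (h : ∀ ε : ℝ, 0 < ε → ∃ δ : ℝ, 0 < δ ∧ ∀ x : K, v x < δ → w (algebraMap K L x) < ε)
    {a b : K} (hx : SplAt v a b) : SplAt w (algebraMap K L a) (algebraMap K L b) := by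
  obtain ⟨p, q, z, hz, e⟩ := hx
  exact ⟨algebraMap K L p, algebraMap K L q, algebraMap K L z, lsq_map h hz, by
    rw [← map_mul, e]; simp⟩

end AbsLevel
end NND

end

section

namespace NND
set_option linter.unusedSectionVars false
set_option linter.unusedVariables false
open NumberField IsDedekindDomain WithZero

section Finite
variable {K : Type*} [Field K] [NumberField K]

/-- finite places -/
abbrev FP (K : Type*) [Field K] [NumberField K] := HeightOneSpectrum (𝓞 K)

/-- additive valuation (junk value `0` at `0`) -/
noncomputable def od (v : FP K) (x : K) : ℤ := - log (v.valuation K x)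

/-- `x ∈ π^n O_v` -/
def Ge (v : FP K) (n : ℤ) (x : K) : Prop := v.valuation K x ≤ exp (-n)

theorem val_eq (v : FP K) {x : K} (hx : x ≠ 0) : v.valuation K x = exp (- od v x) := by
  rw [od, neg_neg, exp_log]; simpa using hx

theorem ge_iff (v : FP K) {n : ℤ} {x : K} (hx : x ≠ 0) : Ge v n x ↔ n ≤ od v x := by
  rw [Ge, val_eq v hx, exp_le_exp]; omega

theorem ge_zero (v : FP K) (n : ℤ) : Ge v n (0 : K) := by simp [Ge]

theorem ge_mono {v : FP K} {m n : ℤ} {x : K} (hmn : m ≤ n) (h : Ge v n x) : Ge v m x :=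
  h.trans (by rw [exp_le_exp]; omega)

theorem ge_add {v : FP K} {n : ℤ} {x y : K} (hx : Ge v n x) (hy : Ge v n y) : Ge v n (x + y) :=
  (v.valuation K).map_add_le hx hy

theorem ge_neg {v : FP K} {n : ℤ} {x : K} (hx : Ge v n x) : Ge v n (-x) := by
  unfold Ge; rw [Valuation.map_neg]; exact hx

theorem ge_neg_iff {v : FP K} {n : ℤ} {x : K} : Ge v n (-x) ↔ Ge v n x := by
  unfold Ge; rw [Valuation.map_neg]

theorem ge_sub {v : FP K} {n : ℤ} {x y : K} (hx : Ge v n x) (hy : Ge v n y) : Ge v n (x - y) := by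
  rw [sub_eq_add_neg]; exact ge_add hx (ge_neg hy)

theorem ge_sub_comm {v : FP K} {n : ℤ} {x y : K} : Ge v n (x - y) ↔ Ge v n (y - x) := by
  rw [← ge_neg_iff, neg_sub]

theorem ge_mul {v : FP K} {m n : ℤ} {x y : K} (hx : Ge v m x) (hy : Ge v n y) :
    Ge v (m + n) (x * y) := by
  unfold Ge at *
  rw [map_mul, neg_add, exp_add]
  exact mul_le_mul' hx hy

theorem ge_mul' {v : FP K} {m n k : ℤ} {x y : K} (hx : Ge v m x) (hy : Ge v n y)
    (h : k ≤ m + n) : Ge v k (x * y) := ge_mono h (ge_mul hx hy)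

theorem ge_pow {v : FP K} {x : K} (hx : Ge v 0 x) (n : ℕ) : Ge v 0 (x ^ n) := by
  induction n with
  | zero => simp [Ge]
  | succ k ih => rw [pow_succ]; exact ge_mul' ih hx (by norm_num)

theorem ge_one (v : FP K) : Ge v 0 (1 : K) := by simp [Ge]

theorem ge_od (v : FP K) (x : K) : Ge v (od v x) x := by
  by_cases hx : x = 0
  · subst hx; exact ge_zero v _
  · exact (ge_iff v hx).2 le_rfl

theorem od_mul (v : FP K) {x y : K} (hx : x ≠ 0) (hy : y ≠ 0) : od v (x * y) = od v x + od v y := by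
  unfold od
  rw [map_mul, log_mul (by simpa using hx) (by simpa using hy)]; ring

@[simp] theorem od_one (v : FP K) : od v (1 : K) = 0 := by simp [od]
@[simp] theorem od_neg (v : FP K) (x : K) : od v (-x) = od v x := by simp [od, Valuation.map_neg]
@[simp] theorem od_inv (v : FP K) (x : K) : od v x⁻¹ = - od v x := by
  simp [od, map_inv₀, log_inv]
theorem od_div (v : FP K) {x y : K} (hx : x ≠ 0) (hy : y ≠ 0) : od v (x / y) = od v x - od v y := by
  rw [div_eq_mul_inv, od_mul v hx (inv_ne_zero hy), od_inv]; ring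
theorem od_pow (v : FP K) (x : K) (n : ℕ) : od v (x ^ n) = n * od v x := by
  simp [od, map_pow, log_pow]
theorem od_zpow (v : FP K) (x : K) (n : ℤ) : od v (x ^ n) = n * od v x := by
  simp [od, map_zpow₀, log_zpow]

theorem od_add_eq {v : FP K} {x y : K} (hx : x ≠ 0) (hy : Ge v (od v x + 1) y) :
    x + y ≠ 0 ∧ od v (x + y) = od v x := by
  have hlt : v.valuation K y < v.valuation K x := by
    rw [val_eq v hx]; refine lt_of_le_of_lt hy ?_; rw [exp_lt_exp]; omega
  have h := Valuation.map_add_eq_of_lt_left (v.valuation K) hlt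
  have h2 : v.valuation K (x + y) = v.valuation K x := by
    rw [add_comm, ← h]
    rw [Valuation.map_add_eq_of_lt_left (v.valuation K) hlt]
    exact Valuation.map_add_eq_of_lt_right (v.valuation K) hlt
  refine ⟨?_, by simp [od, h2]⟩
  intro h0
  rw [h0, map_zero] at h2
  exact hx (by simpa using h2.symm)

theorem unit_of_near {v : FP K} {x : K} (h : Ge v 1 (x - 1)) : x ≠ 0 ∧ od v x = 0 := by
  have := od_add_eq (v := v) (x := 1) (y := x - 1) one_ne_zero (by simpa using h)
  simpa using this

theorem ge_int (v : FP K) (r : 𝓞 K) : Ge v 0 (r : K) := by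
  simpa [Ge] using v.valuation_le_one (K := K) r

theorem ge_iff_mem (v : FP K) (n : ℕ) (r : 𝓞 K) : Ge v n (r : K) ↔ r ∈ v.asIdeal ^ n := by
  unfold Ge
  rw [show ((r : 𝓞 K) : K) = algebraMap (𝓞 K) K r from rfl, v.valuation_of_algebraMap,
    v.intValuation_le_pow_iff_mem]

theorem ge_one_iff_mem (v : FP K) (r : 𝓞 K) : Ge v 1 (r : K) ↔ r ∈ v.asIdeal := by
  have := ge_iff_mem v 1 r
  simpa using this

theorem od_int_nonneg (v : FP K) (r : 𝓞 K) : 0 ≤ od v (r : K) := by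
  by_cases h : (r : K) = 0
  · simp [od, h]
  · exact (ge_iff v h).1 (ge_int v r)

theorem od_nat_nonneg (v : FP K) (n : ℕ) : 0 ≤ od v (n : K) := by
  have := od_int_nonneg v (n : 𝓞 K)
  simpa using this

theorem ge_nat (v : FP K) (n : ℕ) : Ge v 0 (n : K) := by
  have := ge_int v (n : 𝓞 K)
  simpa using this

theorem exists_unif (v : FP K) : ∃ π : 𝓞 K, (π : K) ≠ 0 ∧ od v (π : K) = 1 := by
  obtain ⟨π, hπ⟩ := v.intValuation_exists_uniformizer
  have h : v.valuation K (π : K) = exp (-1 : ℤ) := by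
    rw [show ((π : 𝓞 K) : K) = algebraMap (𝓞 K) K π from rfl, v.valuation_of_algebraMap, hπ]
  refine ⟨π, ?_, ?_⟩
  · intro h0; rw [h0, map_zero] at h; exact exp_ne_zero h.symm
  · rw [od, h, log_exp]; ring

theorem exists_int_approx (v : FP K) {x : K} (hx : Ge v 0 x) (n : ℤ) :
    ∃ r : 𝓞 K, Ge v n (x - r) := by
  obtain ⟨a, ha⟩ := v.exists_valuation_sub_lt_of_integer (K := K) (x := x) (by simpa [Ge] using hx)
    (γ := Units.mk0 (exp (-n)) exp_ne_zero)
  refine ⟨a, ?_⟩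
  rw [ge_sub_comm]
  exact ha.le

/-- absolute value -/
noncomputable def fabv (v : FP K) : AbsoluteValue K ℝ := HeightOneSpectrum.adicAbv K v

theorem fabv_eq (v : FP K) {x : K} (hx : x ≠ 0) :
    fabv v x = (Ideal.absNorm v.asIdeal : ℝ) ^ (- od v x) := by
  unfold fabv
  rw [HeightOneSpectrum.adicAbv_def,
    WithZeroMulInt.toNNReal_neg_apply _ (by simpa using hx)]
  rw [toAdd_unzero_eq_log]
  simp [od]

theorem absNorm_gt (v : FP K) : (1 : ℝ) < Ideal.absNorm v.asIdeal := by
  exact_mod_cast HeightOneSpectrum.one_lt_absNorm v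

theorem fabv_le_iff (v : FP K) (n : ℤ) (x : K) :
    fabv v x ≤ (Ideal.absNorm v.asIdeal : ℝ) ^ (-n) ↔ Ge v n x := by
  by_cases hx : x = 0
  · subst hx
    simp only [map_zero, ge_zero, iff_true]
    have := absNorm_gt v
    positivity
  · rw [fabv_eq v hx, ge_iff v hx, zpow_le_zpow_iff_right₀ (absNorm_gt v)]; omega

theorem exists_ge_of_eps (v : FP K) {ε : ℝ} (hε : 0 < ε) :
    ∃ n : ℕ, ∀ x : K, Ge v n x → fabv v x < ε := by
  have h1 := absNorm_gt v
  obtain ⟨n, hn⟩ := exists_pow_lt_of_lt_one hε (inv_lt_one_of_one_lt₀ h1)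
  refine ⟨n, fun x hx => ((fabv_le_iff v n x).2 hx).trans_lt ?_⟩
  rw [zpow_neg, zpow_natCast, ← inv_pow]; exact hn

theorem ge_of_fabv {v : FP K} {n : ℤ} {x : K}
    (h : fabv v x < (Ideal.absNorm v.asIdeal : ℝ) ^ (-n)) : Ge v n x :=
  (fabv_le_iff v n x).1 h.le

theorem eps_pos (v : FP K) (n : ℤ) : 0 < (Ideal.absNorm v.asIdeal : ℝ) ^ n := by
  have := absNorm_gt v; positivity

/-- criterion for local squares at finite places -/
theorem lsq_fin_of {v : FP K} {x y : K} (hx : x ≠ 0) (h : Ge v (od v (4 : K) + 1) (x * y ^ 2 - 1)) :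
    LSq (fabv v) x := by
  have h40 : 0 ≤ od v (4 : K) := by exact_mod_cast od_nat_nonneg v 4
  refine ⟨hx, fun ε hε => ?_⟩
  obtain ⟨n, hn⟩ := exists_ge_of_eps v hε
  have key : ∀ k : ℕ, ∃ y : K, Ge v (od v (4 : K) + 1 + k) (x * y ^ 2 - 1) := by
    intro k
    induction k with
    | zero => exact ⟨y, by simpa using h⟩
    | succ k ih =>
      obtain ⟨y, hy⟩ := ih
      set e := x * y ^ 2 - 1 with he
      refine ⟨y * (1 - e / 2), ?_⟩
      have e1 : x * (y * (1 - e / 2)) ^ 2 - 1 = - (e * e * ((3 - e) * (4 : K)⁻¹)) := by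
        have h2 : x * y ^ 2 = 1 + e := by rw [he]; ring
        have : x * (y * (1 - e / 2)) ^ 2 - 1 = (x * y ^ 2) * (1 - e / 2) ^ 2 - 1 := by ring
        rw [this, h2]; ring
      rw [e1, ge_neg_iff]
      have h3 : Ge v 0 (3 - e) := ge_sub (by exact_mod_cast ge_nat v 3) (ge_mono (by omega) hy)
      have h4 : Ge v (- od v (4:K)) ((4 : K)⁻¹) := by
        rw [← od_inv]; exact ge_od v _
      refine ge_mul' (ge_mul hy hy) (ge_mul h3 h4) ?_
      push_cast; omega
  obtain ⟨y, hy⟩ := key n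
  exact ⟨y, hn _ (ge_mono (by omega) hy)⟩

theorem exists_of_lsq_fin {v : FP K} {x : K} (h : LSq (fabv v) x) (n : ℤ) :
    ∃ y, Ge v n (x * y ^ 2 - 1) := by
  obtain ⟨y, hy⟩ := h.2 _ (eps_pos v (-n))
  exact ⟨y, ge_of_fabv hy⟩

theorem lsq_fin_even {v : FP K} {x : K} (h : LSq (fabv v) x) : Even (od v x) := by
  obtain ⟨y, hy⟩ := exists_of_lsq_fin h 1
  obtain ⟨h0, h1⟩ := unit_of_near hy
  have hy0 : y ≠ 0 := by rintro rfl; simp at h0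
  rw [od_mul v h.1 (pow_ne_zero 2 hy0), od_pow] at h1
  push_cast at h1
  exact ⟨- od v y, by omega⟩

/-- units close to a nonzero square are local squares -/
theorem lsq_fin_of' {v : FP K} {a x : K} (ha : a ≠ 0) (ha1 : od v a = 0)
    (h : Ge v (od v (4 : K) + 1) (a - x ^ 2)) : LSq (fabv v) a := by
  have h40 : 0 ≤ od v (4 : K) := by exact_mod_cast od_nat_nonneg v 4
  have hx := od_add_eq (v := v) (x := a) (y := -(a - x ^ 2)) ha
    (ge_neg (ge_mono (by omega) h))
  rw [show a + -(a - x ^ 2) = x ^ 2 by ring, ha1] at hx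
  have hx0 : x ≠ 0 := by rintro rfl; simp at hx
  refine lsq_fin_of (y := x⁻¹) ha ?_
  have : a * x⁻¹ ^ 2 - 1 = (a - x ^ 2) * (x ^ 2)⁻¹ := by field_simp
  rw [this]
  refine ge_mul' h (ge_od v _) ?_
  rw [od_inv, hx.2]; omega

end Finite
end NND

end

section

namespace NND
set_option linter.unusedSectionVars false
set_option linter.unusedVariables false
open NumberField IsDedekindDomain WithZero

section Finite
variable {K : Type*} [Field K] [NumberField K]

theorem chain_add {F : Type*} [Field F] [CharZero F] {α β : F} (ha : α ≠ 0) (hab : α + β ≠ 0) :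
    Chain 3 α β (α + β) (-(α * β)) := by
  refine ⟨α, β * (0 ^ 2 - α * 1 ^ 2), ⟨0, 1, by simpa using ha, Or.inr ⟨rfl, rfl⟩⟩,
    _, _, mv_swap _ _, α + β, -(α*β), ?_, ?_⟩
  · refine ⟨1, 1 / α, ?_, Or.inl ⟨?_, by ring⟩⟩
    · have : (1:F) ^ 2 - β * (0 ^ 2 - α * 1 ^ 2) * (1 / α) ^ 2 = (α + β) / α := by field_simp; ring
      rw [this]; exact div_ne_zero hab ha
    · field_simp; ring
  · exact ⟨rfl, rfl⟩

/-- The residue field. -/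
noncomputable abbrev kf (v : FP K) := 𝓞 K ⧸ v.asIdeal

noncomputable instance (v : FP K) : Field (kf v) :=
  haveI := v.isMaximal
  Ideal.Quotient.field v.asIdeal

noncomputable instance (v : FP K) : Finite (kf v) := Ideal.finiteQuotientOfFreeOfNeBot v.asIdeal v.ne_bot

theorem red_eq_iff (v : FP K) (r s : 𝓞 K) :
    (Ideal.Quotient.mk v.asIdeal r = Ideal.Quotient.mk v.asIdeal s) ↔ Ge v 1 ((r : K) - s) := by
  rw [Ideal.Quotient.eq, ← ge_one_iff_mem]; simp

/-- `κ = 1 - 4δ` generates the unramified quadratic extension at `v`. -/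
def Unr (v : FP K) (κ : K) : Prop :=
  ∃ δ : K, Ge v 0 δ ∧ κ = 1 - 4 * δ ∧ ∀ t : K, Ge v 0 t → ¬ Ge v 1 (t ^ 2 - t + δ)

theorem exists_delta (v : FP K) :
    ∃ δ : 𝓞 K, ∀ t : K, Ge v 0 t → ¬ Ge v 1 (t ^ 2 - t + δ) := by
  have hns : ¬ Function.Surjective (fun t : kf v => t ^ 2 - t) := by
    intro hs
    have hi := Finite.injective_iff_surjective.2 hs
    have : (0 : kf v) = 1 := hi (by simp)
    exact zero_ne_one this
  simp only [Function.Surjective, not_forall, not_exists] at hns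
  obtain ⟨d, hd⟩ := hns
  obtain ⟨e, rfl⟩ := Ideal.Quotient.mk_surjective d
  refine ⟨-e, fun t ht h => ?_⟩
  obtain ⟨r, hr⟩ := exists_int_approx v ht 1
  apply hd (Ideal.Quotient.mk _ r)
  rw [← map_pow, ← map_sub, red_eq_iff]
  have : ((r ^ 2 - r : 𝓞 K) : K) - (e : K) = (t ^ 2 - t + ((-e : 𝓞 K) : K)) - (t - r) * (t + r - 1) := by
    push_cast; ring
  rw [this]
  refine ge_sub h (ge_mul' hr ?_ (by norm_num : (1:ℤ) ≤ 1 + 0))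
  exact ge_sub (ge_add ht (ge_int v r)) (ge_one v)

theorem exists_unr (v : FP K) : ∃ κ : 𝓞 K, Unr v (κ : K) := by
  obtain ⟨δ, hδ⟩ := exists_delta v
  exact ⟨1 - 4 * δ, δ, ge_int v δ, by push_cast; rfl, hδ⟩

theorem aniso_even {v : FP K} {δ : K} (h0 : Ge v 0 δ)
    (hδ : ∀ t : K, Ge v 0 t → ¬ Ge v 1 (t ^ 2 - t + δ)) {X Y : K}
    (h : X ^ 2 - X * Y + δ * Y ^ 2 ≠ 0) : Even (od v (X ^ 2 - X * Y + δ * Y ^ 2)) := by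
  have unit : ∀ t : K, Ge v 0 t → t ^ 2 - t + δ ≠ 0 ∧ od v (t ^ 2 - t + δ) = 0 := by
    intro t ht
    have h1 := hδ t ht
    have hne : t ^ 2 - t + δ ≠ 0 := by intro h; apply h1; rw [h]; exact ge_zero v 1
    refine ⟨hne, ?_⟩
    have h2 : Ge v 0 (t ^ 2 - t + δ) := ge_add (ge_sub (ge_pow ht 2) ht) h0
    rw [ge_iff v hne] at h1 h2
    omega
  by_cases hY : Y = 0
  · subst hY
    have : X ^ 2 - X * 0 + δ * 0 ^ 2 = X ^ 2 := by ring
    rw [this, od_pow]; exact ⟨od v X, by push_cast; ring⟩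
  by_cases hX : Ge v 0 (X / Y)
  · have e : X ^ 2 - X * Y + δ * Y ^ 2 = ((X / Y) ^ 2 - X / Y + δ) * Y ^ 2 := by field_simp
    obtain ⟨h1, h2⟩ := unit _ hX
    rw [e, od_mul v h1 (pow_ne_zero 2 hY), h2, od_pow]
    exact ⟨od v Y, by push_cast; ring⟩
  · have hX0 : X ≠ 0 := by rintro rfl; apply hX; simpa using ge_zero v 0
    have hs : Ge v 1 (Y / X) := by
      rw [ge_iff v (div_ne_zero hX0 hY)] at hX
      rw [ge_iff v (div_ne_zero hY hX0), od_div v hY hX0]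
      rw [od_div v hX0 hY] at hX; omega
    have e : X ^ 2 - X * Y + δ * Y ^ 2 = (1 + (-(Y / X) + δ * (Y / X * (Y / X)))) * X ^ 2 := by
      field_simp; ring
    have hs0 : Ge v 0 (Y / X) := ge_mono (by norm_num) hs
    obtain ⟨h1, h2⟩ := od_add_eq (v := v) (x := 1) (y := -(Y / X) + δ * (Y / X * (Y / X)))
      one_ne_zero (by
        rw [od_one]
        exact ge_add (ge_neg hs) (ge_mul' h0 (ge_mul hs hs0) (by norm_num)))
    rw [e, od_mul v h1 (pow_ne_zero 2 hX0), h2, od_pow]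
    exact ⟨od v X, by simp; ring⟩

theorem unr_even {v : FP K} {κ b : K} (hκ : Unr v κ) (hb : b ≠ 0) (h : SplAt (fabv v) κ b) :
    Even (od v b) := by
  obtain ⟨δ, h0, rfl, hδ⟩ := hκ
  obtain ⟨p, q, z, hz, e⟩ := h
  have hbz : b * z ≠ 0 := mul_ne_zero hb hz.1
  have e2 : b * z = (2 : K) ^ 2 * (((p + q) / 2) ^ 2 - ((p + q) / 2) * q + δ * q ^ 2) := by
    rw [e]; ring
  have hne : ((p + q) / 2) ^ 2 - ((p + q) / 2) * q + δ * q ^ 2 ≠ 0 := by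
    intro h; rw [h, mul_zero] at e2; exact hbz e2
  have hev := aniso_even h0 hδ hne
  have := congrArg (od v) e2
  rw [od_mul v hb hz.1, od_mul v (by norm_num) hne, od_pow] at this
  have hz2 := lsq_fin_even hz
  obtain ⟨c, hc⟩ := hev
  obtain ⟨d, hd⟩ := hz2
  exact ⟨od v (2:K) + c - d, by push_cast at this; omega⟩

theorem unr_ne_zero {v : FP K} {κ : K} (hκ : Unr v κ) : κ ≠ 0 := by
  obtain ⟨δ, h0, rfl, hδ⟩ := hκ
  intro h
  -- `δ = 1/4`, root `1/2`
  obtain ⟨π, hπ0, hπ⟩ := exists_unif v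
  have h4 : (4 : K) * δ = 1 := by linear_combination -h
  have hδ0 : δ ≠ 0 := by rintro rfl; simp at h4
  have h42 : od v (4:K) = 0 := by
    have := congrArg (od v) h4
    rw [od_mul v (by norm_num) hδ0, od_one] at this
    have h40 : 0 ≤ od v (4 : K) := by exact_mod_cast od_nat_nonneg v 4
    have := (ge_iff v hδ0).1 h0
    omega
  have h2 : od v (2:K) = 0 := by
    rw [show (4:K) = 2 ^ 2 by norm_num, od_pow] at h42
    push_cast at h42; omega
  apply hδ (2⁻¹) (by rw [ge_iff v (by norm_num), od_inv, h2]; rfl)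
  have : (2⁻¹ : K) ^ 2 - 2⁻¹ + δ = 0 := by linear_combination h4 / 4
  rw [this]; exact ge_zero v 1

theorem unr_not_lsq {v : FP K} {κ : K} (hκ : Unr v κ) : ¬ LSq (fabv v) κ := by
  intro h
  obtain ⟨π, hπ0, hπ⟩ := exists_unif v
  have := unr_even hκ hπ0 (splAt_of_lsq_left hπ0 h)
  rw [hπ] at this
  exact absurd this (by decide)

theorem od4 (v : FP K) : od v (4 : K) = 2 * od v (2 : K) := by
  rw [show (4:K) = 2 ^ 2 by norm_num, od_pow]; push_cast; ring

/-- nondegeneracy of the local symbol, unit case -/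
theorem nondeg_unit {v : FP K} {a : K} (ha : a ≠ 0) (ha1 : od v a = 0) (h : ¬ LSq (fabv v) a) :
    ∃ b : K, b ≠ 0 ∧ ¬ SplAt (fabv v) a b := by
  classical
  have h20 : 0 ≤ od v (2 : K) := by exact_mod_cast od_nat_nonneg v 2
  have h4 := od4 v
  obtain ⟨E, hE⟩ := Int.eq_ofNat_of_zero_le h20
  -- maximal approximation by squares
  let P : ℕ → Prop := fun d => ∃ x : K, Ge v d (a - x ^ 2)
  have hP0 : P 0 := ⟨0, by simpa [ge_iff v ha] using ha1.ge⟩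
  let d := Nat.findGreatest P (2 * E)
  have hPd : P d := Nat.findGreatest_spec (P := P) (Nat.zero_le _) hP0
  have hdle : d ≤ 2 * E := Nat.findGreatest_le _
  have hmax : ¬ P (d + 1) := by
    intro hP
    rcases Nat.lt_or_ge d (2 * E) with hlt | hge
    · have := Nat.le_findGreatest (P := P) (n := 2 * E) (m := d + 1) hlt hP
      change d + 1 ≤ d at this
      omega
    · obtain ⟨x, hx⟩ := hP
      apply h
      refine lsq_fin_of' ha ha1 (ge_mono ?_ hx)
      push_cast; omega
  -- choose `x` a unit
  obtain ⟨x, hx0, hx1, hx⟩ : ∃ x : K, x ≠ 0 ∧ od v x = 0 ∧ Ge v d (a - x ^ 2) := by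
    rcases Nat.eq_zero_or_pos d with hd0 | hdpos
    · refine ⟨1, one_ne_zero, od_one v, ?_⟩
      rw [hd0]
      exact ge_sub (by simpa [ge_iff v ha] using ha1.ge) (by simpa using ge_one v)
    · obtain ⟨x, hx⟩ := hPd
      have h1 := od_add_eq (v := v) (x := a) (y := -(a - x ^ 2)) ha
        (ge_neg (ge_mono (by omega) hx))
      rw [show a + -(a - x ^ 2) = x ^ 2 by ring, ha1, od_pow] at h1
      have hx0 : x ≠ 0 := by rintro rfl; simp at h1
      exact ⟨x, hx0, by have := h1.2; push_cast at this; omega, hx⟩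
  have hnot : ¬ Ge v (d + 1 : ℕ) (a - x ^ 2) := fun h => hmax ⟨x, h⟩
  have htne : a - x ^ 2 ≠ 0 := by intro h; apply hnot; rw [h]; exact ge_zero v _
  have htod : od v (a - x ^ 2) = d := by
    rw [ge_iff v htne] at hx hnot; push_cast at hnot; omega
  set t := (a - x ^ 2) / x ^ 2 with ht
  have hx2 : x ^ 2 ≠ 0 := pow_ne_zero 2 hx0
  have ht0 : t ≠ 0 := div_ne_zero htne hx2
  have htd : od v t = d := by
    rw [ht, od_div v htne hx2, htod, od_pow, hx1]; push_cast; ring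
  have ha' : a / x ^ 2 = 1 + t := by rw [ht]; field_simp; ring
  have h1t : (1 : K) + t ≠ 0 := by rw [← ha']; exact div_ne_zero ha hx2
  have hcong : ∀ b : K, b ≠ 0 → (SplAt (fabv v) a b ↔ SplAt (fabv v) (1 + t) b) := by
    intro b hb
    refine splAt_congr_left ha h1t hb ?_
    rw [← ha', show a * (a / x ^ 2) = (a / x) ^ 2 by field_simp]
    exact lsq_sq _ (div_ne_zero ha hx0)
  rcases hdle.lt_or_eq with hlt | heq
  · rcases Nat.even_or_odd' d with ⟨k, hk | hk⟩
    · -- even: contradiction with maximality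
      exfalso
      obtain ⟨π, hπ0, hπ⟩ := exists_unif v
      have hu0 : (a - x ^ 2) / (π : K) ^ (2 * k) ≠ 0 := div_ne_zero htne (pow_ne_zero _ hπ0)
      have hu : Ge v 0 ((a - x ^ 2) / (π : K) ^ (2 * k)) := by
        rw [ge_iff v hu0, od_div v htne (pow_ne_zero _ hπ0), htod, od_pow, hπ, hk]
        push_cast; omega
      obtain ⟨r, hr⟩ := exists_int_approx v hu 1
      -- residue characteristic two
      have h2v : Ge v 1 (2 : K) := by rw [ge_iff v two_ne_zero]; omega
      have hinj : Function.Injective (fun s : kf v => s ^ 2) := by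
        intro s s' hss
        obtain ⟨s, rfl⟩ := Ideal.Quotient.mk_surjective s
        obtain ⟨s', rfl⟩ := Ideal.Quotient.mk_surjective s'
        have h2 : (2 : kf v) = 0 := by
          have := (red_eq_iff v 2 0).2 (by
            have e : (((2 : 𝓞 K) : K) - ((0 : 𝓞 K) : K)) = 2 := by
              have e1 : ((2 : 𝓞 K) : K) = 2 := map_ofNat (algebraMap (𝓞 K) K) 2
              rw [e1]; simp
            rw [e]; exact h2v)
          rw [map_zero] at this
          rw [← this]; exact (map_ofNat (Ideal.Quotient.mk v.asIdeal) 2).symm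
        have : (Ideal.Quotient.mk v.asIdeal s - Ideal.Quotient.mk v.asIdeal s') ^ 2 = 0 := by
          simp only at hss
          linear_combination hss + (- Ideal.Quotient.mk v.asIdeal s * Ideal.Quotient.mk v.asIdeal s'
            + Ideal.Quotient.mk v.asIdeal s' ^ 2) * h2
        exact sub_eq_zero.1 (pow_eq_zero_iff (two_ne_zero) |>.1 this)
      obtain ⟨z, hz⟩ := Finite.surjective_of_injective hinj (Ideal.Quotient.mk _ r)
      obtain ⟨z, rfl⟩ := Ideal.Quotient.mk_surjective z
      simp only [← map_pow] at hz
      rw [red_eq_iff] at hz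
      refine hmax ⟨x + π ^ k * z, ?_⟩
      have e : a - (x + (π:K) ^ k * z) ^ 2 =
        (π:K) ^ (2 * k) * (((a - x ^ 2) / (π : K) ^ (2 * k) - r) - (((z ^ 2 : 𝓞 K) : K) - r))
          - 2 * (x * ((π : K) ^ k * z)) := by
        push_cast; field_simp; ring
      rw [e]
      have hπk : ∀ j : ℕ, Ge v j ((π : K) ^ j) := by
        intro j; have := ge_od v ((π : K) ^ j); rw [od_pow, hπ] at this; simpa using this
      refine ge_sub (ge_mul' (hπk _) (ge_sub hr hz) (by push_cast; omega)) ?_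
      have hgx : Ge v 0 x := by rw [ge_iff v hx0, hx1]
      refine ge_mul' (ge_od v (2:K)) (ge_mul hgx (ge_mul (hπk k) (ge_int v z))) (by push_cast; omega)
    · -- odd
      obtain ⟨δ, hδ⟩ := exists_delta v
      have hUnr : Unr v (1 - 4 * (δ : K)) := ⟨δ, ge_int v δ, rfl, hδ⟩
      have hδ1 : ¬ Ge v 1 (δ : K) := by have := hδ 0 (ge_zero v 0); simpa using this
      have hδ0 : (δ : K) ≠ 0 := by intro h; apply hδ1; rw [h]; exact ge_zero v _
      have hδu : od v (δ : K) = 0 := by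
        rw [ge_iff v hδ0] at hδ1; have := od_int_nonneg v δ; omega
      set s := 4 * (δ : K) / t with hs
      have h4δ : (4 : K) * δ ≠ 0 := mul_ne_zero (by norm_num) hδ0
      have hsod : od v s = 2 * E - d := by
        rw [hs, od_div v h4δ ht0, od_mul v (by norm_num) hδ0, htd, hδu]; omega
      have hs0 : s ≠ 0 := div_ne_zero h4δ ht0
      obtain ⟨h1s, h1s'⟩ := od_add_eq (v := v) (x := 1) (y := s) one_ne_zero (by
        rw [ge_iff v hs0, od_one, hsod]; omega)
      refine ⟨1 + s, h1s, fun hsp => ?_⟩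
      rw [hcong _ h1s] at hsp
      have hsp2 : SplAt (fabv v) (1 + t) ((1 + s) * (-t)) :=
        splAt_mul hsp (splAt_of_spl _ ⟨1, 1, by ring⟩)
      have hβ : (1 + s) * (-t) ≠ 0 := mul_ne_zero h1s (neg_ne_zero.2 ht0)
      have hsum : (1 + t) + (1 + s) * (-t) = 1 - 4 * (δ : K) := by
        rw [hs]; field_simp; ring
      have hch := chain_add (α := 1 + t) (β := (1 + s) * (-t)) h1t
        (by rw [hsum]; exact unr_ne_zero hUnr)
      have h3 := (chain_splAt (fabv v) h1t hβ hch).1 hsp2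
      rw [hsum] at h3
      have := unr_even hUnr (neg_ne_zero.2 (mul_ne_zero h1t hβ)) h3
      obtain ⟨_, h1t'⟩ := od_add_eq (v := v) (x := 1) (y := t) one_ne_zero (by
        rw [ge_iff v ht0, od_one, htd]; omega)
      rw [od_neg, od_mul v h1t hβ, od_mul v h1s (neg_ne_zero.2 ht0), h1s', h1t', od_neg, htd] at this
      obtain ⟨c, hc⟩ := this
      rw [od_one] at hc
      omega
  · -- unramified
    obtain ⟨π, hπ0, hπ⟩ := exists_unif v
    have hUnr : Unr v (1 + t) := by
      refine ⟨-t / 4, ?_, by ring, ?_⟩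
      · have hne : -t / 4 ≠ 0 := div_ne_zero (neg_ne_zero.2 ht0) (by norm_num)
        rw [ge_iff v hne, od_div v (neg_ne_zero.2 ht0) (by norm_num), od_neg, htd]; omega
      · intro τ hτ hge
        apply hmax
        refine ⟨x * (1 - 2 * τ), ?_⟩
        have : a - (x * (1 - 2 * τ)) ^ 2 = (-4) * (x ^ 2 * (τ ^ 2 - τ + -t / 4)) := by
          have : a = x ^ 2 * (1 + t) := by rw [← ha']; field_simp
          rw [this]; ring
        rw [this]
        have hgx : Ge v 0 (x ^ 2) := by rw [ge_iff v hx2, od_pow, hx1]; simp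
        refine ge_mul' (ge_od v (-4 : K)) (ge_mul hgx hge) ?_
        rw [od_neg]; push_cast; omega
    refine ⟨π, hπ0, fun hsp => ?_⟩
    rw [hcong _ hπ0] at hsp
    have := unr_even hUnr hπ0 hsp
    rw [hπ] at this
    exact absurd this (by decide)

theorem unit_rep {v : FP K} {a : K} (ha : a ≠ 0) (h : Even (od v a)) :
    ∃ c : K, c ≠ 0 ∧ od v (a * c ^ 2) = 0 := by
  obtain ⟨π, hπ0, hπ⟩ := exists_unif v
  obtain ⟨k, hk⟩ := h
  refine ⟨(π : K) ^ (-k), zpow_ne_zero _ hπ0, ?_⟩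
  rw [od_mul v ha (pow_ne_zero 2 (zpow_ne_zero _ hπ0)), od_pow, od_zpow, hπ]
  push_cast; omega

theorem lsq_mul_sq {v : AbsoluteValue K ℝ} {a c : K} (hc : c ≠ 0) :
    LSq v (a * c ^ 2) ↔ LSq v a := by
  refine ⟨fun h => ?_, fun h => lsq_mul h (lsq_sq v hc)⟩
  have := lsq_div h (lsq_sq v hc)
  rwa [mul_div_cancel_right₀ _ (pow_ne_zero 2 hc)] at this

/-- nondegeneracy of the local symbol at finite places -/
theorem nondeg_fin {v : FP K} {a : K} (ha : a ≠ 0) (h : ¬ LSq (fabv v) a) :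
    ∃ b : K, b ≠ 0 ∧ ¬ SplAt (fabv v) a b := by
  by_cases hev : Even (od v a)
  · obtain ⟨c, hc, hod⟩ := unit_rep ha hev
    obtain ⟨b, hb, hsp⟩ := nondeg_unit (mul_ne_zero ha (pow_ne_zero 2 hc)) hod
      (by rwa [lsq_mul_sq hc])
    refine ⟨b, hb, fun h => hsp ?_⟩
    refine (splAt_congr_left ha (mul_ne_zero ha (pow_ne_zero 2 hc)) hb ?_).1 h
    rw [show a * (a * c ^ 2) = (a * c) ^ 2 by ring]
    exact lsq_sq _ (mul_ne_zero ha hc)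
  · obtain ⟨κ, hκ⟩ := exists_unr v
    exact ⟨κ, unr_ne_zero hκ, fun h => hev (unr_even hκ ha (splAt_symm ha (unr_ne_zero hκ) h))⟩

end Finite
end NND

end

section

namespace NND
set_option linter.unusedSectionVars false
set_option linter.unusedVariables false
open NumberField IsDedekindDomain WithZero

section Places
variable {K : Type*} [Field K] [NumberField K]

/-- All places of `K`. -/
abbrev Pl (K : Type*) [Field K] [NumberField K] := FP K ⊕ InfinitePlace K

noncomputable def pav : Pl K → AbsoluteValue K ℝ
  | Sum.inl v => fabv v
  | Sum.inr w => w.1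

@[simp] theorem pav_inl (v : FP K) : pav (Sum.inl v : Pl K) = fabv v := rfl
@[simp] theorem pav_inr (w : InfinitePlace K) : pav (Sum.inr w : Pl K) = w.1 := rfl

theorem fabv_lt_one_iff (v : FP K) {x : K} : fabv v x < 1 ↔ Ge v 1 x := by
  by_cases hx : x = 0
  · subst hx; simp [ge_zero]
  · rw [fabv_eq v hx, ge_iff v hx]
    rw [show (1:ℝ) = (Ideal.absNorm v.asIdeal : ℝ) ^ (0:ℤ) by simp,
      zpow_lt_zpow_iff_right₀ (absNorm_gt v)]
    omega

theorem exists_sep {v w : FP K} (h : v ≠ w) : ∃ r : 𝓞 K, Ge v 1 (r : K) ∧ ¬ Ge w 1 (r : K) := by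
  have hle : ¬ v.asIdeal ≤ w.asIdeal := by
    intro hle
    exact h (HeightOneSpectrum.ext (v.isMaximal.eq_of_le w.isPrime.ne_top hle))
  obtain ⟨r, hr, hr'⟩ := SetLike.not_le_iff_exists.1 hle
  exact ⟨r, (ge_one_iff_mem v r).2 hr, fun h => hr' ((ge_one_iff_mem w r).1 h)⟩

theorem pav_nontrivial (v : Pl K) : (pav v).IsNontrivial := by
  rcases v with v | w
  · obtain ⟨π, hπ0, hπ⟩ := exists_unif v
    refine ⟨π, hπ0, ?_⟩
    have : fabv v (π : K) < 1 := by rw [fabv_lt_one_iff, ge_iff v hπ0, hπ]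
    exact this.ne
  · exact w.isNontrivial

theorem inf_two (w : InfinitePlace K) : w.1 (2 : K) = 2 := by
  have h : w.1 (2 : K) = ‖w.embedding 2‖ := (InfinitePlace.norm_embedding_eq w 2).symm
  rw [h, map_ofNat]; norm_num

theorem not_equiv_fin_inf (v : FP K) (w : InfinitePlace K) : ¬ (fabv v).IsEquiv w.1 := by
  intro h
  have h1 := (h 2 1).1 (by
    have := (fabv_le_iff v 0 (2 : K)).2 (by exact_mod_cast ge_nat v 2)
    simpa using this)
  rw [inf_two, map_one] at h1
  norm_num at h1

theorem pav_inequiv {v w : Pl K} (h : v ≠ w) : ¬ (pav v).IsEquiv (pav w) := by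
  rcases v with v | v <;> rcases w with w | w
  · intro he
    obtain ⟨r, hr, hr'⟩ := exists_sep (v := v) (w := w) (fun h' => h (by rw [h']))
    have := (he.lt_one_iff (x := (r : K))).1 ((fabv_lt_one_iff v).2 hr)
    exact hr' ((fabv_lt_one_iff w).1 this)
  · exact not_equiv_fin_inf v w
  · exact fun he => not_equiv_fin_inf w v (fun x y => (he x y).symm)
  · exact fun he => h (by rw [(InfinitePlace.eq_iff_isEquiv).2 he])

theorem weak_approx (B : Finset (Pl K)) (z : Pl K → K) {ε : ℝ} (hε : 0 < ε) :
    ∃ x : K, ∀ v ∈ B, pav v (x - z v) < ε := by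
  have hd := AbsoluteValue.denseRange_algebraMap_pi (ι := B) (v := fun i : B => pav i.1)
    (fun i => pav_nontrivial _) (fun i j hij => pav_inequiv (fun h => hij (Subtype.ext h)))
  obtain ⟨x, hx⟩ := Metric.denseRange_iff.1 hd (fun i => (WithAbs.equiv (pav i.1)).symm (z i.1)) ε hε
  refine ⟨x, fun v hv => ?_⟩
  have h1 := (dist_pi_lt_iff hε).1 hx ⟨v, hv⟩
  rw [dist_comm, dist_eq_norm] at h1
  exact h1

/-- weak approximation with individual radii -/
theorem weak_approx' (B : Finset (Pl K)) (z : Pl K → K) (ε : Pl K → ℝ) (hε : ∀ v, 0 < ε v) :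
    ∃ x : K, ∀ v ∈ B, pav v (x - z v) < ε v := by
  obtain ⟨δ, hδ, hδ'⟩ : ∃ δ : ℝ, 0 < δ ∧ ∀ v ∈ B, δ ≤ ε v := by
    induction B using Finset.cons_induction with
    | empty => exact ⟨1, one_pos, by simp⟩
    | cons a s ha ih =>
      obtain ⟨δ, h1, h2⟩ := ih
      refine ⟨min δ (ε a), lt_min h1 (hε a), ?_⟩
      intro v hv
      rcases Finset.mem_cons.1 hv with rfl | hv
      · exact min_le_right _ _
      · exact (min_le_left _ _).trans (h2 v hv)
  obtain ⟨x, hx⟩ := weak_approx B z hδ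
  exact ⟨x, fun v hv => (hx v hv).trans_le (hδ' v hv)⟩

theorem lsq_ratio_iff {v : AbsoluteValue K ℝ} {x y : K} (hy : y ≠ 0) : LSq v (x / y) ↔ LSq v (x * y) := by
  rw [← lsq_mul_sq (a := x / y) hy]
  rw [show x / y * y ^ 2 = x * y by field_simp]

/-- prescribing square classes (with extra closeness) -/
theorem exists_class (B : Finset (Pl K)) (hB : B.Nonempty) (z : Pl K → K) (hz : ∀ v, z v ≠ 0)
    (ε : Pl K → ℝ) (hε : ∀ v, 0 < ε v) :
    ∃ x : K, x ≠ 0 ∧ ∀ v ∈ B, LSq (pav v) (x * z v) ∧ pav v (x - z v) < ε v := by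
  obtain ⟨x, hx⟩ := weak_approx' B z (fun v => min (ε v) (rad (pav v) * pav v (z v)))
    (fun v => lt_min (hε v) (mul_pos (rad_pos _) ((pav v).pos (hz v))))
  have key : ∀ v ∈ B, LSq (pav v) (x / z v) := fun v hv =>
    lsq_of_near (hz v) ((hx v hv).trans_le (min_le_right _ _))
  obtain ⟨v0, hv0⟩ := hB
  refine ⟨x, ?_, fun v hv => ⟨(lsq_ratio_iff (hz v)).1 (key v hv), (hx v hv).trans_le (min_le_left _ _)⟩⟩
  intro h
  have := (key v0 hv0).1
  simp [h] at this

theorem exists_class' (B : Finset (Pl K)) (z : Pl K → K) (hz : ∀ v ∈ B, z v ≠ 0) :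
    ∃ x : K, x ≠ 0 ∧ ∀ v ∈ B, LSq (pav v) (x * z v) := by
  classical
  rcases B.eq_empty_or_nonempty with rfl | hB
  · exact ⟨1, one_ne_zero, by simp⟩
  obtain ⟨x, hx, h⟩ := exists_class B hB (fun v => if v ∈ B then z v else 1)
    (fun v => by split_ifs with h; exacts [hz v h, one_ne_zero]) (fun _ => 1) (fun _ => one_pos)
  refine ⟨x, hx, fun v hv => ?_⟩
  simpa [hv] using (h v hv).1

/-! ### infinite places -/

theorem real_abs {w : InfinitePlace K} (hw : w.IsReal) (x : K) :
    w.1 x = |InfinitePlace.embedding_of_isReal hw x| := by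
  have := InfinitePlace.norm_embedding_of_isReal hw x
  rw [Real.norm_eq_abs] at this
  rw [this]; rfl

theorem lsq_real_iff {w : InfinitePlace K} (hw : w.IsReal) {x : K} :
    LSq w.1 x ↔ 0 < InfinitePlace.embedding_of_isReal hw x := by
  set φ := InfinitePlace.embedding_of_isReal hw with hφ
  constructor
  · rintro ⟨h0, h⟩
    obtain ⟨y, hy⟩ := h (1/2) (by norm_num)
    rw [real_abs hw, map_sub, map_mul, map_pow, map_one, ← hφ] at hy
    have := (abs_lt.1 hy).1
    by_contra hneg
    push Not at hneg
    nlinarith [sq_nonneg (φ y)]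
  · intro h
    refine ⟨fun h0 => by rw [h0] at h; simp at h, fun ε hε => ?_⟩
    have hd : DenseRange φ := by
      have : DenseRange (fun q : ℚ => (q : ℝ)) := Rat.denseRange_cast
      refine this.mono ?_
      rintro _ ⟨q, rfl⟩
      exact ⟨q, by simp⟩
    have hopen : IsOpen {t : ℝ | |φ x * t ^ 2 - 1| < ε} :=
      isOpen_lt (by fun_prop) continuous_const
    have hne : {t : ℝ | |φ x * t ^ 2 - 1| < ε}.Nonempty := by
      refine ⟨(Real.sqrt (φ x))⁻¹, ?_⟩
      have : φ x * (Real.sqrt (φ x))⁻¹ ^ 2 - 1 = 0 := by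
        rw [inv_pow, Real.sq_sqrt h.le, mul_inv_cancel₀ h.ne', sub_self]
      simp only [Set.mem_ofPred_eq, this, abs_zero, hε]
    obtain ⟨y, hy⟩ := hd.exists_mem_open hopen hne
    refine ⟨y, ?_⟩
    rw [real_abs hw, map_sub, map_mul, map_pow, map_one]
    exact hy

theorem dense_complex {w : InfinitePlace K} (hw : w.IsComplex) : DenseRange w.embedding := by
  obtain ⟨α, hα⟩ : ∃ α : K, (w.embedding α).im ≠ 0 := by
    by_contra hcon
    push Not at hcon
    apply (InfinitePlace.not_isReal_iff_isComplex).2 hw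
    rw [InfinitePlace.isReal_iff]
    ext x
    simp only [ComplexEmbedding.conjugate_coe_eq]
    exact Complex.conj_eq_iff_im.2 (hcon x)
  refine Metric.denseRange_iff.2 fun z ε hε => ?_
  set a := w.embedding α with ha
  have hd := Rat.denseRange_cast (𝕜 := ℝ)
  obtain ⟨q, hq⟩ := Metric.denseRange_iff.1 hd (z.im / a.im) (ε / 2 / (|a.im| )) (by positivity)
  obtain ⟨p, hp⟩ := Metric.denseRange_iff.1 hd (z.re - q * a.re) (ε / 2) (by positivity)
  refine ⟨p + q * α, ?_⟩
  rw [dist_eq_norm]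
  refine (Complex.norm_le_abs_re_add_abs_im _).trans_lt ?_
  have e1 : (z - w.embedding (p + q * α)).re = (z.re - q * a.re) - p := by
    simp [← ha]; ring
  have e2 : (z - w.embedding (p + q * α)).im = (z.im / a.im - q) * a.im := by
    simp [← ha]; field_simp
  rw [e1, e2, abs_mul]
  rw [Real.dist_eq] at hp hq
  have := (lt_div_iff₀ (abs_pos.2 hα)).1 hq
  linarith

theorem lsq_complex {w : InfinitePlace K} (hw : w.IsComplex) {x : K} (hx : x ≠ 0) : LSq w.1 x := by
  refine ⟨hx, fun ε hε => ?_⟩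
  set φ := w.embedding with hφ
  have hφx : φ x ≠ 0 := by simpa using hx
  have hopen : IsOpen {t : ℂ | ‖φ x * t ^ 2 - 1‖ < ε} :=
    isOpen_lt (by fun_prop) continuous_const
  have hne : {t : ℂ | ‖φ x * t ^ 2 - 1‖ < ε}.Nonempty := by
    obtain ⟨t, ht⟩ := IsAlgClosed.exists_pow_nat_eq (φ x)⁻¹ (n := 2) (by norm_num)
    refine ⟨t, ?_⟩
    have : φ x * t ^ 2 - 1 = 0 := by rw [ht, mul_inv_cancel₀ hφx, sub_self]
    simp only [Set.mem_ofPred_eq, this, norm_zero, hε]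
  obtain ⟨y, hy⟩ := (dense_complex hw).exists_mem_open hopen hne
  refine ⟨y, ?_⟩
  have : w.1 (x * y ^ 2 - 1) = ‖φ (x * y ^ 2 - 1)‖ := (InfinitePlace.norm_embedding_eq w _).symm
  rw [this, map_sub, map_mul, map_pow, map_one]
  exact hy

theorem not_splAt_real {w : InfinitePlace K} (hw : w.IsReal) {a b : K}
    (ha : InfinitePlace.embedding_of_isReal hw a < 0) (hb : InfinitePlace.embedding_of_isReal hw b < 0) :
    ¬ SplAt w.1 a b := by
  rintro ⟨p, q, z, hz, e⟩
  rw [lsq_real_iff hw] at hz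
  have := congrArg (InfinitePlace.embedding_of_isReal hw) e
  rw [map_mul, map_sub, map_mul, map_pow, map_pow] at this
  nlinarith [mul_pos_of_neg_of_neg ha hb, mul_pos (neg_pos.2 hb) hz,
    sq_nonneg (InfinitePlace.embedding_of_isReal hw p), mul_nonneg (neg_pos.2 ha).le (sq_nonneg (InfinitePlace.embedding_of_isReal hw q))]

/-- nondegeneracy at all places -/
theorem nondeg {v : Pl K} {a : K} (ha : a ≠ 0) (h : ¬ LSq (pav v) a) :
    ∃ b : K, b ≠ 0 ∧ ¬ SplAt (pav v) a b := by
  rcases v with v | w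
  · exact nondeg_fin ha h
  · by_cases hw : w.IsReal
    · refine ⟨-1, by norm_num, not_splAt_real hw ?_ (by simp)⟩
      have h1 := (lsq_real_iff hw).not.1 h
      have : InfinitePlace.embedding_of_isReal hw a ≠ 0 := by simpa using ha
      exact lt_of_le_of_ne (not_lt.1 h1) this
    · exact absurd (lsq_complex (InfinitePlace.not_isReal_iff_isComplex.1 hw) ha) h

end Places
end NND

end

section

namespace NND
set_option linter.unusedSectionVars false
set_option linter.unusedVariables false
open NumberField IsDedekindDomain WithZero

section SUnits
variable {K : Type*} [Field K] [NumberField K]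

theorem od_int_eq_zero {w : FP K} {r : 𝓞 K} (hr : r ∉ w.asIdeal) : od w (r : K) = 0 := by
  by_cases h0 : (r : K) = 0
  · simp [od, h0]
  have h1 := od_int_nonneg w r
  rw [← ge_one_iff_mem, ge_iff w h0] at hr
  omega

theorem coe_int_ne {r : 𝓞 K} (hr : r ≠ 0) : (r : K) ≠ 0 := by
  simpa using hr

theorem od_int_eq {w : FP K} {r : 𝓞 K} (h0 : r ≠ 0) {n : ℕ} (h : r ∈ w.asIdeal ^ n)
    (h' : r ∉ w.asIdeal ^ (n + 1)) : od w (r : K) = n := by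
  rw [← ge_iff_mem, ge_iff w (coe_int_ne h0)] at h h'
  push_cast at h'
  omega

theorem fp_le_eq {v w : FP K} (h : v.asIdeal ≤ w.asIdeal) : v = w :=
  HeightOneSpectrum.ext (v.isMaximal.eq_of_le w.isPrime.ne_top h)

theorem finite_int {r : 𝓞 K} (hr : r ≠ 0) : {v : FP K | r ∈ v.asIdeal}.Finite := by
  have := Ideal.finite_factors (R := 𝓞 K) (I := Ideal.span {r}) (by simpa using hr)
  refine this.subset ?_
  intro v hv
  simp only [Set.mem_ofPred_eq] at hv ⊢
  rw [Ideal.dvd_span_singleton]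
  exact hv

theorem exists_frac (x : K) : ∃ r s : 𝓞 K, s ≠ 0 ∧ x = (r : K) / s := by
  obtain ⟨r, s, hs, h⟩ := IsFractionRing.div_surjective (A := 𝓞 K) x
  exact ⟨r, s, nonZeroDivisors.ne_zero hs, h.symm⟩

theorem finite_od {x : K} (hx : x ≠ 0) : {v : FP K | od v x ≠ 0}.Finite := by
  obtain ⟨r, s, hs, rfl⟩ := exists_frac x
  have hr : r ≠ 0 := by rintro rfl; simp at hx
  refine ((finite_int hr).union (finite_int hs)).subset ?_
  intro v hv
  by_contra hcon
  simp only [Set.mem_union, Set.mem_ofPred_eq, not_or] at hcon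
  apply hv
  rw [od_div v (coe_int_ne hr) (coe_int_ne hs), od_int_eq_zero hcon.1, od_int_eq_zero hcon.2]; simp

theorem exists_gen_pow (v : FP K) : ∃ x : K, x ≠ 0 ∧ 0 < od v x ∧ ∀ w : FP K, w ≠ v → od w x = 0 := by
  classical
  set h := Fintype.card (ClassGroup (𝓞 K)) with hh
  have hpos : 0 < h := Fintype.card_pos
  have hp : (v.asIdeal ^ h).IsPrincipal := by
    have h0 : v.asIdeal ∈ nonZeroDivisors (Ideal (𝓞 K)) := mem_nonZeroDivisors_of_ne_zero v.ne_bot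
    have := pow_card_eq_one (x := ClassGroup.mk0 ⟨v.asIdeal, h0⟩)
    rw [← map_pow, ClassGroup.mk0_eq_one_iff] at this
    exact this
  obtain ⟨r, hr⟩ := hp
  have hr : v.asIdeal ^ h = Ideal.span {r} := hr
  have hr0 : r ≠ 0 := by
    rintro rfl
    rw [Ideal.span_singleton_eq_bot.2 rfl] at hr
    exact v.ne_bot (pow_eq_zero_iff hpos.ne' |>.1 hr)
  have hmem : r ∈ v.asIdeal ^ h := by rw [hr]; exact Ideal.mem_span_singleton_self r
  refine ⟨r, coe_int_ne hr0, ?_, fun w hw => od_int_eq_zero fun hrw => hw ?_⟩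
  · have := (ge_iff v (coe_int_ne hr0)).1 ((ge_iff_mem v h r).2 hmem)
    omega
  · have hle : v.asIdeal ^ h ≤ w.asIdeal := by
      rw [hr, Ideal.span_le]; simpa using hrw
    exact (fp_le_eq (w.isPrime.le_of_pow_le hle)).symm

/-- The `S`-class group is trivial. -/
def ClT (S : Finset (FP K)) : Prop :=
  ∀ v : FP K, v ∉ S → ∃ x : K, x ≠ 0 ∧ od v x = 1 ∧ ∀ w : FP K, w ∉ S → w ≠ v → od w x = 0

theorem ClT.mono {S S' : Finset (FP K)} (h : ClT S) (hS : S ⊆ S') : ClT S' := by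
  intro v hv
  obtain ⟨x, h0, h1, h2⟩ := h v (fun h => hv (hS h))
  exact ⟨x, h0, h1, fun w hw hwv => h2 w (fun h => hw (hS h)) hwv⟩

variable (K) in
theorem exists_clT : ∃ S : Finset (FP K), ClT S := by
  classical
  have hsurj : ∀ c : ClassGroup (𝓞 K), ∃ J : nonZeroDivisors (Ideal (𝓞 K)), ClassGroup.mk0 J = c :=
    ClassGroup.mk0_surjective
  choose J hJ using hsurj
  have hfin : (⋃ c, {v : FP K | (J c : Ideal (𝓞 K)) ≤ v.asIdeal}).Finite := by
    refine Set.finite_iUnion fun c => ?_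
    have := Ideal.finite_factors (R := 𝓞 K) (I := (J c : Ideal (𝓞 K))) (nonZeroDivisors.ne_zero (J c).2)
    refine this.subset fun v hv => ?_
    exact Ideal.dvd_iff_le.2 hv
  refine ⟨hfin.toFinset, fun v hv => ?_⟩
  have hnot : ∀ w : FP K, w ∉ hfin.toFinset → ∀ c, ¬ (J c : Ideal (𝓞 K)) ≤ w.asIdeal := by
    intro w hw c hle
    apply hw
    rw [Set.Finite.mem_toFinset]
    exact Set.mem_iUnion.2 ⟨c, hle⟩
  have h0 : v.asIdeal ∈ nonZeroDivisors (Ideal (𝓞 K)) := mem_nonZeroDivisors_of_ne_zero v.ne_bot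
  set c := (ClassGroup.mk0 ⟨v.asIdeal, h0⟩)⁻¹ with hc
  have hp : ((v.asIdeal * (J c : Ideal (𝓞 K)))).IsPrincipal := by
    have : ClassGroup.mk0 (⟨v.asIdeal, h0⟩ * J c) = 1 := by
      rw [map_mul, hJ, hc, mul_inv_cancel]
    rw [ClassGroup.mk0_eq_one_iff] at this
    exact this
  have hI0 : (J c : Ideal (𝓞 K)) ≠ ⊥ := nonZeroDivisors.ne_zero (J c).2
  have hnot' : ∀ w : FP K, w ∉ hfin.toFinset → ¬ (J c : Ideal (𝓞 K)) ≤ w.asIdeal :=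
    fun w hw => hnot w hw c
  generalize (J c : Ideal (𝓞 K)) = I at hp hI0 hnot'
  generalize hfin.toFinset = S at hnot' hv
  clear hnot hJ hc c hfin
  obtain ⟨r, hr⟩ := hp
  have hr : v.asIdeal * I = Ideal.span {r} := hr
  have hr0 : r ≠ 0 := by
    rintro rfl
    rw [Ideal.span_singleton_eq_bot.2 rfl] at hr
    rcases Ideal.mul_eq_bot.1 hr with h | h
    · exact v.ne_bot h
    · exact hI0 h
  have hmem : r ∈ v.asIdeal * I := by rw [hr]; exact Ideal.mem_span_singleton_self r
  have hmem' : r ∈ v.asIdeal := by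
    have hle : v.asIdeal * I ≤ v.asIdeal := Ideal.mul_le_left
    exact hle hmem
  refine ⟨r, coe_int_ne hr0, ?_, fun w hw hwv => od_int_eq_zero fun hrw => hwv ?_⟩
  · have := od_int_eq (w := v) hr0 (n := 1) (by rw [pow_one]; exact hmem') ?_
    · exact_mod_cast this
    · intro h
      have hle : v.asIdeal * I ≤ v.asIdeal * v.asIdeal := by
        rw [hr, Ideal.span_le, ← pow_two]; simpa using h
      rw [← Ideal.dvd_iff_le, mul_dvd_mul_iff_left v.ne_bot, Ideal.dvd_iff_le] at hle
      exact hnot' v hv hle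
  · have hle : v.asIdeal * I ≤ w.asIdeal := by
      rw [hr, Ideal.span_le]; simpa using hrw
    rcases w.isPrime.mul_le.1 hle with h | h
    · exact (fp_le_eq h).symm
    · exact absurd h (hnot' w hw)

theorem od_prod (v : FP K) {ι : Type*} (s : Finset ι) (f : ι → K) (hf : ∀ i ∈ s, f i ≠ 0) :
    od v (∏ i ∈ s, f i) = ∑ i ∈ s, od v (f i) := by
  classical
  induction s using Finset.induction_on with
  | empty => simp
  | insert a s ha ih =>
    have h1 : ∀ i ∈ s, f i ≠ 0 := fun i hi => hf i (Finset.mem_insert_of_mem hi)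
    rw [Finset.prod_insert ha, Finset.sum_insert ha,
      od_mul v (hf a (Finset.mem_insert_self _ _)) (Finset.prod_ne_zero_iff.2 h1), ih h1]

theorem ClT.exists_od {S : Finset (FP K)} (h : ClT S) (n : FP K → ℤ)
    (hn : {v : FP K | n v ≠ 0}.Finite) : ∃ c : K, c ≠ 0 ∧ ∀ v, v ∉ S → od v c = n v := by
  classical
  choose! x h0 h1 h2 using h
  have hne : ∀ w ∈ hn.toFinset.filter (· ∉ S), x w ^ n w ≠ 0 := by
    intro w hw
    exact zpow_ne_zero _ (h0 w (Finset.mem_filter.1 hw).2)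
  refine ⟨∏ w ∈ hn.toFinset.filter (· ∉ S), x w ^ n w, Finset.prod_ne_zero_iff.2 hne, fun v hv => ?_⟩
  rw [od_prod v _ _ hne, Finset.sum_eq_single v]
  · rw [od_zpow, h1 v hv, mul_one]
  · intro w hw hwv
    rw [od_zpow, h2 w (Finset.mem_filter.1 hw).2 v hv (Ne.symm hwv), mul_zero]
  · intro hv'
    have : n v = 0 := by
      by_contra hne
      exact hv' (Finset.mem_filter.2 ⟨by simpa using hne, hv⟩)
    simp [this]

/-- The group of `S`-units. -/
def SU (S : Finset (FP K)) : Subgroup Kˣ where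
  carrier := {x | ∀ v : FP K, v ∉ S → od v (x : K) = 0}
  mul_mem' := by
    intro a b ha hb v hv
    simp only [Units.val_mul]
    rw [od_mul v a.ne_zero b.ne_zero, ha v hv, hb v hv, add_zero]
  one_mem' := by intro v hv; simp
  inv_mem' := by
    intro a ha v hv
    simp only [Units.val_inv_eq_inv_val]
    rw [od_inv, ha v hv, neg_zero]

theorem mem_SU {S : Finset (FP K)} {x : Kˣ} : x ∈ SU S ↔ ∀ v : FP K, v ∉ S → od v (x : K) = 0 := Iff.rfl

noncomputable def ordMap (S : Finset (FP K)) : Additive (SU S) →ₗ[ℤ] (S → ℤ) :=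
  AddMonoidHom.toIntLinearMap
    { toFun := fun x i => od i.1 ((x.toMul : Kˣ) : K)
      map_zero' := by ext i; simp
      map_add' := by
        intro x y; ext i
        simp only [toMul_add, Subgroup.coe_mul, Units.val_mul, Pi.add_apply]
        exact od_mul i.1 (Units.ne_zero _) (Units.ne_zero _) }

theorem ordMap_apply (S : Finset (FP K)) (x : SU S) (i : S) :
    ordMap S (Additive.ofMul x) i = od i.1 ((x : Kˣ) : K) := rfl

theorem od_unit (v : FP K) (u : (𝓞 K)ˣ) : od v ((u : 𝓞 K) : K) = 0 := by
  apply od_int_eq_zero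
  intro h
  exact v.isPrime.ne_top (Ideal.eq_top_of_isUnit_mem _ h u.isUnit)

noncomputable def unitMap (S : Finset (FP K)) : Additive (𝓞 K)ˣ →ₗ[ℤ] Additive (SU S) :=
  AddMonoidHom.toIntLinearMap (MonoidHom.toAdditive
    { toFun := fun u => ⟨Units.map (algebraMap (𝓞 K) K : 𝓞 K →* K) u, fun v _ => od_unit v u⟩
      map_one' := by ext; simp
      map_mul' := by intro x y; ext; simp })

theorem unitMap_inj (S : Finset (FP K)) : Function.Injective (unitMap (K := K) S) := by
  intro x y h
  have h1 := congrArg (fun z : Additive (SU S) => ((z.toMul : Kˣ) : K)) h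
  apply Additive.toMul.injective
  ext
  exact h1

theorem range_unitMap (S : Finset (FP K)) :
    LinearMap.range (unitMap (K := K) S) = LinearMap.ker (ordMap S) := by
  ext x
  constructor
  · rintro ⟨u, rfl⟩
    rw [LinearMap.mem_ker]
    ext i
    exact od_unit i.1 u.toMul
  · intro hx
    rw [LinearMap.mem_ker] at hx
    have hod : ∀ v : FP K, od v ((x.toMul : Kˣ) : K) = 0 := by
      intro v
      by_cases hv : v ∈ S
      · exact congrFun hx ⟨v, hv⟩
      · exact x.toMul.2 v hv
    have hintg : ∀ y : K, y ≠ 0 → (∀ v : FP K, od v y = 0) → ∃ r : 𝓞 K, (r : K) = y := by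
      intro y hy h
      exact HeightOneSpectrum.mem_integers_of_valuation_le_one K y (fun v => by
        rw [val_eq v hy, h v]; simp)
    obtain ⟨r, hr⟩ := hintg _ (Units.ne_zero (x.toMul : Kˣ)) hod
    obtain ⟨s, hs⟩ := hintg (((x.toMul : Kˣ) : K)⁻¹) (inv_ne_zero (Units.ne_zero _)) (fun v => by
      rw [od_inv, hod v, neg_zero])
    have hrs : r * s = 1 := by
      apply RingOfIntegers.coe_injective
      show ((r * s : 𝓞 K) : K) = ((1 : 𝓞 K) : K)
      push_cast
      exact (congrArg₂ (· * ·) hr hs).trans (mul_inv_cancel₀ (Units.ne_zero _))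
    refine ⟨Additive.ofMul ⟨r, s, hrs, by rw [mul_comm, hrs]⟩, ?_⟩
    apply Additive.toMul.injective
    ext
    exact hr

instance (S : Finset (FP K)) : Module.Finite ℤ (Additive (SU S)) := by
  have h1 : (LinearMap.ker (ordMap S)).FG := by
    rw [← range_unitMap, LinearMap.range_eq_map]
    exact Module.Finite.fg_top.map _
  have h2 : (LinearMap.range (ordMap S)).FG := IsNoetherian.noetherian _
  refine ⟨?_⟩
  refine Submodule.fg_of_fg_map_of_fg_inf_ker (ordMap S) ?_ ?_
  · rwa [← LinearMap.range_eq_map]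
  · rwa [top_inf_eq]

theorem finrank_SU (S : Finset (FP K)) :
    Module.finrank ℤ (Additive (SU S)) + 1 = S.card + Fintype.card (InfinitePlace K) := by
  classical
  have h1 := (LinearMap.ker (ordMap S)).finrank_quotient_add_finrank
  rw [(ordMap S).quotKerEquivRange.finrank_eq] at h1
  have h2 : Module.finrank ℤ (LinearMap.ker (ordMap S)) = Units.rank K := by
    rw [← range_unitMap, ← Units.finrank_eq]
    exact (LinearEquiv.ofInjective _ (unitMap_inj S)).finrank_eq.symm
  have h3 : Module.finrank ℤ (LinearMap.range (ordMap S)) = S.card := by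
    apply le_antisymm
    · have := Submodule.finrank_le (LinearMap.range (ordMap S))
      simpa using this
    · choose g g0 g1 g2 using exists_gen_pow (K := K)
      let x : S → Additive (SU S) := fun i => Additive.ofMul ⟨Units.mk0 (g i.1) (g0 i.1), fun v hv =>
        g2 i.1 v (fun h => hv (h ▸ i.2))⟩
      have hx : ∀ i j, ordMap S (x i) j = if j = i then od i.1 (g i.1) else 0 := by
        intro i j
        show od j.1 (g i.1) = _
        split_ifs with h
        · rw [h]
        · exact g2 i.1 j.1 (fun h' => h (Subtype.ext h'))
      have hli : LinearIndependent ℤ (fun i : S => (⟨ordMap S (x i), LinearMap.mem_range_self _ _⟩ :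
          LinearMap.range (ordMap S))) := by
        rw [Fintype.linearIndependent_iff]
        intro c hc i
        have := congrArg (fun z : LinearMap.range (ordMap S) => (z : S → ℤ) i) hc
        simp only [Submodule.coe_sum, Submodule.coe_smul, Finset.sum_apply, Pi.smul_apply, hx,
          smul_eq_mul, mul_ite, mul_zero, Submodule.coe_zero, Pi.zero_apply, Finset.sum_ite_eq,
          Finset.mem_univ, if_true] at this
        rcases mul_eq_zero.1 this with h | h
        · exact h
        · have := g1 i.1; omega
      have := hli.fintype_card_le_finrank
      simpa using this
  have h4 : Units.rank K + 1 = Fintype.card (InfinitePlace K) := by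
    unfold Units.rank
    have : 0 < Fintype.card (InfinitePlace K) := Fintype.card_pos
    omega
  omega

end SUnits
end NND

end

section

namespace NND
set_option linter.unusedSectionVars false
set_option linter.unusedVariables false
open NumberField IsDedekindDomain WithZero

section Count

theorem dbl_equiv {A B : Type*} [AddCommGroup A] [AddCommGroup B] (e : A ≃+ B) :
    (nsmulAddMonoidHom 2 : A →+ A).range.index = (nsmulAddMonoidHom 2 : B →+ B).range.index ∧
    Nat.card (nsmulAddMonoidHom 2 : A →+ A).ker = Nat.card (nsmulAddMonoidHom 2 : B →+ B).ker := by
  constructor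
  · have h : (nsmulAddMonoidHom 2 : A →+ A).range
      = (nsmulAddMonoidHom 2 : B →+ B).range.comap e.toAddMonoidHom := by
      ext x
      simp only [AddMonoidHom.mem_range, AddSubgroup.mem_comap]
      constructor
      · rintro ⟨y, rfl⟩
        exact ⟨e y, by simp⟩
      · rintro ⟨y, hy⟩
        refine ⟨e.symm y, e.injective ?_⟩
        simp at hy ⊢
        exact hy
    rw [h, AddSubgroup.index_comap_of_surjective _ e.surjective]
  · refine Nat.card_congr ⟨fun x => ⟨e x.1, ?_⟩, fun x => ⟨e.symm x.1, ?_⟩, fun x => by simp, fun x => by simp⟩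
    · have := x.2
      rw [AddMonoidHom.mem_ker] at this ⊢
      have h2 := congrArg e this
      simpa using h2
    · have := x.2
      rw [AddMonoidHom.mem_ker] at this ⊢
      have h2 := congrArg e.symm this
      simpa using h2

theorem dbl_prod (A B : Type*) [AddCommGroup A] [AddCommGroup B] :
    (nsmulAddMonoidHom 2 : A × B →+ A × B).range.index
      = (nsmulAddMonoidHom 2 : A →+ A).range.index * (nsmulAddMonoidHom 2 : B →+ B).range.index ∧
    Nat.card (nsmulAddMonoidHom 2 : A × B →+ A × B).ker
      = Nat.card (nsmulAddMonoidHom 2 : A →+ A).ker * Nat.card (nsmulAddMonoidHom 2 : B →+ B).ker := by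
  constructor
  · rw [← AddSubgroup.index_prod]
    congr 1
    ext ⟨a, b⟩
    simp only [AddMonoidHom.mem_range, AddSubgroup.mem_prod]
    constructor
    · rintro ⟨⟨x, y⟩, h⟩
      simp at h
      exact ⟨⟨x, by simpa using h.1⟩, ⟨y, by simpa using h.2⟩⟩
    · rintro ⟨⟨x, hx⟩, ⟨y, hy⟩⟩
      exact ⟨(x, y), by ext <;> simp_all⟩
  · rw [← Nat.card_prod]
    refine Nat.card_congr ⟨fun x => (⟨x.1.1, ?_⟩, ⟨x.1.2, ?_⟩), fun x => ⟨(x.1.1, x.2.1), ?_⟩, fun x => by simp, fun x => by simp⟩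
    · have := x.2
      rw [AddMonoidHom.mem_ker] at this ⊢
      exact congrArg Prod.fst this
    · have := x.2
      rw [AddMonoidHom.mem_ker] at this ⊢
      exact congrArg Prod.snd this
    · have h1 := x.1.2
      have h2 := x.2.2
      rw [AddMonoidHom.mem_ker] at h1 h2 ⊢
      exact Prod.ext h1 h2

theorem dbl_finite (A : Type*) [AddCommGroup A] [Finite A] :
    (nsmulAddMonoidHom 2 : A →+ A).range.index = Nat.card (nsmulAddMonoidHom 2 : A →+ A).ker :=
  AddSubgroup.index_range

theorem dbl_free (n : ℕ) :
    (nsmulAddMonoidHom 2 : (Fin n →₀ ℤ) →+ (Fin n →₀ ℤ)).range.index = 2 ^ n ∧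
    Nat.card (nsmulAddMonoidHom 2 : (Fin n →₀ ℤ) →+ (Fin n →₀ ℤ)).ker = 1 := by
  constructor
  · let f : (Fin n →₀ ℤ) →+ (Fin n → ZMod 2) :=
      { toFun := fun x i => (x i : ZMod 2)
        map_zero' := by ext; simp
        map_add' := by intro x y; ext; simp }
    have hker : (nsmulAddMonoidHom 2 : (Fin n →₀ ℤ) →+ (Fin n →₀ ℤ)).range = f.ker := by
      ext x
      rw [AddMonoidHom.mem_ker, AddMonoidHom.mem_range]
      constructor
      · rintro ⟨y, rfl⟩
        ext i
        show (((2 • y) i : ℤ) : ZMod 2) = 0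
        rw [ZMod.intCast_zmod_eq_zero_iff_dvd]
        simp
      · intro h
        have h2 : ∀ i, (2 : ℤ) ∣ x i := fun i => by
          have := congrFun h i
          exact (ZMod.intCast_zmod_eq_zero_iff_dvd _ _).1 this
        choose y hy using h2
        refine ⟨Finsupp.equivFunOnFinite.symm y, ?_⟩
        ext i
        simp [hy i]
    rw [hker, AddSubgroup.index_ker]
    have : f.range = ⊤ := by
      rw [AddMonoidHom.range_eq_top]
      intro y
      refine ⟨Finsupp.equivFunOnFinite.symm (fun i => ((y i).val : ℤ)), ?_⟩
      ext i
      show (((y i).val : ℤ) : ZMod 2) = y i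
      simp
    rw [this]
    simp
  · rw [Nat.card_eq_one_iff_unique]
    refine ⟨⟨?_⟩, ⟨0⟩⟩
    intro x y
    have key : ∀ z : (nsmulAddMonoidHom 2 : (Fin n →₀ ℤ) →+ (Fin n →₀ ℤ)).ker, z.1 = 0 := by
      intro z
      have := z.2
      rw [AddMonoidHom.mem_ker] at this
      ext i
      have := congrArg (fun t => t i) this
      simpa using this
    exact Subtype.ext ((key x).trans (key y).symm)

theorem dbl_card (A : Type*) [AddCommGroup A] [Module.Finite ℤ A] :
    (nsmulAddMonoidHom 2 : A →+ A).range.index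
      = 2 ^ Module.finrank ℤ A * Nat.card (nsmulAddMonoidHom 2 : A →+ A).ker := by
  obtain ⟨n, ι, _, p, hp, e, ⟨f⟩⟩ := Module.equiv_free_prod_directSum (R := ℤ) (M := A)
  set T := DirectSum ι (fun i => ℤ ⧸ Submodule.span ℤ {p i ^ e i}) with hT
  haveI : ∀ i, Finite (ℤ ⧸ Submodule.span ℤ {p i ^ e i}) := fun i => by
    haveI : NeZero ((p i ^ e i).natAbs) := ⟨by
      simpa using fun h => absurd h (hp i).ne_zero⟩
    exact Finite.of_equiv _ (Int.quotientSpanEquivZMod (p i ^ e i)).symm.toEquiv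
  haveI : Finite T := by
    classical
    exact Finite.of_equiv _ (DirectSum.linearEquivFunOnFintype ℤ ι
      (fun i => ℤ ⧸ Submodule.span ℤ {p i ^ e i})).symm.toEquiv
  have hrank : Module.finrank ℤ A = n := by
    rw [f.finrank_eq]
    have h1 := (LinearMap.ker (LinearMap.fst ℤ (Fin n →₀ ℤ) T)).finrank_quotient_add_finrank
    rw [(LinearMap.fst ℤ (Fin n →₀ ℤ) T).quotKerEquivRange.finrank_eq, LinearMap.range_eq_top.2 LinearMap.fst_surjective] at h1
    have h2 : Module.finrank ℤ (LinearMap.ker (LinearMap.fst ℤ (Fin n →₀ ℤ) T)) = 0 := by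
      rw [LinearMap.ker_fst]
      rw [(LinearEquiv.ofInjective _ (LinearMap.inr_injective (R := ℤ) (M := Fin n →₀ ℤ) (M₂ := T))).symm.finrank_eq]
      rw [Module.finrank_eq_zero_iff_isTorsion]
      intro x
      have hpos : 0 < addOrderOf x := addOrderOf_pos x
      refine ⟨⟨(addOrderOf x : ℤ), mem_nonZeroDivisors_of_ne_zero (by exact_mod_cast hpos.ne')⟩, ?_⟩
      show (addOrderOf x : ℤ) • x = 0
      rw [natCast_zsmul]; exact addOrderOf_nsmul_eq_zero x
    rw [h2] at h1
    have h3 : Module.finrank ℤ (⊤ : Submodule ℤ (Fin n →₀ ℤ)) = n := by simp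
    rw [h3, add_zero] at h1
    exact h1.symm
  have h1 := dbl_equiv f.toAddEquiv
  have h2 := dbl_prod (Fin n →₀ ℤ) T
  have h3 := dbl_free n
  have h4 := dbl_finite T
  rw [h1.1, h1.2, h2.1, h2.2, h3.1, h3.2, h4, hrank]
  ring

/-- index of squares in a finitely generated abelian group whose 2-torsion is `±1`. -/
theorem sq_index (G : Type*) [CommGroup G] [Module.Finite ℤ (Additive G)] :
    (powMonoidHom 2 : G →* G).range.index
      = 2 ^ Module.finrank ℤ (Additive G) * Nat.card (powMonoidHom 2 : G →* G).ker := by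
  have h := dbl_card (Additive G)
  have h1 : (nsmulAddMonoidHom 2 : Additive G →+ Additive G).range
      = Subgroup.toAddSubgroup (powMonoidHom 2 : G →* G).range := rfl
  have h2 : Nat.card (nsmulAddMonoidHom 2 : Additive G →+ Additive G).ker =
     Nat.card (powMonoidHom 2 : G →* G).ker := rfl
  rw [h1, h2, Subgroup.index_toAddSubgroup] at h
  exact h

end Count
end NND

end

section

namespace NND
set_option linter.unusedSectionVars false
set_option linter.unusedVariables false
open NumberField IsDedekindDomain WithZero

section Ext
variable {K E : Type*} [Field K] [NumberField K] [Field E] [NumberField E] [Algebra K E]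

/-- place below -/
noncomputable def bel (K : Type*) {E : Type*} [Field K] [NumberField K] [Field E] [NumberField E] [Algebra K E]
    (P : FP E) : FP K where
  asIdeal := P.asIdeal.under (𝓞 K)
  isPrime := inferInstance
  ne_bot := Ideal.under_ne_bot (𝓞 K) P.ne_bot

instance (P : FP E) : P.asIdeal.LiesOver (bel K P).asIdeal := ⟨rfl⟩

theorem od_over (P : FP E) : ∃ e : ℤ, 0 < e ∧ ∀ x : K, od P (algebraMap K E x) = e * od (bel K P) x := by
  refine ⟨((bel K P).asIdeal.ramificationIdx' P.asIdeal : ℕ), ?_, fun x => ?_⟩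
  · have := Ideal.IsDedekindDomain.ramificationIdx'_ne_zero_of_liesOver P.asIdeal (bel K P).ne_bot
    omega
  · have h := HeightOneSpectrum.valuation_liesOver E (bel K P) P x
    unfold od
    rw [← h, log_pow]
    simp

theorem exists_above (v : FP K) : ∃ P : FP E, bel K P = v := by
  obtain ⟨Q, hQ, hQ2⟩ := Ideal.exists_ideal_over_prime_of_isIntegral (S := 𝓞 E) v.asIdeal ⊥ (by
    rw [← RingHom.ker_eq_comap_bot, (RingHom.injective_iff_ker_eq_bot _).1 (FaithfulSMul.algebraMap_injective (𝓞 K) (𝓞 E))]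
    exact bot_le)
  refine ⟨⟨Q, hQ2.1, ?_⟩, HeightOneSpectrum.ext hQ2.2⟩
  rintro rfl
  apply v.ne_bot
  rw [← hQ2.2, ← RingHom.ker_eq_comap_bot, (RingHom.injective_iff_ker_eq_bot _).1 (FaithfulSMul.algebraMap_injective (𝓞 K) (𝓞 E))]

theorem finite_above (S : Finset (FP K)) : {P : FP E | bel K P ∈ S}.Finite := by
  have : {P : FP E | bel K P ∈ S} = ⋃ v ∈ S, {P : FP E | bel K P = v} := by ext; simp
  rw [this]
  refine Set.Finite.biUnion S.finite_toSet fun v _ => ?_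
  obtain ⟨π, h0, h1⟩ := exists_unif v
  refine (finite_od (K := E) (x := algebraMap K E (π : K)) (by simpa using h0)).subset ?_
  rintro P rfl
  obtain ⟨e, he, h⟩ := od_over (K := K) P
  show od P _ ≠ 0
  rw [h, h1]; omega

noncomputable def abv (E : Type*) [Field E] [NumberField E] [Algebra K E] (S : Finset (FP K)) : Finset (FP E) :=
  (finite_above S).toFinset

@[simp] theorem mem_abv {S : Finset (FP K)} {P : FP E} : P ∈ abv E S ↔ bel K P ∈ S := by
  simp [abv]

noncomputable def pbel (K : Type*) {E : Type*} [Field K] [NumberField K] [Field E] [NumberField E] [Algebra K E] :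
    Pl E → Pl K
  | Sum.inl P => Sum.inl (bel K P)
  | Sum.inr w => Sum.inr (w.comap (algebraMap K E))

theorem ge_over (P : FP E) (n : ℕ) {x : K} (h : Ge (bel K P) n x) : Ge P n (algebraMap K E x) := by
  by_cases hx : x = 0
  · subst hx; rw [map_zero]; exact ge_zero _ _
  obtain ⟨e, he, ho⟩ := od_over (K := K) P
  rw [ge_iff _ hx] at h
  rw [ge_iff _ (by simpa using hx), ho]
  nlinarith

theorem pav_cmp (V : Pl E) : ∀ ε : ℝ, 0 < ε → ∃ δ : ℝ, 0 < δ ∧ ∀ x : K, pav (pbel K V) x < δ →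
    pav V (algebraMap K E x) < ε := by
  intro ε hε
  rcases V with P | w
  · obtain ⟨n, hn⟩ := exists_ge_of_eps P hε
    refine ⟨_, eps_pos (bel K P) (-(n : ℤ)), fun x hx => hn _ (ge_over P n (ge_of_fabv hx))⟩
  · exact ⟨ε, hε, fun x hx => hx⟩

theorem lsq_up (V : Pl E) {x : K} (h : LSq (pav (pbel K V)) x) : LSq (pav V) (algebraMap K E x) :=
  lsq_map (pav_cmp V) h

theorem splAt_up (V : Pl E) {a b : K} (h : SplAt (pav (pbel K V)) a b) :
    SplAt (pav V) (algebraMap K E a) (algebraMap K E b) :=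
  splAt_map (pav_cmp V) h

/-- action on places -/
noncomputable def sig (f : E ≃+* E) (P : FP E) : FP E where
  asIdeal := P.asIdeal.comap (RingOfIntegers.mapRingEquiv f)
  isPrime := inferInstance
  ne_bot := by
    intro h
    apply P.ne_bot
    have := congrArg (Ideal.map (RingOfIntegers.mapRingEquiv f)) h
    rwa [Ideal.map_comap_of_surjective _ (RingOfIntegers.mapRingEquiv f).surjective, Ideal.map_bot] at this

theorem sig_int (f : E ≃+* E) (P : FP E) (r : 𝓞 E) (n : ℕ) : Ge (sig f P) n (r : E) ↔ Ge P n (f r) := by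
  rw [ge_iff_mem, ← RingOfIntegers.mapRingEquiv_apply, ge_iff_mem]
  show r ∈ (P.asIdeal.comap (RingOfIntegers.mapRingEquiv f)) ^ n ↔ _
  rw [← Ideal.map_symm, ← Ideal.map_pow, Ideal.map_symm]
  rfl

theorem sig_od_int (f : E ≃+* E) (P : FP E) (r : 𝓞 E) : od (sig f P) (r : E) = od P (f r) := by
  by_cases hr : r = 0
  · subst hr; simp [od]
  have h0 : (r : E) ≠ 0 := coe_int_ne hr
  have h1 : f (r : E) ≠ 0 := by simpa using hr
  have key : ∀ n : ℕ, (n : ℤ) ≤ od (sig f P) (r : E) ↔ (n : ℤ) ≤ od P (f r) := fun n => by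
    rw [← ge_iff _ h0, ← ge_iff _ h1, sig_int]
  have n1 : 0 ≤ od (sig f P) (r : E) := od_int_nonneg _ r
  have n2 : 0 ≤ od P (f r) := by
    rw [← RingOfIntegers.mapRingEquiv_apply]; exact od_int_nonneg _ _
  have a1 := (key (od (sig f P) (r : E)).toNat).1 (by omega)
  have a2 := (key (od P (f r)).toNat).2 (by omega)
  omega

theorem sig_od (f : E ≃+* E) (P : FP E) (x : E) : od (sig f P) x = od P (f x) := by
  by_cases hx : x = 0
  · subst hx; simp [od]
  obtain ⟨r, s, hs, rfl⟩ := exists_frac x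
  have hr : r ≠ 0 := by rintro rfl; simp at hx
  have h1 : f (r : E) ≠ 0 := by simpa using hr
  have h2 : f (s : E) ≠ 0 := by simpa using hs
  rw [map_div₀, od_div _ (coe_int_ne hr) (coe_int_ne hs), od_div _ h1 h2, sig_od_int, sig_od_int]

theorem sig_bel (f : E ≃ₐ[K] E) (P : FP E) : bel K (sig f.toRingEquiv P) = bel K P := by
  apply HeightOneSpectrum.ext
  ext r
  have h : ∀ Q : FP E, r ∈ (bel K Q).asIdeal ↔ Ge Q 1 (algebraMap K E r) := fun Q => by
    rw [show algebraMap K E (r : K) = ((algebraMap (𝓞 K) (𝓞 E) r : 𝓞 E) : E) from rfl, ge_one_iff_mem]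
    rfl
  rw [h, h]
  by_cases h0 : algebraMap K E (r : K) = 0
  · rw [h0]; simp [ge_zero]
  rw [ge_iff _ h0, ge_iff _ h0, sig_od]
  simp

end Ext
end NND

end

section

namespace NND
set_option linter.unusedSectionVars false
set_option linter.unusedVariables false
set_option linter.style.haveILetI false
open NumberField IsDedekindDomain WithZero

theorem herb {U W : Type*} [CommGroup U] [CommGroup W] [Module.Finite ℤ (Additive U)]
    [Module.Finite ℤ (Additive W)] (ι : U →* W) (hι : Function.Injective ι) (N : W →* U) (φ : W →* W)
    (h1 : ∀ u, N (ι u) = u ^ 2) (h2 : ∀ w, φ w = 1 ↔ w ∈ ι.range)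
    (h3 : ∀ w, N w = 1 ↔ w ∈ φ.range) (h4 : ∀ w, φ (φ w) = φ w ^ 2)
    (tU : Nat.card (powMonoidHom 2 : U →* U).ker = 2)
    (tV : Nat.card (powMonoidHom 2 : φ.range →* φ.range).ker = 2) :
    N.range.index * 2 ^ Module.finrank ℤ (Additive W) = 2 ^ (2 * Module.finrank ℤ (Additive U)) := by
  set V := φ.range with hV
  let φ' : W →* V := φ.rangeRestrict
  have hsurj : Function.Surjective φ' := φ.rangeRestrict_surjective
  let L : Additive W →ₗ[ℤ] Additive V := (MonoidHom.toAdditive φ').toIntLinearMap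
  have hL : Function.Surjective L := fun y => by
    obtain ⟨x, hx⟩ := hsurj y.toMul
    exact ⟨Additive.ofMul x, hx⟩
  haveI : Module.Finite ℤ (Additive V) := Module.Finite.of_surjective L hL
  have hrk : Module.finrank ℤ (Additive V) + Module.finrank ℤ (Additive U) = Module.finrank ℤ (Additive W) := by
    have e1 := (LinearMap.ker L).finrank_quotient_add_finrank
    rw [L.quotKerEquivRange.finrank_eq, LinearMap.range_eq_top.2 hL, finrank_top] at e1
    rw [← e1]
    congr 1
    let J : Additive U →ₗ[ℤ] Additive W := (MonoidHom.toAdditive ι).toIntLinearMap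
    have hJ : Function.Injective J := fun x y h => hι h
    have hr : LinearMap.range J = LinearMap.ker L := by
      ext w
      rw [LinearMap.mem_ker, LinearMap.mem_range]
      have hh : L w = 0 ↔ φ w.toMul = 1 := by
        constructor
        · intro h; exact congrArg Subtype.val h
        · intro h; exact Subtype.ext h
      rw [hh, h2, MonoidHom.mem_range]
      constructor
      · rintro ⟨y, rfl⟩; exact ⟨y.toMul, rfl⟩
      · rintro ⟨y, hy⟩; exact ⟨Additive.ofMul y, hy⟩
    rw [← hr]
    exact (LinearEquiv.ofInjective J hJ).finrank_eq
  have s1 := sq_index U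
  have s2 := sq_index V
  rw [tU] at s1
  rw [tV] at s2
  have c1 : ((powMonoidHom 2 : U →* U).range.comap N).index = (powMonoidHom 2 : U →* U).range.relIndex N.range :=
    Subgroup.index_comap _ _
  have hle : (powMonoidHom 2 : U →* U).range ≤ N.range := by
    rintro _ ⟨u, rfl⟩
    exact ⟨ι u, h1 u⟩
  have c2 := Subgroup.relIndex_mul_index hle
  have c3 : ((powMonoidHom 2 : V →* V).range.comap φ').index = (powMonoidHom 2 : V →* V).range.index :=
    Subgroup.index_comap_of_surjective _ hsurj
  have c4 : (powMonoidHom 2 : V →* V).range.comap φ' = (powMonoidHom 2 : U →* U).range.comap N := by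
    ext w
    rw [Subgroup.mem_comap, Subgroup.mem_comap]
    constructor
    · rintro ⟨⟨_, x, rfl⟩, hx⟩
      have hx' : (φ x) ^ 2 = φ w := congrArg Subtype.val hx
      rw [← h4] at hx'
      have : φ (w * (φ x)⁻¹) = 1 := by rw [map_mul, map_inv, hx']; simp
      obtain ⟨u, hu⟩ := (h2 _).1 this
      refine ⟨u, ?_⟩
      show u ^ 2 = N w
      rw [← h1, hu, map_mul, map_inv, (h3 (φ x)).2 ⟨x, rfl⟩]; simp
    · rintro ⟨u, hu⟩
      have hu' : u ^ 2 = N w := hu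
      have : N (w * (ι u)⁻¹) = 1 := by rw [map_mul, map_inv, h1, hu']; simp
      obtain ⟨x, hx⟩ := (h3 _).1 this
      refine ⟨φ' x, Subtype.ext ?_⟩
      show (φ x) ^ 2 = φ w
      rw [← h4, hx, map_mul, map_inv, (h2 (ι u)).2 ⟨u, rfl⟩]; simp
  rw [c4, c1] at c3
  rw [c3, s2, s1] at c2
  rw [← hrk]
  have hp : 0 < 2 ^ Module.finrank ℤ (Additive V) := by positivity
  have : 2 ^ Module.finrank ℤ (Additive V) * N.range.index = 2 ^ Module.finrank ℤ (Additive U) := by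
    have : (2 ^ Module.finrank ℤ (Additive V) * N.range.index) * 2 = 2 ^ Module.finrank ℤ (Additive U) * 2 := by
      rw [← c2]; ring
    omega
  rw [pow_add, two_mul, pow_add, ← this]; ring

/-- quadratic extension data -/
structure QE (K E : Type*) [Field K] [Field E] [Algebra K E] (a : K) where
  s : E
  hs : s ^ 2 = algebraMap K E a
  gen : ∀ z : E, ∃ x y : K, z = algebraMap K E x + algebraMap K E y * s
  nsq : ∀ r : K, r ^ 2 ≠ a
  σ : E ≃ₐ[K] E
  hσ : σ s = -s

section
universe u
variable {K : Type u} [Field K] [NumberField K]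

theorem exists_qe (a : K) (ha : ∀ r : K, r ^ 2 ≠ a) :
    ∃ (E : Type u) (_ : Field E) (_ : NumberField E) (_ : Algebra K E), Nonempty (QE K E a) := by
  haveI : Fact (∀ r : K, r ^ 2 ≠ a + 0 * r) := ⟨fun r => by simpa using ha r⟩
  let E := QuadraticAlgebra K a 0
  have : CharZero E := inferInstance
  haveI : FiniteDimensional ℚ E := by
    haveI : IsScalarTower ℚ K E := ⟨fun q k e => by
      rw [Algebra.smul_def, Algebra.smul_def, Algebra.smul_def, Algebra.smul_def, map_mul, mul_assoc, eq_ratCast, eq_ratCast, map_ratCast]⟩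
    exact Module.Finite.trans (R := ℚ) K E
  haveI : NumberField E := { }
  have hw : (QuadraticAlgebra.omega : E) * QuadraticAlgebra.omega = algebraMap K E a := by
    rw [QuadraticAlgebra.omega_mul_omega_eq_add]
    simp [Algebra.algebraMap_eq_smul_one]
  let f : E →ₐ[K] E := QuadraticAlgebra.lift ⟨-QuadraticAlgebra.omega, by
    rw [neg_mul_neg, hw]; simp [Algebra.algebraMap_eq_smul_one]⟩
  have hf : f QuadraticAlgebra.omega = - QuadraticAlgebra.omega := by
    simp [f, QuadraticAlgebra.lift]
  have hff : f.comp f = AlgHom.id K E := by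
    apply QuadraticAlgebra.algHom_ext
    rw [AlgHom.comp_apply, hf, map_neg, hf]
    exact neg_neg _
  refine ⟨E, inferInstance, inferInstance, inferInstance, ⟨⟨QuadraticAlgebra.omega, by rw [sq, hw], ?_, ha,
    AlgEquiv.ofAlgHom f f hff hff, hf⟩⟩⟩
  intro z
  refine ⟨z.re, z.im, ?_⟩
  rw [← Algebra.smul_def]
  exact QuadraticAlgebra.mk_eq_add_smul_omega z.re z.im

end
end NND

end

section

namespace NND
set_option linter.unusedSectionVars false
set_option linter.unusedVariables false
set_option linter.style.haveILetI false
open NumberField IsDedekindDomain WithZero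

namespace QE
variable {K E : Type*} [Field K] [NumberField K] [Field E] [NumberField E] [Algebra K E] {a : K}

theorem a_ne (q : QE K E a) : a ≠ 0 := fun h => q.nsq 0 (by simp [h])
theorem s_ne (q : QE K E a) : q.s ≠ 0 := fun h => by
  have := q.hs
  rw [h] at this
  apply q.a_ne
  have h2 : (algebraMap K E) a = 0 := by rw [← this]; simp
  simpa using h2

theorem σσ (q : QE K E a) (z : E) : q.σ (q.σ z) = z := by
  obtain ⟨x, y, rfl⟩ := q.gen z
  simp [q.hσ]

theorem fixed (q : QE K E a) {z : E} (h : q.σ z = z) : ∃ x : K, z = (algebraMap K E) x := by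
  obtain ⟨x, y, rfl⟩ := q.gen z
  refine ⟨x, ?_⟩
  have h1 : q.σ ((algebraMap K E) x + (algebraMap K E) y * q.s) = (algebraMap K E) x - (algebraMap K E) y * q.s := by simp [q.hσ]; ring
  rw [h1] at h
  have h2 : (2 : E) * ((algebraMap K E) y * q.s) = 0 := by linear_combination -h
  have h3 : (algebraMap K E) y * q.s = 0 := by simpa using h2
  rw [h3, add_zero]

theorem exists_nm (q : QE K E a) (z : E) : ∃ n : K, (algebraMap K E) n = z * q.σ z := by
  obtain ⟨n, hn⟩ := q.fixed (z := z * q.σ z) (by rw [map_mul, q.σσ, mul_comm])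
  exact ⟨n, hn.symm⟩

noncomputable def nm (q : QE K E a) (z : E) : K := (q.exists_nm z).choose
theorem nm_eq (q : QE K E a) (z : E) : (algebraMap K E) (q.nm z) = z * q.σ z := (q.exists_nm z).choose_spec

theorem inj (q : QE K E a) {x y : K} (h : (algebraMap K E) x = (algebraMap K E) y) : x = y := (algebraMap K E).injective h

theorem nm_mul (q : QE K E a) (z w : E) : q.nm (z * w) = q.nm z * q.nm w := by
  apply q.inj
  rw [map_mul, q.nm_eq, q.nm_eq, q.nm_eq, map_mul]; ring

theorem nm_ne (q : QE K E a) {z : E} (hz : z ≠ 0) : q.nm z ≠ 0 := by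
  intro h
  have := q.nm_eq z
  rw [h, map_zero] at this
  have h2 : q.σ z ≠ 0 := by simpa using hz
  exact mul_ne_zero hz h2 this.symm

theorem nm_base (q : QE K E a) (x : K) : q.nm ((algebraMap K E) x) = x ^ 2 := by
  apply q.inj; rw [q.nm_eq]; simp; ring

theorem nm_spl (q : QE K E a) (z : E) : Spl (q.nm z) a := by
  obtain ⟨x, y, rfl⟩ := q.gen z
  refine ⟨x, y, ?_⟩
  apply q.inj
  rw [q.nm_eq]
  simp [q.hσ]
  linear_combination ((algebraMap K E) y)^2 * (-q.hs)

noncomputable def nmU (q : QE K E a) : Eˣ →* Kˣ where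
  toFun z := Units.mk0 (q.nm z) (q.nm_ne z.ne_zero)
  map_one' := by
    ext; simp
    have := q.nm_base 1
    simpa using this
  map_mul' := by intro x y; ext; simp [q.nm_mul]

theorem nmU_val (q : QE K E a) (z : Eˣ) : ((q.nmU z : Kˣ) : K) = q.nm z := rfl

noncomputable def σU (q : QE K E a) : Eˣ →* Eˣ := Units.map (q.σ : E →* E)

theorem σU_val (q : QE K E a) (z : Eˣ) : ((q.σU z : Eˣ) : E) = q.σ z := rfl

/-- the conjugate place -/
noncomputable def sg (q : QE K E a) (P : FP E) : FP E := sig q.σ.toRingEquiv P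
theorem sg_od (q : QE K E a) (P : FP E) (x : E) : od (q.sg P) x = od P (q.σ x) := sig_od _ _ _
theorem sg_bel (q : QE K E a) (P : FP E) : bel K (q.sg P) = bel K P := sig_bel _ _

theorem nm_od (q : QE K E a) (P : FP E) {z : E} (hz : z ≠ 0) :
    od P ((algebraMap K E) (q.nm z)) = od P z + od (q.sg P) z := by
  rw [q.nm_eq, od_mul P hz (by simpa using hz), q.sg_od]

theorem nm_mem (q : QE K E a) {S : Finset (FP K)} {w : Eˣ} (hw : w ∈ SU (abv E S)) : q.nmU w ∈ SU S := by
  intro v hv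
  obtain ⟨P, rfl⟩ := exists_above (E := E) v
  obtain ⟨e, he, h⟩ := od_over (K := K) P
  have h1 := q.nm_od P w.ne_zero
  rw [hw P (by simpa using hv), hw (q.sg P) (by simpa [q.sg_bel] using hv), h] at h1
  rw [q.nmU_val]
  have : e * od (bel K P) (q.nm w) = 0 := by simpa using h1
  rcases mul_eq_zero.1 this with h | h
  · omega
  · exact h

theorem base_mem (q : QE K E a) {S : Finset (FP K)} {u : Kˣ} : Units.map ((algebraMap K E) : K →* E) u ∈ SU (abv E S) ↔ u ∈ SU S := by
  constructor
  · intro hu v hv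
    obtain ⟨P, rfl⟩ := exists_above (E := E) v
    obtain ⟨e, he, h⟩ := od_over (K := K) P
    have h1 := hu P (by simpa using hv)
    have h2 : od P ((algebraMap K E) (u : K)) = 0 := h1
    rw [h] at h2
    rcases mul_eq_zero.1 h2 with h | h
    · omega
    · exact h
  · intro hu P hP
    obtain ⟨e, he, h⟩ := od_over (K := K) P
    show od P ((algebraMap K E) (u : K)) = 0
    rw [h, hu _ (by simpa using hP), mul_zero]

theorem σ_mem (q : QE K E a) {S : Finset (FP K)} {w : Eˣ} (hw : w ∈ SU (abv E S)) : q.σU w ∈ SU (abv E S) := by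
  intro P hP
  rw [q.σU_val, ← q.sg_od]
  exact hw _ (by simpa [q.sg_bel] using hP)

theorem s_mem (q : QE K E a) {S : Finset (FP K)} (ha : ∀ v ∉ S, od v a = 0) : Units.mk0 q.s q.s_ne ∈ SU (abv E S) := by
  intro P hP
  obtain ⟨e, he, h⟩ := od_over (K := K) P
  have h1 := od_pow P q.s 2
  rw [q.hs, h, ha _ (by simpa using hP)] at h1
  show od P q.s = 0
  push_cast at h1; omega

theorem hilb90 (q : QE K E a) {S : Finset (FP K)} (hS : ClT S) (h2 : ∀ v ∉ S, od v (2 : K) = 0)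
    (ha : ∀ v ∉ S, od v a = 0) {w : Eˣ} (hw : w ∈ SU (abv E S)) (hn : q.nm w = 1) :
    ∃ z ∈ SU (abv E S), w = z / q.σU z := by
  classical
  have hn' : (w : E) * q.σ w = 1 := by rw [← q.nm_eq, hn, map_one]
  by_cases hm : (w : E) = -1
  · refine ⟨_, q.s_mem ha, ?_⟩
    rw [eq_div_iff_mul_eq']
    ext
    rw [Units.val_mul, hm, q.σU_val, Units.val_mk0, q.hσ]; ring
  set z : E := 1 + w with hz
  have hz0 : z ≠ 0 := fun h => hm (by linear_combination h)
  have hσz : z = w * q.σ z := by rw [hz, map_add, map_one]; linear_combination -hn'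
  obtain ⟨x, y, hxy⟩ := q.gen z
  let n : FP K → ℤ := fun v => -(if x = 0 then od v y else if y = 0 then od v x else min (od v x) (od v y))
  have hxy0 : x ≠ 0 ∨ y ≠ 0 := by
    by_contra h; push Not at h; rw [h.1, h.2] at hxy; simp at hxy; exact hz0 hxy
  obtain ⟨c, hc0, hc⟩ := hS.exists_od n (by
    by_cases hx : x = 0
    · have hy : y ≠ 0 := by tauto
      refine (finite_od hy).subset ?_
      intro v hv h; apply hv; simp [n, hx, h]
    by_cases hy : y = 0
    · refine (finite_od hx).subset ?_
      intro v hv h; apply hv; simp [n, hx, hy, h]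
    refine ((finite_od hx).union (finite_od hy)).subset ?_
    intro v hv
    by_contra h
    simp only [Set.mem_union, Set.mem_ofPred_eq, not_or, not_not] at h
    apply hv; simp [n, hx, hy, h.1, h.2])
  have hcz : (algebraMap K E) c * z ≠ 0 := mul_ne_zero (by simpa using hc0) hz0
  refine ⟨Units.mk0 ((algebraMap K E) c * z) hcz, ?_, ?_⟩
  swap
  · rw [eq_div_iff_mul_eq']
    ext
    rw [Units.val_mul, q.σU_val, Units.val_mk0, map_mul, AlgEquiv.commutes]
    linear_combination -((algebraMap K E) c) * hσz
  intro P hP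
  have hP' : bel K P ∉ S := by simpa using hP
  obtain ⟨e, he, ho⟩ := od_over (K := K) P
  have hcv := hc _ hP'
  set v := bel K P with hv
  rw [Units.val_mk0]
  have hs0 : od P q.s = 0 := q.s_mem ha P hP
  have h20 : od P (2 : E) = 0 := by
    have := ho 2
    rwa [h2 v hP', map_ofNat, mul_zero] at this
  -- coordinates
  have gx : Ge P 0 ((algebraMap K E) (c * x)) := by
    by_cases hx : x = 0
    · rw [hx]; simp [ge_zero]
    rw [ge_iff _ (by simp [hc0, hx]), ho, od_mul v hc0 hx, hcv]
    apply mul_nonneg he.le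
    simp only [n, hx, if_false]
    split_ifs <;> simp
  have gy : Ge P 0 ((algebraMap K E) (c * y) * q.s) := by
    by_cases hy : y = 0
    · rw [hy]; simp [ge_zero]
    rw [ge_iff _ (by simp [hc0, hy, q.s_ne]), od_mul P (by simp [hc0, hy]) q.s_ne, hs0, ho, od_mul v hc0 hy, hcv, add_zero]
    apply mul_nonneg he.le
    simp only [n, hy, if_false]
    split_ifs <;> simp
  have hcz' : (algebraMap K E) c * z = (algebraMap K E) (c * x) + (algebraMap K E) (c * y) * q.s := by rw [hxy, map_mul, map_mul]; ring
  have ge0 : 0 ≤ od P ((algebraMap K E) c * z) := by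
    rw [← ge_iff P hcz, hcz']; exact ge_add gx gy
  -- upper bound
  set k := od P ((algebraMap K E) c * z) with hk
  have hσ1 : q.σ ((algebraMap K E) c * z) = (algebraMap K E) (c * x) - (algebraMap K E) (c * y) * q.s := by
    rw [hcz']; simp [q.hσ]; ring
  have hσ0 : q.σ ((algebraMap K E) c * z) ≠ 0 := by simpa using hcz
  have hk2 : od P (q.σ ((algebraMap K E) c * z)) = k := by
    have : (algebraMap K E) c * z = w * q.σ ((algebraMap K E) c * z) := by
      rw [map_mul, AlgEquiv.commutes]; linear_combination ((algebraMap K E) c) * hσz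
    have h3 := congrArg (od P) this
    rw [od_mul P w.ne_zero hσ0, hw P hP, zero_add] at h3
    exact h3.symm
  have b1 : Ge P k ((algebraMap K E) c * z) := ge_od _ _
  have b2 : Ge P k (q.σ ((algebraMap K E) c * z)) := by rw [← hk2]; exact ge_od _ _
  have kx : x ≠ 0 → k ≤ e * od v (c * x) := fun hx => by
    have h3 := ge_add b1 b2
    rw [hσ1, hcz', show (algebraMap K E) (c * x) + (algebraMap K E) (c * y) * q.s + ((algebraMap K E) (c * x) - (algebraMap K E) (c * y) * q.s) = 2 * (algebraMap K E) (c * x) by ring,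
      ge_iff _ (by simp [hc0, hx]), od_mul P two_ne_zero (by simp [hc0, hx]), h20, ho] at h3
    linarith
  have ky : y ≠ 0 → k ≤ e * od v (c * y) := fun hy => by
    have h3 := ge_sub b1 b2
    rw [hσ1, hcz', show (algebraMap K E) (c * x) + (algebraMap K E) (c * y) * q.s - ((algebraMap K E) (c * x) - (algebraMap K E) (c * y) * q.s) = 2 * ((algebraMap K E) (c * y) * q.s) by ring,
      ge_iff _ (by simp [hc0, hy, q.s_ne]), od_mul P two_ne_zero (by simp [hc0, hy, q.s_ne]), od_mul P (by simp [hc0, hy]) q.s_ne, h20, hs0, ho] at h3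
    linarith
  have kle : k ≤ 0 := by
    by_cases hx : x = 0
    · have hy : y ≠ 0 := by tauto
      have := ky hy
      rw [od_mul v hc0 hy, hcv] at this
      simpa [n, hx] using this
    by_cases hy : y = 0
    · have := kx hx
      rw [od_mul v hc0 hx, hcv] at this
      simpa [n, hx, hy] using this
    have a1 := kx hx
    have a2 := ky hy
    rw [od_mul v hc0 hx, hcv] at a1
    rw [od_mul v hc0 hy, hcv] at a2
    simp only [n, hx, hy, if_false] at a1 a2
    rcases min_cases (od v x) (od v y) with ⟨h, _⟩ | ⟨h, _⟩
    · rw [h] at a1; simpa using a1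
    · rw [h] at a2; simpa using a2
  omega

end QE
end NND

end

section

namespace NND
set_option linter.unusedSectionVars false
set_option linter.unusedVariables false
set_option linter.style.haveILetI false
open NumberField IsDedekindDomain WithZero

/-- the places in `S` together with all infinite places -/
noncomputable def PS {K : Type*} [Field K] [NumberField K] (S : Finset (FP K)) : Finset (Pl K) :=
  S.disjSum Finset.univ

section
variable {K : Type*} [Field K] [NumberField K]
@[simp] theorem inl_mem_PS {S : Finset (FP K)} {v : FP K} : (Sum.inl v : Pl K) ∈ PS S ↔ v ∈ S := by simp [PS]
@[simp] theorem inr_mem_PS {S : Finset (FP K)} {v : InfinitePlace K} : (Sum.inr v : Pl K) ∈ PS S := by simp [PS]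
theorem PS_card (S : Finset (FP K)) : (PS S).card = S.card + Fintype.card (InfinitePlace K) := by
  simp [PS, Finset.card_disjSum]
theorem PS_mono {S S' : Finset (FP K)} (h : S ⊆ S') : PS S ⊆ PS S' := by
  intro v hv
  rcases v with v | v
  · simp at hv ⊢; exact h hv
  · simp
open Classical in
/-- nonsplit places -/
noncomputable def NS (a : K) (S : Finset (FP K)) : Finset (Pl K) := (PS S).filter fun v => ¬ LSq (pav v) a
end

namespace QE
variable {K E : Type*} [Field K] [NumberField K] [Field E] [NumberField E] [Algebra K E] {a : K}

noncomputable def psg (q : QE K E a) : Pl E → Pl E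
  | Sum.inl P => Sum.inl (q.sg P)
  | Sum.inr w => Sum.inr (w.comap q.σ.toRingEquiv.toRingHom)

theorem pbel_psg (q : QE K E a) (V : Pl E) : pbel K (q.psg V) = pbel K V := by
  rcases V with P | w
  · exact congrArg Sum.inl (q.sg_bel P)
  · refine congrArg Sum.inr ?_
    rw [← InfinitePlace.comap_comp]
    congr 1
    ext x
    simp

theorem exists_pabove (q : QE K E a) (v : Pl K) : ∃ V : Pl E, pbel K V = v := by
  rcases v with v | w
  · obtain ⟨P, hP⟩ := exists_above (E := E) v
    exact ⟨Sum.inl P, congrArg Sum.inl hP⟩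
  · obtain ⟨W, hW⟩ := InfinitePlace.comap_surjective (k := K) (K := E) w
    exact ⟨Sum.inr W, congrArg Sum.inr hW⟩

theorem psg_inv (q : QE K E a) {V : Pl E} (h : q.psg V = V) (x : E) : pav V (q.σ x) = pav V x := by
  by_cases hx : x = 0
  · subst hx; simp
  rcases V with P | w
  · have h1 : q.sg P = P := Sum.inl_injective h
    have h2 := q.sg_od P x
    rw [h1] at h2
    rw [pav_inl, fabv_eq _ hx, fabv_eq _ (by simpa using hx), h2]
  · have h1 : w.comap q.σ.toRingEquiv.toRingHom = w := Sum.inr_injective h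
    have : (w.comap q.σ.toRingEquiv.toRingHom) x = w x := by rw [h1]
    exact this

theorem psg_ne (q : QE K E a) {V : Pl E} (h : LSq (pav (pbel K V)) a) : q.psg V ≠ V := by
  intro he
  have hinv := q.psg_inv he
  have h2 : 0 < pav V (2 : E) := (pav V).pos two_ne_zero
  obtain ⟨δ, hδ, H⟩ := pav_cmp (K := K) V ((pav V 2 / 2) ^ 2) (by positivity)
  obtain ⟨y, hy⟩ := h.2 δ hδ
  have h3 := H _ hy
  have e1 : (algebraMap K E) (a * y ^ 2 - 1) = (q.s * (algebraMap K E) y - 1) * (q.s * (algebraMap K E) y + 1) := by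
    simp [← q.hs]; ring
  have e2 : pav V (q.s * (algebraMap K E) y - 1) = pav V (q.s * (algebraMap K E) y + 1) := by
    rw [← hinv, map_sub, map_mul, q.hσ, AlgEquiv.commutes, map_one, ← (pav V).map_neg]
    congr 1; ring
  rw [e1, map_mul, e2, ← sq] at h3
  have h4 : pav V (q.s * (algebraMap K E) y + 1) < pav V 2 / 2 := lt_of_pow_lt_pow_left₀ 2 (by positivity) h3
  have h5 : pav V 2 ≤ pav V (q.s * (algebraMap K E) y + 1) + pav V (q.s * (algebraMap K E) y - 1) := by
    have := (pav V).sub_le_add (q.s * (algebraMap K E) y + 1) (q.s * (algebraMap K E) y - 1)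
    rwa [show q.s * (algebraMap K E) y + 1 - (q.s * (algebraMap K E) y - 1) = 2 by ring] at this
  rw [e2] at h5
  linarith

theorem place_count (q : QE K E a) (S : Finset (FP K)) :
    2 * (PS S).card ≤ (PS (abv E S)).card + (NS a S).card := by
  classical
  choose up hup using fun v : Pl K => q.exists_pabove v
  have hinj : Function.Injective up := fun v w h => by rw [← hup v, h, hup]
  have hinj2 : Function.Injective (fun v => q.psg (up v)) := fun v w h => by
    have := congrArg (pbel K) h
    simpa [q.pbel_psg, hup] using this
  have hmem : ∀ V : Pl E, V ∈ PS (abv E S) ↔ pbel K V ∈ PS S := by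
    intro V
    rcases V with P | w
    · simp [pbel]
    · simp [pbel]
  set A := (PS S).image up
  set B := ((PS S).filter fun v => LSq (pav v) a).image (fun v => q.psg (up v))
  have hd : Disjoint A B := by
    rw [Finset.disjoint_left]
    intro V hA hB
    obtain ⟨v, hv, rfl⟩ := Finset.mem_image.1 hA
    obtain ⟨w, hw, hw2⟩ := Finset.mem_image.1 hB
    have := congrArg (pbel K) hw2
    simp only [q.pbel_psg, hup] at this
    subst this
    refine q.psg_ne (V := up w) ?_ hw2
    rw [hup]; exact (Finset.mem_filter.1 hw).2
  have hsub : A ∪ B ⊆ PS (abv E S) := by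
    intro V hV
    rw [hmem]
    rcases Finset.mem_union.1 hV with h | h
    · obtain ⟨v, hv, rfl⟩ := Finset.mem_image.1 h
      rw [hup]; exact hv
    · obtain ⟨w, hw, rfl⟩ := Finset.mem_image.1 h
      rw [q.pbel_psg, hup]; exact (Finset.mem_filter.1 hw).1
  have h1 := Finset.card_le_card hsub
  rw [Finset.card_union_of_disjoint hd, Finset.card_image_of_injective _ hinj, Finset.card_image_of_injective _ hinj2] at h1
  have h2 := Finset.card_filter_add_card_filter_not (s := PS S) (fun v => LSq (pav v) a)
  have h3 : (NS a S).card = ((PS S).filter fun v => ¬ LSq (pav v) a).card := by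
    unfold NS; congr
  omega

end QE

theorem two_tors {F : Type*} [Field F] [CharZero F] {G : Type*} [CommGroup G] (j : G →* Fˣ)
    (hj : Function.Injective j) {m : G} (hm : ((j m : Fˣ) : F) = -1) :
    Nat.card (powMonoidHom 2 : G →* G).ker = 2 := by
  rw [Nat.card_eq_two_iff]
  have hm2 : m ^ 2 = 1 := hj (by ext; simp [hm])
  refine ⟨⟨1, by simp⟩, ⟨m, hm2⟩, ?_, ?_⟩
  · intro h
    have h1 : (1 : G) = m := congrArg Subtype.val h
    rw [← h1] at hm
    simp at hm
    norm_num [eq_neg_iff_add_eq_zero] at hm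
  · ext ⟨x, hx⟩
    have hx2 : x ^ 2 = 1 := hx
    have h3 : ((j x : Fˣ) : F) ^ 2 = 1 := by
      have := congrArg (fun t => ((j t : Fˣ) : F)) hx2
      simpa using this
    simp only [Set.mem_insert_iff, Set.mem_singleton_iff, Set.mem_univ, iff_true, Subtype.mk.injEq]
    rw [sq] at h3
    rcases mul_self_eq_one_iff.1 h3 with h | h
    · left; exact hj (by ext; simp [h])
    · right; exact Subtype.ext (hj (Units.ext (h.trans hm.symm)))

section
universe u
variable {K : Type u} [Field K] [NumberField K]

theorem QE.unit_index {E : Type*} [Field E] [NumberField E] [Algebra K E] {a : K} (q : QE K E a)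
    {S : Finset (FP K)} (hS : ClT S) (h2 : ∀ v ∉ S, od v (2 : K) = 0) (ha : ∀ v ∉ S, od v a = 0) :
    ∃ N : Subgroup (SU S), (∀ b ∈ N, Spl (((b : SU S) : Kˣ) : K) a) ∧ N.index ≠ 0 ∧ 2 * N.index ≤ 2 ^ (NS a S).card := by
  let U := SU S
  let W := SU (abv E S)
  let i : U →* W := ((Units.map (algebraMap K E : K →* E)).comp U.subtype).codRestrict W
    (fun u => (q.base_mem).2 u.2)
  let N : W →* U := (q.nmU.comp W.subtype).codRestrict U (fun w => q.nm_mem w.2)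
  let φ : W →* W := ((MonoidHom.id Eˣ / q.σU).comp W.subtype).codRestrict W
    (fun w => W.div_mem w.2 (q.σ_mem w.2))
  have hφ : ∀ w : W, ((φ w : W) : Eˣ) = (w : Eˣ) / q.σU w := fun w => rfl
  have hNv : ∀ w : W, (((N w : U) : Kˣ) : K) = q.nm ((w : Eˣ) : E) := fun w => rfl
  have hiv : ∀ u : U, (((i u : W) : Eˣ) : E) = algebraMap K E ((u : Kˣ) : K) := fun w => rfl
  have hσσ : ∀ w : Eˣ, q.σU (q.σU w) = w := fun w => by ext; simp [q.σU_val, q.σσ]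
  have h3 : ∀ w, N w = 1 ↔ w ∈ φ.range := by
    intro w
    constructor
    · intro h
      obtain ⟨z, hz, hw⟩ := q.hilb90 hS h2 ha w.2 (by rw [← hNv, h]; simp)
      exact ⟨⟨z, hz⟩, Subtype.ext hw.symm⟩
    · rintro ⟨z, rfl⟩
      ext
      rw [hNv]
      apply q.inj
      rw [q.nm_eq, hφ]
      have := hσσ z
      simp only [Units.val_div_eq_div_val, map_div₀, q.σU_val, q.σσ]
      have h1 : ((z : Eˣ) : E) ≠ 0 := Units.ne_zero _
      have h2 : q.σ ((z : Eˣ) : E) ≠ 0 := by simpa using h1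
      field_simp
      simp
  have key := herb i (by
      intro x y h
      have := congrArg (fun t : W => ((t : Eˣ) : E)) h
      simp only [hiv] at this
      exact Subtype.ext (Units.ext (q.inj this))) N φ
    (by
      intro u
      ext
      rw [hNv, hiv, q.nm_base]; simp)
    (by
      intro w
      constructor
      · intro h
        have h1 := congrArg (fun t : W => (t : Eˣ)) h
        simp only [hφ] at h1
        have h2 : (w : Eˣ) = q.σU w := by simpa [div_eq_one] using h1
        obtain ⟨x, hx⟩ := q.fixed (z := ((w : Eˣ) : E)) (by rw [← q.σU_val, ← h2])
        have hx0 : x ≠ 0 := by rintro rfl; simp at hx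
        have hw : (w : Eˣ) = Units.map (algebraMap K E : K →* E) (Units.mk0 x hx0) := by
          ext; simp [hx]
        refine ⟨⟨Units.mk0 x hx0, ?_⟩, Subtype.ext hw.symm⟩
        rw [← q.base_mem, ← hw]; exact w.2
      · rintro ⟨u, rfl⟩
        ext
        rw [hφ]
        simp [q.σU_val, hiv])
    h3
    (by
      intro w
      apply Subtype.ext
      rw [hφ, hφ, map_div, hσσ, sq, Subgroup.coe_mul, hφ]
      rw [div_div_eq_mul_div, div_mul_eq_mul_div, div_mul_div_comm, div_div])
    (two_tors (F := K) U.subtype Subtype.val_injective (m := ⟨-1, fun v hv => by simp⟩) (by simp))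
    (two_tors (F := E) (W.subtype.comp φ.range.subtype) (Subtype.val_injective.comp Subtype.val_injective)
      (m := ⟨⟨-1, fun v hv => by simp⟩, ⟨⟨_, q.s_mem ha⟩, by
        ext
        rw [hφ]
        simp [q.σU_val, q.hσ, q.s_ne]⟩⟩) (by simp))
  refine ⟨N.range, ?_, ?_, ?_⟩
  · rintro _ ⟨w, rfl⟩
    rw [hNv]; exact q.nm_spl _
  · intro h0
    rw [h0, zero_mul] at key
    exact absurd key (by positivity)
  · have r1 : Module.finrank ℤ (Additive U) + 1 = _ := finrank_SU S
    have r2 : Module.finrank ℤ (Additive W) + 1 = _ := finrank_SU (abv E S)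
    have pc := q.place_count S
    rw [PS_card, PS_card] at pc
    have hp : 0 < 2 ^ Module.finrank ℤ (Additive W) := by positivity
    refine Nat.le_of_mul_le_mul_right (c := 2 ^ Module.finrank ℤ (Additive W)) ?_ hp
    calc 2 * N.range.index * 2 ^ Module.finrank ℤ (Additive W)
        = 2 ^ (2 * Module.finrank ℤ (Additive U) + 1) := by rw [mul_assoc, key]; ring
      _ ≤ 2 ^ ((NS a S).card + Module.finrank ℤ (Additive W)) := by
        apply Nat.pow_le_pow_right (by norm_num)
        omega
      _ = _ := by rw [pow_add]

/-- (i) unit norm index bound -/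
theorem unit_index {a : K} (hns : ∀ r : K, r ^ 2 ≠ a)
    {S : Finset (FP K)} (hS : ClT S) (h2 : ∀ v ∉ S, od v (2 : K) = 0) (ha : ∀ v ∉ S, od v a = 0) :
    ∃ N : Subgroup (SU S), (∀ b ∈ N, Spl (((b : SU S) : Kˣ) : K) a) ∧ N.index ≠ 0 ∧ 2 * N.index ≤ 2 ^ (NS a S).card := by
  obtain ⟨E, _, _, _, ⟨q⟩⟩ := exists_qe a hns
  exact q.unit_index hS h2 ha
end

end NND

end

section

namespace NND
set_option linter.unusedSectionVars false
set_option linter.unusedVariables false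
set_option linter.style.haveILetI false
open NumberField IsDedekindDomain WithZero

theorem index_indep {G : Type*} [CommGroup G] {ι : Type*} [DecidableEq ι] (R : Finset ι) (H : ι → Subgroup G)
    (h : ∀ v ∈ R, ∃ g, g ∉ H v ∧ ∀ w ∈ R, w ≠ v → g ∈ H w) (N : Subgroup G)
    (hN : ∀ v ∈ R, N ≤ H v) (hN0 : N.index ≠ 0) : 2 ^ R.card ≤ N.index := by
  suffices hs : ∀ R' ⊆ R, (⨅ v ∈ R', H v).index ≠ 0 → 2 ^ R'.card ≤ (⨅ v ∈ R', H v).index by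
    have hle : N ≤ ⨅ v ∈ R, H v := by simpa using hN
    have h1 := Subgroup.index_dvd_of_le hle
    have h2 : (⨅ v ∈ R, H v).index ≠ 0 := fun h0 => hN0 (by rw [h0] at h1; simpa using h1)
    exact (hs R subset_rfl h2).trans (Nat.le_of_dvd (Nat.pos_of_ne_zero hN0) h1)
  intro R'
  induction R' using Finset.induction_on with
  | empty => intro _ _; simp
  | insert v R' hv ih =>
    intro hsub h0
    have hle : (⨅ w ∈ insert v R', H w) ≤ ⨅ w ∈ R', H w := by
      apply le_iInf₂
      intro w hw
      exact iInf₂_le w (Finset.mem_insert_of_mem hw)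
    have h1 := Subgroup.relIndex_mul_index hle
    have h3 : (⨅ w ∈ R', H w).index ≠ 0 := fun h => h0 (by rw [← h1, h, mul_zero])
    have h4 := ih (fun x hx => hsub (Finset.mem_insert_of_mem hx)) h3
    have h5 : (⨅ w ∈ insert v R', H w).relIndex (⨅ w ∈ R', H w) ≠ 1 := by
      rw [Ne, Subgroup.relIndex_eq_one]
      intro hcon
      obtain ⟨g, hg, hg2⟩ := h v (hsub (Finset.mem_insert_self _ _))
      apply hg
      have : g ∈ ⨅ w ∈ R', H w := by
        simp only [Subgroup.mem_iInf]
        intro w hw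
        exact hg2 w (hsub (Finset.mem_insert_of_mem hw)) (fun e => hv (e ▸ hw))
      have h6 := hcon this
      simp only [Subgroup.mem_iInf] at h6
      exact h6 v (Finset.mem_insert_self _ _)
    have h6 : (⨅ w ∈ insert v R', H w).relIndex (⨅ w ∈ R', H w) ≠ 0 := fun h => h0 (by rw [← h1, h, zero_mul])
    rw [Finset.card_insert_of_notMem hv, ← h1, pow_succ, mul_comm]
    exact Nat.mul_le_mul (by omega) h4

section
universe u
variable {K : Type u} [Field K] [NumberField K]

/-- good sets of places: class group trivial and containing all dyadic places -/
structure Gd (S : Finset (FP K)) : Prop where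
  cl : ClT S
  dy : ∀ v ∉ S, od v (2 : K) = 0

theorem Gd.mono {S S' : Finset (FP K)} (h : Gd S) (hS : S ⊆ S') : Gd S' :=
  ⟨h.cl.mono hS, fun v hv => h.dy v fun h => hv (hS h)⟩

theorem exists_gd (S0 : Finset (FP K)) : ∃ S, S0 ⊆ S ∧ Gd S := by
  classical
  obtain ⟨S1, h1⟩ := exists_clT K
  refine ⟨S0 ∪ (S1 ∪ (finite_od (K := K) two_ne_zero).toFinset), Finset.subset_union_left, ?_, ?_⟩
  · exact h1.mono (Finset.subset_union_left.trans Finset.subset_union_right)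
  · intro v hv
    simp at hv
    tauto

theorem exists_supp (x : K) (hx : x ≠ 0) : ∃ S : Finset (FP K), ∀ v ∉ S, od v x = 0 := by
  refine ⟨(finite_od hx).toFinset, fun v hv => ?_⟩
  simpa using hv

theorem mem_NS {a : K} {S : Finset (FP K)} {v : Pl K} : v ∈ NS a S ↔ v ∈ PS S ∧ ¬ LSq (pav v) a := by
  simp [NS]

theorem no_surj {a : K} (hns : ∀ r : K, r ^ 2 ≠ a) {S : Finset (FP K)} (hS : Gd S)
    (ha : ∀ v ∉ S, od v a = 0)
    (h : ∀ v ∈ NS a S, ∃ u : K, u ≠ 0 ∧ (∀ w ∉ S, od w u = 0) ∧ ¬ SplAt (pav v) a u ∧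
      ∀ w ∈ NS a S, w ≠ v → SplAt (pav w) a u) : False := by
  classical
  obtain ⟨N, hN, hN0, hN2⟩ := unit_index hns hS.cl hS.dy ha
  have := index_indep (NS a S) (fun v => (Nm (pav v) a).comap (SU S).subtype) (by
    intro v hv
    obtain ⟨u, hu0, hu, h1, h2⟩ := h v hv
    exact ⟨⟨Units.mk0 u hu0, hu⟩, h1, h2⟩) N (fun v hv b hb => splAt_of_spl _ (hN b hb)) hN0
  have h1 : 0 < 2 ^ (NS a S).card := by positivity
  omega

/-- choose a global element with prescribed norm residue symbols on a finite set -/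
theorem exists_sep_norm {a : K} (ha : a ≠ 0) (R : Finset (Pl K)) {v : Pl K} (hv : ¬ LSq (pav v) a) :
    ∃ z : K, z ≠ 0 ∧ ¬ SplAt (pav v) a z ∧ ∀ w ∈ R, w ≠ v → SplAt (pav w) a z := by
  classical
  obtain ⟨b, hb0, hb⟩ := nondeg ha hv
  obtain ⟨z, hz0, hz⟩ := exists_class' (insert v R) (fun w => if w = v then b else 1) (by
    intro w _; split_ifs <;> simp [hb0])
  refine ⟨z, hz0, ?_, ?_⟩
  · have := hz v (Finset.mem_insert_self _ _)
    rw [if_pos rfl] at this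
    rwa [splAt_congr hz0 hb0 this]
  · intro w hw hwv
    have := hz w (Finset.mem_insert_of_mem hw)
    rw [if_neg hwv, mul_one] at this
    exact splAt_of_lsq _ this

/-- a nonsquare is a local non-square at some place outside any finite set -/
theorem exists_nonres {b : K} (hns : ∀ r : K, r ^ 2 ≠ b) (S : Finset (FP K)) :
    ∃ v ∉ S, ¬ LSq (fabv v) b := by
  classical
  by_contra hcon
  push Not at hcon
  obtain ⟨E, _, _, _, ⟨q⟩⟩ := exists_qe b hns
  obtain ⟨T0, hT0⟩ := exists_clT E
  obtain ⟨Sb, hSb⟩ := exists_supp b q.a_ne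
  obtain ⟨S1, hS1, hg⟩ := exists_gd (S ∪ Sb ∪ T0.image (bel K))
  have hT : ClT (abv E S1) := hT0.mono fun P hP => by
    simp only [mem_abv]
    exact hS1 (Finset.mem_union_right _ (Finset.mem_image_of_mem _ hP))
  have key : ∀ z : K, z ≠ 0 → ∃ n : K, n ≠ 0 ∧ Spl n b ∧ ∀ v ∉ S1, od v (z * n) = 0 := by
    intro z hz
    choose up hup using fun v : FP K => exists_above (E := E) v
    have hz' : algebraMap K E z ≠ 0 := by simpa using hz
    obtain ⟨c, hc0, hc⟩ := hT.exists_od (fun P => if up (bel K P) = P then - od P (algebraMap K E z) else 0) (by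
      refine (finite_od hz').subset ?_
      intro P hP h
      apply hP
      simp [h])
    refine ⟨q.nm c, q.nm_ne hc0, q.nm_spl c, fun v hv => ?_⟩
    have hne : q.sg (up v) ≠ up v := by
      intro h
      refine q.psg_ne (V := Sum.inl (up v)) ?_ (congrArg Sum.inl h)
      show LSq (fabv (bel K (up v))) b
      rw [hup]
      exact hcon v fun h => hv (hS1 (by simp [h]))
    obtain ⟨e, he, ho⟩ := od_over (K := K) (up v)
    have h1 := q.nm_od (up v) hc0
    rw [hc (up v) (by simpa [hup] using hv), hc (q.sg (up v)) (by simpa [hup, q.sg_bel] using hv),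
      q.sg_bel, hup, if_pos rfl, if_neg (Ne.symm hne), ho, ho, hup, add_zero] at h1
    rw [od_mul v hz (q.nm_ne hc0)]
    have : e * (od v (q.nm c) + od v z) = 0 := by linarith
    rcases mul_eq_zero.1 this with h | h
    · omega
    · omega
  refine no_surj hns hg (fun v hv => hSb v fun h => hv (hS1 (by simp [h]))) ?_
  intro v hv
  obtain ⟨z, hz0, hz1, hz2⟩ := exists_sep_norm q.a_ne (NS b S1) (mem_NS.1 hv).2
  obtain ⟨n, hn0, hn1, hn2⟩ := key z hz0
  refine ⟨z * n, mul_ne_zero hz0 hn0, hn2, ?_, ?_⟩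
  · rwa [splAt_mul_iff hn0 (splAt_of_spl _ hn1)]
  · intro w hw hwv
    exact splAt_mul (hz2 w hw hwv) (splAt_of_spl _ hn1)

end
end NND

end

section

namespace NND
set_option linter.unusedSectionVars false
set_option linter.unusedVariables false
set_option linter.style.haveILetI false
open NumberField IsDedekindDomain WithZero

section Odd
variable {K : Type*} [Field K] [NumberField K]

theorem o_sq {v : FP K} (h2 : od v (2 : K) = 0) {x : K} (hx : x ≠ 0) (hx0 : od v x = 0) {r : 𝓞 K}
    (hr : Ge v 1 (x - r)) : LSq (fabv v) x ↔ IsSquare (Ideal.Quotient.mk v.asIdeal r) := by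
  have h4 : od v (4 : K) + 1 = 1 := by rw [od4, h2]; simp
  constructor
  · intro h
    obtain ⟨y, hy⟩ := exists_of_lsq_fin h 1
    obtain ⟨h0, h1⟩ := unit_of_near hy
    have hy0 : y ≠ 0 := by rintro rfl; simp at h0
    rw [od_mul v hx (pow_ne_zero 2 hy0), od_pow, hx0] at h1
    have hy1 : od v y = 0 := by push_cast at h1; omega
    have hyi : Ge v 0 y⁻¹ := by rw [ge_iff v (inv_ne_zero hy0), od_inv, hy1]; simp
    obtain ⟨s, hs⟩ := exists_int_approx v hyi 1
    refine ⟨Ideal.Quotient.mk _ s, ?_⟩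
    rw [← map_mul, red_eq_iff]
    have e1 : Ge v 1 (x - y⁻¹ ^ 2) := by
      have := ge_mul hy (ge_pow hyi 2)
      rw [add_zero] at this
      convert this using 1; field_simp
    have e2 : Ge v 1 (y⁻¹ ^ 2 - (s : K) ^ 2) := by
      have := ge_mul hs (ge_add hyi (ge_int v s))
      rw [add_zero] at this
      convert this using 1; ring
    have := ge_add (ge_sub e1 hr) e2
    convert this using 1; push_cast; ring
  · rintro ⟨t, ht⟩
    obtain ⟨s, rfl⟩ := Ideal.Quotient.mk_surjective t
    rw [← map_mul, red_eq_iff] at ht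
    refine lsq_fin_of' (x := (s : K)) hx hx0 ?_
    rw [h4]
    have := ge_add hr ht
    convert this using 1; push_cast; ring

theorem kf_two {v : FP K} (h2 : od v (2 : K) = 0) : ringChar (kf v) ≠ 2 := by
  intro h
  have h0 : ((2 : ℕ) : kf v) = 0 := by rw [← h]; exact ringChar.Nat.cast_ringChar
  have h1 : Ideal.Quotient.mk v.asIdeal (2 : 𝓞 K) = Ideal.Quotient.mk v.asIdeal 0 := by
    rw [map_zero]; exact_mod_cast h0
  rw [red_eq_iff] at h1
  have e : ((2 : 𝓞 K) : K) = 2 := map_ofNat (algebraMap (𝓞 K) K) 2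
  have h3 : Ge v 1 (2 : K) := by
    rw [← e]
    simpa using h1
  rw [ge_iff v two_ne_zero, h2] at h3
  omega

theorem nsq_mul {F : Type*} [Field F] [Finite F] (hF : ringChar F ≠ 2) {a b : F} (ha : ¬ IsSquare a) (hb : ¬ IsSquare b) :
    IsSquare (a * b) := by
  classical
  haveI := Fintype.ofFinite F
  have ha0 : a ≠ 0 := by rintro rfl; simp at ha
  have hb0 : b ≠ 0 := by rintro rfl; simp at hb
  rw [← quadraticChar_one_iff_isSquare (mul_ne_zero ha0 hb0), map_mul,
    (quadraticChar_neg_one_iff_not_isSquare (a := a)).2 ha, (quadraticChar_neg_one_iff_not_isSquare (a := b)).2 hb]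
  norm_num

theorem o_approx {v : FP K} {x : K} (hx0 : od v x = 0) : ∃ r : 𝓞 K, Ge v 1 (x - r) := by
  by_cases hx : x = 0
  · exact ⟨0, by simp [hx, ge_zero]⟩
  exact exists_int_approx v ((ge_iff v hx).2 hx0.ge) 1

theorem ge_mul_sub {v : FP K} {x y r s : K} {n : ℤ} (hx : Ge v 0 x) (hs : Ge v 0 s) (h1 : Ge v n (x - r)) (h2 : Ge v n (y - s)) :
    Ge v n (x * y - r * s) := by
  have e1 := ge_mul hx h2
  have e2 := ge_mul h1 hs
  rw [zero_add] at e1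
  rw [add_zero] at e2
  have := ge_add e1 e2
  convert this using 1; ring

/-- product of two unit non-residues is a residue -/
theorem o_prod {v : FP K} (h2 : od v (2 : K) = 0) {x y : K} (hx : x ≠ 0) (hx0 : od v x = 0)
    (hy : y ≠ 0) (hy0 : od v y = 0) (h : ¬ LSq (fabv v) x) (h' : ¬ LSq (fabv v) y) :
    LSq (fabv v) (x * y) := by
  obtain ⟨r, hr⟩ := o_approx hx0
  obtain ⟨s, hs⟩ := o_approx hy0
  rw [o_sq h2 hx hx0 hr] at h
  rw [o_sq h2 hy hy0 hs] at h'
  rw [o_sq h2 (mul_ne_zero hx hy) (by rw [od_mul v hx hy, hx0, hy0]; simp) (r := r * s), map_mul]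
  · exact nsq_mul (kf_two h2) h h'
  · have := ge_mul_sub ((ge_iff v hx).2 hx0.ge) (ge_int v s) hr hs
    simpa using this

theorem o_unr {v : FP K} (h2 : od v (2 : K) = 0) {x : K} (hx : x ≠ 0) (hx0 : od v x = 0)
    (h : ¬ LSq (fabv v) x) : Unr v x := by
  have h4 : od v (4 : K) = 0 := by rw [od4, h2]; simp
  have h40 : (4 : K) ≠ 0 := by norm_num
  have h4i : Ge v 0 (4 : K)⁻¹ := by rw [ge_iff v (inv_ne_zero h40), od_inv, h4]; simp
  have hg4 : Ge v 0 (4 : K) := by rw [ge_iff v h40, h4]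
  have hxg : Ge v 0 x := (ge_iff v hx).2 hx0.ge
  refine ⟨(1 - x) * 4⁻¹, ?_, by field_simp; ring, ?_⟩
  · exact ge_mul' (ge_sub (ge_one v) hxg) h4i (by simp)
  · intro t ht hcon
    apply h
    refine lsq_fin_of' (x := 2 * t - 1) hx hx0 ?_
    rw [h4]
    have := ge_mul hg4 (ge_neg hcon)
    convert this using 1
    field_simp; ring

theorem o_spl {v : FP K} (h2 : od v (2 : K) = 0) {a b : K} (ha : a ≠ 0) (ha0 : od v a = 0)
    (hb : b ≠ 0) (hb0 : od v b = 0) : SplAt (fabv v) a b := by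
  classical
  obtain ⟨r, hr⟩ := o_approx ha0
  obtain ⟨s, hs⟩ := o_approx hb0
  haveI := Fintype.ofFinite (kf v)
  have hr0 : Ideal.Quotient.mk v.asIdeal r ≠ 0 := by
    intro h
    rw [← map_zero (Ideal.Quotient.mk v.asIdeal), red_eq_iff] at h
    have := ge_add hr h
    rw [show a - (r : K) + (r - (0 : 𝓞 K)) = a by push_cast; ring, ge_iff v ha, ha0] at this
    omega
  obtain ⟨p', q', hpq⟩ := FiniteField.exists_root_sum_quadratic
    (f := (Polynomial.X ^ 2 - Polynomial.C (Ideal.Quotient.mk v.asIdeal s) : Polynomial (kf v)))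
    (g := (Polynomial.C (-Ideal.Quotient.mk v.asIdeal r) * Polynomial.X ^ 2 : Polynomial (kf v)))
    (by compute_degree!) (by rw [Polynomial.degree_C_mul_X_pow _ (by simpa using hr0)]; rfl)
    (FiniteField.odd_card_of_char_ne_two (kf_two h2))
  obtain ⟨p, rfl⟩ := Ideal.Quotient.mk_surjective p'
  obtain ⟨q, rfl⟩ := Ideal.Quotient.mk_surjective q'
  simp only [Polynomial.eval_sub, Polynomial.eval_pow, Polynomial.eval_X, Polynomial.eval_C, Polynomial.eval_mul] at hpq
  have e1 : Ideal.Quotient.mk v.asIdeal (p ^ 2 - r * q ^ 2) = Ideal.Quotient.mk v.asIdeal s := by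
    simp only [map_sub, map_mul, map_pow]
    linear_combination hpq
  rw [red_eq_iff] at e1
  have e2 : Ge v 1 (((p : K) ^ 2 - a * (q : K) ^ 2) - b) := by
    have f1 : Ge v 1 ((a - r) * (q : K) ^ 2) := ge_mul' hr (ge_pow (ge_int v q) 2) (by simp)
    have := ge_sub (ge_sub e1 f1) hs
    convert this using 1
    push_cast; ring
  have e3 : Ge v 1 (((p : K) ^ 2 - a * (q : K) ^ 2) / b - 1) := by
    have : Ge v 0 b⁻¹ := by rw [ge_iff v (inv_ne_zero hb), od_inv, hb0]; simp
    have := ge_mul' (k := 1) e2 this (by simp)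
    convert this using 1; field_simp
  obtain ⟨n0, n1⟩ := unit_of_near e3
  refine ⟨p, q, ((p : K) ^ 2 - a * (q : K) ^ 2) / b, ?_, by field_simp⟩
  refine lsq_fin_of' (x := 1) n0 n1 ?_
  rw [od4, h2]; simpa using e3

theorem lsq_of_even {v : FP K} (h2 : od v (2 : K) = 0) {κ x : K} (hκ : κ ≠ 0) (hκ0 : od v κ = 0)
    (hκ1 : ¬ LSq (fabv v) κ) (hx : x ≠ 0) (hev : Even (od v x)) (h : ¬ LSq (fabv v) x) :
    LSq (fabv v) (κ * x) := by
  obtain ⟨c, hc, hod⟩ := unit_rep hx hev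
  have := o_prod h2 hκ hκ0 (mul_ne_zero hx (pow_ne_zero 2 hc)) hod hκ1 (by rwa [lsq_mul_sq hc])
  rw [← mul_assoc] at this
  rwa [lsq_mul_sq hc] at this

theorem o_spl_even {v : FP K} (h2 : od v (2 : K) = 0) {x y : K} (hx : x ≠ 0) (hy : y ≠ 0)
    (hx0 : Even (od v x)) (hy0 : Even (od v y)) : SplAt (fabv v) x y := by
  obtain ⟨c, hc, hod⟩ := unit_rep hx hx0
  obtain ⟨d, hd, hod2⟩ := unit_rep hy hy0
  have hxc := mul_ne_zero hx (pow_ne_zero 2 hc)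
  have hyd := mul_ne_zero hy (pow_ne_zero 2 hd)
  have h := o_spl h2 hxc hod hyd hod2
  rw [splAt_mul_iff (pow_ne_zero 2 hd) (splAt_of_lsq _ (lsq_sq _ hd))] at h
  have h' := splAt_symm hxc hy h
  rw [splAt_mul_iff (pow_ne_zero 2 hc) (splAt_of_lsq _ (lsq_sq _ hc))] at h'
  exact splAt_symm hy hx h'


theorem o_three {v : FP K} (h2 : od v (2 : K) = 0) {κ x y : K} (hκ : κ ≠ 0) (hκ0 : od v κ = 0)
    (hκ1 : ¬ LSq (fabv v) κ) (hx : x ≠ 0) (hy : y ≠ 0) (h : ¬ SplAt (fabv v) x y) :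
    LSq (fabv v) (κ * x) ∨ LSq (fabv v) (κ * y) ∨ LSq (fabv v) (-(κ * x * y)) := by
  by_cases hex : Even (od v x)
  · left
    exact lsq_of_even h2 hκ hκ0 hκ1 hx hex fun hl => h (splAt_of_lsq_left hy hl)
  by_cases hey : Even (od v y)
  · right; left
    exact lsq_of_even h2 hκ hκ0 hκ1 hy hey fun hl => h (splAt_of_lsq _ hl)
  right; right
  rw [show -(κ * x * y) = κ * (-(x * y)) by ring]
  refine lsq_of_even h2 hκ hκ0 hκ1 (neg_ne_zero.2 (mul_ne_zero hx hy)) ?_ ?_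
  · rw [od_neg, od_mul v hx hy]
    rw [Int.not_even_iff_odd] at hex hey
    exact hex.add_odd hey
  · intro hl
    have h1 : SplAt (fabv v) x (y * (-x)) := by
      rw [show y * (-x) = -(x * y) by ring]; exact splAt_of_lsq _ hl
    rw [splAt_mul_iff (neg_ne_zero.2 hx) (splAt_neg_self _ x)] at h1
    exact h h1

theorem o_ns {v : FP K} (h2 : od v (2 : K) = 0) {κ b : K} (hκ : κ ≠ 0) (hκ0 : od v κ = 0)
    (hκ1 : ¬ LSq (fabv v) κ) (hb : b ≠ 0) (hodd : ¬ Even (od v b)) : ¬ SplAt (fabv v) κ b :=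
  fun h => hodd (unr_even (o_unr h2 hκ hκ0 hκ1) hb h)

/-- at an odd place some unit is a non-residue -/
theorem exists_unit_nonres {v : FP K} (h2 : od v (2 : K) = 0) :
    ∃ κ : 𝓞 K, (κ : K) ≠ 0 ∧ od v (κ : K) = 0 ∧ ¬ LSq (fabv v) (κ : K) := by
  obtain ⟨t, ht⟩ := FiniteField.exists_nonsquare (F := kf v) (kf_two h2)
  obtain ⟨r, rfl⟩ := Ideal.Quotient.mk_surjective t
  have hr : r ∉ v.asIdeal := fun h => by
    rw [(Ideal.Quotient.eq_zero_iff_mem).2 h] at ht; simp at ht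
  have hr0 : (r : K) ≠ 0 := by
    intro h; apply hr
    have : r = 0 := by simpa using h
    rw [this]; exact zero_mem _
  refine ⟨r, hr0, od_int_eq_zero hr, ?_⟩
  rwa [o_sq h2 hr0 (od_int_eq_zero hr) (r := r) (by simp [ge_zero])]

end Odd

section
universe u
variable {K : Type u} [Field K] [NumberField K]

theorem QE.sq_iff {E : Type*} [Field E] [NumberField E] [Algebra K E] {a : K} (q : QE K E a) {b : K}
    (h1 : ∀ r : K, r ^ 2 ≠ b) (h2 : ∀ r : K, r ^ 2 ≠ a * b) (z : E) : z ^ 2 ≠ algebraMap K E b := by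
  intro h
  obtain ⟨x, y, rfl⟩ := q.gen z
  have h3 := congrArg q.σ h
  simp only [map_pow, map_add, map_mul, q.hσ, AlgEquiv.commutes] at h3
  have h4 : (4 : E) * (algebraMap K E x * algebraMap K E y * q.s) = 0 := by linear_combination h - h3
  have h5 : algebraMap K E x = 0 ∨ algebraMap K E y = 0 := by
    simpa [q.s_ne] using h4
  rcases h5 with h5 | h5
  · apply h2 (a * y)
    apply q.inj
    rw [h5] at h
    simp only [map_mul, map_pow]
    linear_combination (algebraMap K E a) * h - algebraMap K E a * (algebraMap K E y)^2 * q.hs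
  · apply h1 x
    apply q.inj
    rw [h5] at h
    simpa using h

/-- a place where `a` splits but `b` is inert -/
theorem exists_split_nonres {a b : K} (ha : ∀ r : K, r ^ 2 ≠ a) (hb : ∀ r : K, r ^ 2 ≠ b)
    (hab : ∀ r : K, r ^ 2 ≠ a * b) (S : Finset (FP K)) :
    ∃ v ∉ S, LSq (fabv v) a ∧ ¬ LSq (fabv v) b := by
  classical
  obtain ⟨E, _, _, _, ⟨q⟩⟩ := exists_qe a ha
  have hb0 : b ≠ 0 := fun h => hb 0 (by simp [h])
  obtain ⟨Sa, hSa⟩ := exists_supp a q.a_ne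
  obtain ⟨Sb, hSb⟩ := exists_supp b hb0
  obtain ⟨S2, hS2⟩ := exists_supp (2 : K) two_ne_zero
  obtain ⟨P, hP, hPb⟩ := exists_nonres (q.sq_iff hb hab) (abv E (S ∪ Sa ∪ Sb ∪ S2))
  simp only [mem_abv, Finset.mem_union, not_or] at hP
  obtain ⟨⟨⟨h1, h2⟩, h3⟩, h4⟩ := hP
  have hvb : ¬ LSq (fabv (bel K P)) b := fun h => hPb (lsq_up (K := K) (Sum.inl P) h)
  refine ⟨bel K P, h1, ?_, hvb⟩
  by_contra hva
  have h5 := o_prod (hS2 _ h4) q.a_ne (hSa _ h2) hb0 (hSb _ h3) hva hvb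
  have h6 : LSq (fabv P) (algebraMap K E (a * b)) := lsq_up (K := K) (Sum.inl P) h5
  rw [map_mul, ← q.hs, mul_comm, lsq_mul_sq q.s_ne] at h6
  exact hPb h6

end
end NND

end

section

namespace NND
set_option linter.unusedSectionVars false
set_option linter.unusedVariables false
set_option linter.style.haveILetI false
open NumberField IsDedekindDomain WithZero

section LocIndex
variable {K : Type*} [Field K] [NumberField K]

theorem q_eq_iff (v : FP K) (n : ℕ) (r s : 𝓞 K) :
    (Ideal.Quotient.mk (v.asIdeal ^ n) r = Ideal.Quotient.mk (v.asIdeal ^ n) s) ↔ Ge v n ((r : K) - s) := by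
  rw [Ideal.Quotient.eq, ← ge_iff_mem]; simp

instance finite_q (v : FP K) (n : ℕ) : Finite (𝓞 K ⧸ v.asIdeal ^ n) :=
  Ideal.finiteQuotientOfFreeOfNeBot _ (pow_ne_zero n v.ne_bot)

theorem card_q (v : FP K) (n : ℕ) : Nat.card (𝓞 K ⧸ v.asIdeal ^ n) = (Ideal.absNorm v.asIdeal) ^ n := by
  rw [← map_pow, Ideal.absNorm_apply, Submodule.cardQuot_apply]

theorem absNorm_pos (v : FP K) : 0 < Ideal.absNorm v.asIdeal := by
  have := absNorm_gt v
  have h : (0:ℝ) < Ideal.absNorm v.asIdeal := by linarith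
  exact_mod_cast h

theorem card_fker (v : FP K) {m n : ℕ} (h : m ≤ n) :
    Nat.card (RingHom.ker (Ideal.Quotient.factor (Ideal.pow_le_pow_right h : v.asIdeal ^ n ≤ v.asIdeal ^ m)))
      = (Ideal.absNorm v.asIdeal) ^ (n - m) := by
  set f := Ideal.Quotient.factor (Ideal.pow_le_pow_right h : v.asIdeal ^ n ≤ v.asIdeal ^ m) with hf
  have h1 := AddSubgroup.card_mul_index f.toAddMonoidHom.ker
  have hs : Function.Surjective f.toAddMonoidHom :=
    Ideal.Quotient.factor_surjective (Ideal.pow_le_pow_right h : v.asIdeal ^ n ≤ v.asIdeal ^ m)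
  rw [AddSubgroup.index_ker, AddMonoidHom.range_eq_top.2 hs, AddSubgroup.card_top, card_q, card_q] at h1
  have h2 : Nat.card f.toAddMonoidHom.ker = Nat.card (RingHom.ker f) := rfl
  rw [h2] at h1
  have h3 : (Ideal.absNorm v.asIdeal) ^ n = (Ideal.absNorm v.asIdeal) ^ (n - m) * (Ideal.absNorm v.asIdeal) ^ m := by
    rw [← pow_add]; congr 1; omega
  rw [h3] at h1
  exact Nat.eq_of_mul_eq_mul_right (pow_pos (absNorm_pos v) m) h1

theorem sq_one_near {v : FP K} {e : ℕ} (he : od v (2 : K) = e) {r : 𝓞 K} (h : Ge v (2 * e + 1 : ℕ) ((r : K) ^ 2 - 1)) :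
    Ge v (e + 1 : ℕ) ((r : K) - 1) ∨ Ge v (e + 1 : ℕ) ((r : K) + 1) := by
  by_contra hc
  push Not at hc
  obtain ⟨h1, h2⟩ := hc
  have n1 : (r : K) - 1 ≠ 0 := by intro h0; rw [h0] at h1; exact h1 (ge_zero _ _)
  have n2 : (r : K) + 1 ≠ 0 := by intro h0; rw [h0] at h2; exact h2 (ge_zero _ _)
  have e1 : (r : K) ^ 2 - 1 = ((r : K) - 1) * ((r : K) + 1) := by ring
  rw [e1, ge_iff v (mul_ne_zero n1 n2), od_mul v n1 n2] at h
  rw [ge_iff v n1] at h1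
  rw [ge_iff v n2] at h2
  push_cast at *
  omega

theorem card_sq_ker {v : FP K} {e : ℕ} (he : od v (2 : K) = e) :
    Nat.card (powMonoidHom 2 : (𝓞 K ⧸ v.asIdeal ^ (2 * e + 1))ˣ →* _).ker ≤ 2 * (Ideal.absNorm v.asIdeal) ^ e := by
  classical
  set f := Ideal.Quotient.factor (Ideal.pow_le_pow_right (by omega) : v.asIdeal ^ (2 * e + 1) ≤ v.asIdeal ^ (e + 1)) with hf
  have hcard : Nat.card (Bool × RingHom.ker f) = 2 * (Ideal.absNorm v.asIdeal) ^ e := by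
    rw [Nat.card_prod, card_fker v (by omega)]
    congr 2
    · simp
    · omega
  rw [← hcard]
  have key : ∀ g : (powMonoidHom 2 : (𝓞 K ⧸ v.asIdeal ^ (2 * e + 1))ˣ →* _).ker,
      ∃ b : Bool, f (((g : (𝓞 K ⧸ v.asIdeal ^ (2 * e + 1))ˣ) : 𝓞 K ⧸ v.asIdeal ^ (2 * e + 1)) - if b then 1 else -1) = 0 := by
    rintro ⟨g, hg⟩
    rw [MonoidHom.mem_ker, powMonoidHom_apply] at hg
    have hg' : (g : 𝓞 K ⧸ v.asIdeal ^ (2 * e + 1)) ^ 2 = 1 := by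
      rw [← Units.val_pow_eq_pow_val, hg, Units.val_one]
    obtain ⟨r, hr⟩ := Ideal.Quotient.mk_surjective (g : 𝓞 K ⧸ v.asIdeal ^ (2 * e + 1))
    rw [← hr, ← map_pow, ← map_one (Ideal.Quotient.mk _), q_eq_iff] at hg'
    rcases sq_one_near he (r := r) (by simpa using hg') with h | h
    · refine ⟨true, ?_⟩
      have : Ideal.Quotient.mk (v.asIdeal ^ (e + 1)) r = Ideal.Quotient.mk _ 1 := by
        rw [q_eq_iff]; simpa using h
      simp only [if_true, map_sub, map_one, ← hr]
      rw [hf, Ideal.Quotient.factor_mk, this]; simp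
    · refine ⟨false, ?_⟩
      have : Ideal.Quotient.mk (v.asIdeal ^ (e + 1)) r = Ideal.Quotient.mk _ (-1) := by
        rw [q_eq_iff]; simpa using h
      simp only [Bool.false_eq_true, if_false, map_sub, map_neg, map_one, ← hr]
      rw [hf, Ideal.Quotient.factor_mk, this]; simp
  choose b hb using key
  haveI : Finite (Bool × RingHom.ker f) := inferInstance
  refine Nat.card_le_card_of_injective (fun g => (b g, ⟨_, RingHom.mem_ker.2 (hb g)⟩)) ?_
  intro g g' h
  simp only [Prod.mk.injEq, Subtype.mk.injEq] at h
  obtain ⟨h1, h2⟩ := h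
  rw [h1] at h2
  exact Subtype.ext (Units.ext (sub_left_injective h2))

theorem loc_index (v : FP K) {e : ℕ} (he : od v (2 : K) = e) :
    (LSg (fabv v)).index ≠ 0 ∧ (LSg (fabv v)).index ≤ 4 * (Ideal.absNorm v.asIdeal) ^ e := by
  classical
  set n := 2 * e + 1 with hn
  set G := (𝓞 K ⧸ v.asIdeal ^ n)ˣ with hG
  set Q := G ⧸ (powMonoidHom 2 : G →* G).range with hQ
  have h4 : od v (4 : K) + 1 = (n : ℕ) := by rw [od4, he, hn]; push_cast; ring
  have hQc : Nat.card (Bool × Q) ≤ 4 * (Ideal.absNorm v.asIdeal) ^ e := by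
    rw [Nat.card_prod]
    have h1 : Nat.card Q = Nat.card (powMonoidHom 2 : G →* G).ker := Subgroup.index_range
    have h2 := card_sq_ker he
    have h3 : Nat.card Bool = 2 := by simp
    rw [h1, h3]
    have : Nat.card (powMonoidHom 2 : G →* G).ker ≤ 2 * (Ideal.absNorm v.asIdeal) ^ e := h2
    linarith
  obtain ⟨π, hπ0, hπ⟩ := exists_unif v
  have lift : ∀ g : G, ∃ r : 𝓞 K, Ideal.Quotient.mk _ r = (g : 𝓞 K ⧸ v.asIdeal ^ n) ∧ (r : K) ≠ 0 ∧ od v (r : K) = 0 := by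
    intro g
    obtain ⟨r, hr⟩ := Ideal.Quotient.mk_surjective (g : 𝓞 K ⧸ v.asIdeal ^ n)
    obtain ⟨s, hs⟩ := Ideal.Quotient.mk_surjective ((g⁻¹ : G) : 𝓞 K ⧸ v.asIdeal ^ n)
    have h : Ideal.Quotient.mk (v.asIdeal ^ n) (r * s) = Ideal.Quotient.mk _ 1 := by
      rw [map_mul, hr, hs, map_one]; exact Units.mul_inv _
    rw [q_eq_iff] at h
    have h' : Ge v 1 ((r : K) * s - 1) := by
      refine ge_mono (n := (n : ℕ)) ?_ ?_
      · rw [hn]; push_cast; omega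
      · simpa using h
    obtain ⟨h0, h1⟩ := unit_of_near h'
    have hr0 : (r : K) ≠ 0 := left_ne_zero_of_mul h0
    have hs0 : (s : K) ≠ 0 := right_ne_zero_of_mul h0
    rw [od_mul v hr0 hs0] at h1
    have := od_int_nonneg v r
    have := od_int_nonneg v s
    exact ⟨r, hr, hr0, by omega⟩
  choose l hl hl0 hl1 using lift
  let F : Bool × Q → Kˣ ⧸ LSg (fabv v) := fun p =>
    ((Units.mk0 ((if p.1 then (π : K) else 1) * (l p.2.out : K)) (mul_ne_zero (by split_ifs <;> simp_all) (hl0 _)) : Kˣ) : Kˣ ⧸ LSg (fabv v))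
  have hF : Function.Surjective F := by
    intro c
    obtain ⟨x, rfl⟩ := QuotientGroup.mk_surjective c
    obtain ⟨b, k, hbk⟩ : ∃ (b : Bool) (k : ℤ), od v (x : K) = (if b then 1 else 0) + 2 * k := by
      rcases Int.emod_two_eq_zero_or_one (od v (x : K)) with h | h
      · exact ⟨false, od v (x : K) / 2, by simp; omega⟩
      · exact ⟨true, od v (x : K) / 2, by simp; omega⟩
    set ρ : K := if b then (π : K) else 1 with hρ
    have hρ0 : ρ ≠ 0 := by rw [hρ]; split_ifs <;> simp_all
    have hρ1 : od v ρ = if b then 1 else 0 := by rw [hρ]; split_ifs <;> simp_all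
    have hz0 : ((π : K) ^ k) ≠ 0 := zpow_ne_zero _ hπ0
    set x0 : K := (x : K) / (ρ * ((π : K) ^ k) ^ 2) with hx0
    have hx00 : x0 ≠ 0 := div_ne_zero x.ne_zero (mul_ne_zero hρ0 (pow_ne_zero 2 hz0))
    have hx0o : od v x0 = 0 := by
      rw [hx0, od_div v x.ne_zero (mul_ne_zero hρ0 (pow_ne_zero 2 hz0)), od_mul v hρ0 (pow_ne_zero 2 hz0), od_pow, od_zpow, hπ, hbk, hρ1]
      push_cast; ring
    have hx0i : Ge v 0 x0 := (ge_iff v hx00).2 hx0o.ge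
    have hx0i' : Ge v 0 x0⁻¹ := (ge_iff v (inv_ne_zero hx00)).2 (by rw [od_inv, hx0o]; simp)
    obtain ⟨r, hr⟩ := exists_int_approx v hx0i n
    obtain ⟨r', hr'⟩ := exists_int_approx v hx0i' n
    have hrr : Ideal.Quotient.mk (v.asIdeal ^ n) r * Ideal.Quotient.mk (v.asIdeal ^ n) r' = 1 := by
      rw [← map_mul, ← map_one (Ideal.Quotient.mk _), q_eq_iff]
      have := ge_mul_sub hx0i (ge_int v r') hr hr'
      rw [mul_inv_cancel₀ hx00] at this
      rw [ge_sub_comm]; simpa using this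
    let g : G := Units.mkOfMulEqOne _ _ hrr
    refine ⟨(b, (g : Q)), ?_⟩
    have hout : ((Quotient.out (g : Q) : G) : Q) = (g : Q) := QuotientGroup.out_eq' _
    obtain ⟨h, hh⟩ : (g : G)⁻¹ * (Quotient.out (g : Q) : G) ∈ (powMonoidHom 2 : G →* G).range :=
      QuotientGroup.eq.1 hout.symm
    rw [powMonoidHom_apply] at hh
    have hh' : (Quotient.out (g : Q) : G) = g * h ^ 2 := by rw [hh]; simp
    obtain ⟨t, ht⟩ := Ideal.Quotient.mk_surjective (h : 𝓞 K ⧸ v.asIdeal ^ n)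
    set s := l (Quotient.out (g : Q)) with hs
    have e1 : Ideal.Quotient.mk (v.asIdeal ^ n) s = Ideal.Quotient.mk _ (r * t ^ 2) := by
      rw [hs, hl, hh', map_mul, map_pow, ht]
      exact (Units.val_mul g (h ^ 2)).trans (congrArg₂ (· * ·) rfl (Units.val_pow_eq_pow_val h 2))
    rw [q_eq_iff] at e1
    have e2 : Ge v n ((x0 - r) * (t : K) ^ 2) := by
      have := ge_mul hr (ge_pow (ge_int v t) 2)
      simpa using this
    have e3 : Ge v n ((s : K) - x0 * (t : K) ^ 2) := by
      have := ge_sub e1 e2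
      convert this using 1; push_cast; ring
    have e4 : Ge v n ((s : K) / x0 - (t : K) ^ 2) := by
      have := ge_mul e3 hx0i'
      rw [add_zero] at this
      convert this using 1; field_simp
    have e5 : LSq (fabv v) ((s : K) / x0) := by
      refine lsq_fin_of' (div_ne_zero (hl0 _) hx00) ?_ (x := (t : K)) ?_
      · rw [od_div v (hl0 _) hx00, hx0o, hl1]; simp
      · rw [h4]; exact e4
    refine (QuotientGroup.eq.2 ?_)
    rw [mem_LSg]
    have e6 := lsq_mul (lsq_inv e5) (lsq_sq (fabv v) hz0)
    convert e6 using 1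
    push_cast
    simp only [Units.val_mk0]
    change (ρ * (s : K))⁻¹ * _ = _
    have hs0 : (s : K) ≠ 0 := hl0 _
    rw [hx0]; field_simp
  haveI : Finite (Bool × Q) := inferInstance
  haveI := Finite.of_surjective F hF
  refine ⟨?_, ?_⟩
  · rw [Subgroup.index]; exact Nat.card_pos.ne'
  · rw [Subgroup.index]; exact (Nat.card_le_card_of_surjective F hF).trans hQc

theorem loc_index_real {w : InfinitePlace K} (hw : w.IsReal) : (LSg w.1).index ≠ 0 ∧ (LSg w.1).index ≤ 2 := by
  classical
  let F : Bool → Kˣ ⧸ LSg w.1 := fun b => if b then ((1 : Kˣ) : Kˣ ⧸ LSg w.1) else ((-1 : Kˣ) : Kˣ ⧸ LSg w.1)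
  have hF : Function.Surjective F := by
    intro c
    obtain ⟨x, rfl⟩ := QuotientGroup.mk_surjective c
    have h0 : InfinitePlace.embedding_of_isReal hw (x : K) ≠ 0 := by simp
    rcases lt_or_gt_of_ne h0 with h | h
    · refine ⟨false, ?_⟩
      simp only [F, Bool.false_eq_true, if_false]
      rw [QuotientGroup.eq, mem_LSg, lsq_real_iff hw]
      simpa using h
    · refine ⟨true, ?_⟩
      simp only [F, if_true]
      rw [QuotientGroup.eq, mem_LSg, lsq_real_iff hw]
      simpa using h
  haveI := Finite.of_surjective F hF
  refine ⟨?_, ?_⟩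
  · rw [Subgroup.index]; exact Nat.card_pos.ne'
  · rw [Subgroup.index]; exact (Nat.card_le_card_of_surjective F hF).trans (by simp)

theorem loc_index_complex {w : InfinitePlace K} (hw : w.IsComplex) : (LSg w.1).index = 1 := by
  rw [Subgroup.index_eq_one, Subgroup.eq_top_iff']
  intro x
  exact lsq_complex hw x.ne_zero

/-- the group of elements that are local squares at all of `S` and the infinite places -/
noncomputable def LS (S : Finset (FP K)) : Subgroup Kˣ := ⨅ v : PS S, LSg (pav v.1)

theorem mem_LS {S : Finset (FP K)} {x : Kˣ} : x ∈ LS S ↔ ∀ v ∈ PS S, LSq (pav v) (x : K) := by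
  simp [LS, Subgroup.mem_iInf, mem_LSg]

theorem prod_norm_le (S : Finset (FP K)) :
    ∏ v ∈ S, (Ideal.absNorm v.asIdeal) ^ (od v (2 : K)).toNat ≤ 2 ^ Module.finrank ℚ K := by
  have h1 : ∏ v ∈ S, v.asIdeal ^ (od v (2 : K)).toNat ∣ Ideal.span {(2 : 𝓞 K)} := by
    refine Finset.prod_dvd_of_coprime ?_ ?_
    · intro v hv w hw hvw
      refine IsCoprime.pow ?_
      rw [Ideal.isCoprime_iff_sup_eq]
      haveI := v.isMaximal
      haveI := w.isMaximal
      refine Ideal.IsMaximal.coprime_of_ne v.isMaximal w.isMaximal ?_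
      intro h; exact hvw (HeightOneSpectrum.ext h)
    · intro v hv
      rw [Ideal.dvd_span_singleton, ← ge_iff_mem]
      have e : ((2 : 𝓞 K) : K) = 2 := map_ofNat (algebraMap (𝓞 K) K) 2
      rw [e, ge_iff v two_ne_zero]
      have : 0 ≤ od v (2 : K) := by exact_mod_cast od_nat_nonneg v 2
      omega
  have h2 := map_dvd (Ideal.absNorm) h1
  rw [map_prod, Ideal.absNorm_span_singleton] at h2
  have h3 : Algebra.norm ℤ (2 : 𝓞 K) = 2 ^ Module.finrank ℚ K := by
    have := Algebra.norm_algebraMap (S := 𝓞 K) (2 : ℤ)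
    rw [RingOfIntegers.rank] at this
    simpa using this
  rw [h3] at h2
  simp only [map_pow] at h2
  rw [Int.natAbs_pow] at h2
  exact Nat.le_of_dvd (by positivity) (by simpa using h2)

theorem pl_index_ne (v : Pl K) : (LSg (pav v)).index ≠ 0 := by
  rcases v with v | w
  · obtain ⟨e, he⟩ := Int.eq_ofNat_of_zero_le (a := od v (2 : K)) (by exact_mod_cast od_nat_nonneg v 2)
    exact (loc_index v he).1
  · rcases w.isReal_or_isComplex with h | h
    · exact (loc_index_real h).1
    · simp [loc_index_complex h]

theorem LS_index (S : Finset (FP K)) : (LS S).index ≠ 0 ∧ (LS S).index ≤ 4 ^ (PS S).card := by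
  classical
  refine ⟨Subgroup.index_iInf_ne_zero fun v => pl_index_ne v.1, ?_⟩
  refine (Subgroup.index_iInf_le _).trans ?_
  rw [Finset.prod_coe_sort (PS S) (fun v => (LSg (pav v)).index)]
  rw [PS, Finset.prod_disjSum, Finset.card_disjSum, pow_add]
  have h1 : ∏ v ∈ S, (LSg (pav (Sum.inl v : Pl K))).index ≤ 4 ^ S.card * 2 ^ Module.finrank ℚ K := by
    refine le_trans (b := ∏ v ∈ S, (4 * (Ideal.absNorm v.asIdeal) ^ (od v (2 : K)).toNat)) ?_ ?_
    · refine Finset.prod_le_prod' fun v hv => ?_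
      refine (loc_index v ?_).2
      have : 0 ≤ od v (2 : K) := by exact_mod_cast od_nat_nonneg v 2
      omega
    · rw [Finset.prod_mul_distrib, Finset.prod_const]
      exact Nat.mul_le_mul_left _ (prod_norm_le S)
  have h2 : ∏ w : InfinitePlace K, (LSg (pav (Sum.inr w : Pl K))).index ≤ 2 ^ InfinitePlace.nrRealPlaces K := by
    refine le_trans (b := ∏ w : InfinitePlace K, (if w.IsReal then 2 else 1)) ?_ ?_
    · refine Finset.prod_le_prod' fun w hw => ?_
      split_ifs with h
      · exact (loc_index_real h).2
      · exact (loc_index_complex (InfinitePlace.not_isReal_iff_isComplex.1 h)).le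
    · rw [Finset.prod_ite]
      simp only [Finset.prod_const, one_pow, mul_one]
      refine Nat.pow_le_pow_right (by norm_num) ?_
      rw [InfinitePlace.nrRealPlaces, Fintype.card_subtype]
  calc _ ≤ (4 ^ S.card * 2 ^ Module.finrank ℚ K) * 2 ^ InfinitePlace.nrRealPlaces K := Nat.mul_le_mul h1 h2
    _ = _ := by
      rw [← InfinitePlace.card_add_two_mul_card_eq_rank, Finset.card_univ, InfinitePlace.card_eq_nrRealPlaces_add_nrComplexPlaces,
        mul_assoc, ← pow_add, show (4:ℕ) = 2 ^ 2 by norm_num, ← pow_mul, ← pow_mul, ← pow_add, ← pow_add]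
      congr 1; ring
end LocIndex
end NND

end

section

namespace NND
set_option linter.unusedSectionVars false
set_option linter.unusedVariables false
set_option linter.style.haveILetI false
open NumberField IsDedekindDomain WithZero

universe u

theorem index_le_two {G : Type*} [CommGroup G] {H : Subgroup G} (h : ∀ x y, x ∉ H → y ∉ H → x * y ∈ H) :
    H.index ≠ 0 ∧ H.index ≤ 2 := by
  classical
  by_cases ht : ∃ x, x ∉ H
  · obtain ⟨x, hx⟩ := ht
    let F : Bool → G ⧸ H := fun b => if b then ((1 : G) : G ⧸ H) else ((x⁻¹ : G) : G ⧸ H)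
    have hF : Function.Surjective F := by
      intro c
      obtain ⟨y, rfl⟩ := QuotientGroup.mk_surjective c
      by_cases hy : y ∈ H
      · refine ⟨true, ?_⟩
        simp only [F, if_true]
        rw [QuotientGroup.eq]; simpa using hy
      · refine ⟨false, ?_⟩
        simp only [F, Bool.false_eq_true, if_false]
        rw [QuotientGroup.eq]; simpa using h x y hx hy
    haveI := Finite.of_surjective F hF
    refine ⟨?_, ?_⟩
    · rw [Subgroup.index]; exact Nat.card_pos.ne'
    · rw [Subgroup.index]; exact (Nat.card_le_card_of_surjective F hF).trans (by simp)
  · push Not at ht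
    have : H = ⊤ := (Subgroup.eq_top_iff' H).2 ht
    simp [this]

section Hasse
variable {K : Type u} [Field K] [NumberField K]

theorem SU_sq_index (S : Finset (FP K)) :
    (powMonoidHom 2 : SU S →* SU S).range.index = 2 ^ (PS S).card := by
  rw [sq_index, two_tors (SU S).subtype Subtype.val_injective (m := ⟨-1, by intro v hv; simp⟩) (by simp),
    PS_card, ← finrank_SU, pow_succ]

theorem SU_sq {S : Finset (FP K)} {b : SU S} (h : ∃ r : K, r ^ 2 = ((b : Kˣ) : K)) :
    b ∈ (powMonoidHom 2 : SU S →* SU S).range := by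
  obtain ⟨r, hr⟩ := h
  have hr0 : r ≠ 0 := by
    rintro rfl
    exact (b : Kˣ).ne_zero (by rw [← hr]; simp)
  refine ⟨⟨Units.mk0 r hr0, ?_⟩, ?_⟩
  · intro v hv
    have := b.2 v hv
    rw [← hr, od_pow] at this
    push_cast at this
    simp only [Units.val_mk0]
    omega
  · apply Subtype.ext; apply Units.ext
    simpa using hr

theorem exists_places {a : K} (hns : ∀ r : K, r ^ 2 ≠ a) (S : Finset (FP K)) (hS : Gd S) :
    ∀ k, k + 1 ≤ (PS S).card → ∃ T : Finset (FP K), T.card = k ∧ (∀ v ∈ T, v ∉ S) ∧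
      (∀ v ∈ T, LSq (fabv v) a) ∧ ∀ v ∈ T, ∃ g ∈ SU S, ¬ LSq (fabv v) (g : K) ∧ ∀ w ∈ T, w ≠ v → LSq (fabv w) (g : K) := by
  classical
  intro k
  induction k with
  | zero => intro _; exact ⟨∅, by simp⟩
  | succ k ih =>
    intro hk
    obtain ⟨T, hTc, hTS, hTa, hTg⟩ := ih (by omega)
    set H : Subgroup (SU S) := ⨅ v : T, (LSg (fabv v.1)).comap (SU S).subtype with hH
    have hHm : ∀ b : SU S, b ∈ H ↔ ∀ v ∈ T, LSq (fabv v) ((b : Kˣ) : K) := by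
      intro b; simp [hH, Subgroup.mem_iInf, Subgroup.mem_subgroupOf, mem_LSg]
    have hone : ∀ v : T, ((LSg (fabv v.1)).comap (SU S).subtype).index ≤ 2 := by
      rintro ⟨v, hv⟩
      refine (index_le_two ?_).2
      intro x y hx hy
      exact o_prod (hS.dy v (hTS v hv)) (x : Kˣ).ne_zero (x.2 v (hTS v hv)) (y : Kˣ).ne_zero (y.2 v (hTS v hv)) hx hy
    have hHi : H.index ≤ 2 ^ k := by
      refine (Subgroup.index_iInf_le _).trans ?_
      refine (Finset.prod_le_prod' (fun v _ => hone v)).trans ?_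
      simp [hTc]
    obtain ⟨b, hbH, hb1, hb2⟩ : ∃ b : SU S, b ∈ H ∧ (∀ r : K, r ^ 2 ≠ ((b : Kˣ) : K)) ∧ ∀ r : K, r ^ 2 ≠ a * ((b : Kˣ) : K) := by
      by_contra hc
      push Not at hc
      have hle : (powMonoidHom 2 : SU S →* SU S).range ≤ H := by
        rintro _ ⟨x, rfl⟩
        rw [hHm]
        intro v hv
        simpa using lsq_sq (fabv v) (x : Kˣ).ne_zero
      have h1 := Subgroup.relIndex_mul_index hle
      have h2 : (powMonoidHom 2 : SU S →* SU S).range.relIndex H ≤ 2 := by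
        refine (index_le_two ?_).2
        intro x y hx hy
        rw [Subgroup.mem_subgroupOf] at hx hy ⊢
        obtain ⟨r, hr⟩ := hc x x.2 (fun r hr => hx (SU_sq ⟨r, hr⟩))
        obtain ⟨r', hr'⟩ := hc y y.2 (fun r hr => hy (SU_sq ⟨r, hr⟩))
        refine SU_sq ⟨r * r' / a, ?_⟩
        have ha0 : a ≠ 0 := by rintro rfl; exact hns 0 (by simp)
        rw [div_pow, mul_pow, hr, hr']
        push_cast
        field_simp
      rw [SU_sq_index] at h1
      have h3 : 2 ^ (PS S).card ≤ 2 ^ (k + 1) := by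
        rw [← h1, pow_succ, mul_comm]
        exact Nat.mul_le_mul hHi h2
      have := (Nat.pow_le_pow_iff_right (by norm_num : 1 < 2)).1 h3
      omega
    obtain ⟨v, hv, hva, hvb⟩ := exists_split_nonres hns hb1 hb2 (S ∪ T)
    simp only [Finset.mem_union, not_or] at hv
    rw [hHm] at hbH
    refine ⟨insert v T, ?_, ?_, ?_, ?_⟩
    · rw [Finset.card_insert_of_notMem hv.2, hTc]
    · intro w hw
      rcases Finset.mem_insert.1 hw with rfl | hw
      · exact hv.1
      · exact hTS w hw
    · intro w hw
      rcases Finset.mem_insert.1 hw with rfl | hw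
      · exact hva
      · exact hTa w hw
    · intro w hw
      rcases Finset.mem_insert.1 hw with rfl | hw
      · refine ⟨b, b.2, hvb, ?_⟩
        intro w' hw' hne
        rcases Finset.mem_insert.1 hw' with rfl | hw'
        · exact absurd rfl hne
        · exact hbH w' hw'
      · obtain ⟨g, hg, hg1, hg2⟩ := hTg w hw
        by_cases hgv : LSq (fabv v) (g : K)
        · refine ⟨g, hg, hg1, ?_⟩
          intro w' hw' hne
          rcases Finset.mem_insert.1 hw' with rfl | hw'
          · exact hgv
          · exact hg2 w' hw' hne
        · refine ⟨g * b, mul_mem hg b.2, ?_, ?_⟩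
          · intro h
            apply hg1
            have := lsq_div h (hbH w hw)
            rw [Units.val_mul, mul_div_assoc, div_self (b : Kˣ).ne_zero, mul_one] at this
            exact this
          · intro w' hw' hne
            rcases Finset.mem_insert.1 hw' with rfl | hw'
            · exact o_prod (hS.dy w' hv.1) g.ne_zero (hg w' hv.1) (b : Kˣ).ne_zero (b.2 w' hv.1) hgv hvb
            · rw [Units.val_mul]; exact lsq_mul (hg2 w' hw' hne) (hbH w' hw')

theorem lsq_prod {ι : Type*} {v : AbsoluteValue K ℝ} (J : Finset ι) (g : ι → K) (h : ∀ j ∈ J, LSq v (g j)) :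
    LSq v (∏ j ∈ J, g j) :=
  Finset.prod_induction g (LSq v) (fun _ _ => lsq_mul) (lsq_one v) h

theorem lsq_is_sq {S T : Finset (FP K)} [DecidableEq (FP K)] (hS : Gd S) (hT : ∀ v ∈ T, v ∉ S)
    (hg : ∀ v ∈ T, ∃ g ∈ SU S, ¬ LSq (fabv v) (g : K) ∧ ∀ w ∈ T, w ≠ v → LSq (fabv w) (g : K))
    {b : K} (hb0 : b ≠ 0) (hb : ∀ v ∉ S ∪ T, od v b = 0) (hbl : ∀ v ∈ PS S, LSq (pav v) b) : ∃ r : K, r ^ 2 = b := by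
  classical
  by_contra hns
  push Not at hns
  have hS' : Gd (S ∪ T) := hS.mono Finset.subset_union_left
  have hNS : ∀ v ∈ NS b (S ∪ T), ∃ w ∈ T, v = Sum.inl w := by
    intro v hv
    rw [mem_NS] at hv
    rcases v with v | v
    · simp only [inl_mem_PS, Finset.mem_union] at hv
      rcases hv.1 with h | h
      · exact absurd (hbl _ (inl_mem_PS.2 h)) hv.2
      · exact ⟨v, h, rfl⟩
    · exact absurd (hbl _ inr_mem_PS) hv.2
  choose! g hgS hg1 hg2 using hg
  refine no_surj hns hS' hb ?_
  intro v' hv'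
  obtain ⟨v, hvT, rfl⟩ := hNS v' hv'
  rw [mem_NS] at hv'
  have hvb : ¬ LSq (fabv v) b := hv'.2
  obtain ⟨t, ht0, htu, htv, htn⟩ : ∃ t : K, t ≠ 0 ∧ (∀ w ∉ S ∪ T, od w t = 0) ∧ (∀ w ∈ T, w ≠ v → od w t = 0) ∧ ¬ SplAt (fabv v) b t := by
    have h2 := hS.dy v (hT v hvT)
    by_cases hev : Even (od v b)
    · obtain ⟨c, hc0, hc⟩ := hS.cl.exists_od (fun w => if w = v then 1 else 0) (by
        refine (Set.finite_singleton v).subset ?_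
        intro w hw; by_contra h; simp at h; simp [h] at hw)
      refine ⟨c, hc0, ?_, ?_, ?_⟩
      · intro w hw
        simp only [Finset.mem_union, not_or] at hw
        rw [hc w hw.1, if_neg]; rintro rfl; exact hw.2 hvT
      · intro w hw hne
        rw [hc w (hT w hw), if_neg hne]
      · obtain ⟨d, hd0, hd⟩ := unit_rep hb0 hev
        have h1 := o_ns h2 (mul_ne_zero hb0 (pow_ne_zero 2 hd0)) hd (by rwa [lsq_mul_sq hd0]) hc0
          (by rw [hc v (hT v hvT), if_pos rfl]; decide)
        intro h
        apply h1
        rw [splAt_congr_left (a' := b) (mul_ne_zero hb0 (pow_ne_zero 2 hd0)) hb0 hc0]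
        · exact h
        · have := lsq_sq (fabv v) (mul_ne_zero hb0 hd0)
          convert this using 1; ring
    · refine ⟨g v, (g v).ne_zero, ?_, ?_, ?_⟩
      · intro w hw
        simp only [Finset.mem_union, not_or] at hw
        exact hgS v hvT w hw.1
      · intro w hw hne
        exact hgS v hvT w (hT w hw)
      · intro h
        exact o_ns h2 (g v).ne_zero (hgS v hvT v (hT v hvT)) (hg1 v hvT) hb0 hev (splAt_symm hb0 (g v).ne_zero h)
  set J := T.filter (fun w => w ≠ v ∧ ¬ SplAt (fabv w) b t) with hJ
  have hp0 : ∏ j ∈ J, ((g j : Kˣ) : K) ≠ 0 := Finset.prod_ne_zero_iff.2 fun j _ => (g j).ne_zero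
  refine ⟨t * ∏ j ∈ J, ((g j : Kˣ) : K), mul_ne_zero ht0 hp0, ?_, ?_, ?_⟩
  · intro w hw
    rw [od_mul w ht0 hp0, htu w hw, od_prod w _ _ (fun j _ => (g j).ne_zero), zero_add]
    refine Finset.sum_eq_zero fun j hj => ?_
    simp only [Finset.mem_union, not_or] at hw
    exact hgS j (Finset.mem_filter.1 hj).1 w hw.1
  · change ¬ SplAt (fabv v) _ _
    rw [splAt_mul_iff hp0]
    · exact htn
    · refine splAt_of_lsq _ (lsq_prod _ _ ?_)
      intro j hj
      rw [hJ, Finset.mem_filter] at hj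
      exact hg2 j hj.1 v hvT (Ne.symm hj.2.1)
  · intro w' hw' hne
    obtain ⟨w, hwT, rfl⟩ := hNS w' hw'
    have hwv : w ≠ v := fun h => hne (by rw [h])
    change SplAt (fabv w) _ _
    by_cases hw : SplAt (fabv w) b t
    · refine splAt_mul hw (splAt_of_lsq _ (lsq_prod _ _ ?_))
      intro j hj
      rw [hJ, Finset.mem_filter] at hj
      refine hg2 j hj.1 w hwT ?_
      rintro rfl; exact hj.2.2 hw
    · have hwJ : w ∈ J := by rw [hJ, Finset.mem_filter]; exact ⟨hwT, hwv, hw⟩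
      rw [← Finset.mul_prod_erase J (fun j => ((g j : Kˣ) : K)) hwJ, ← mul_assoc]
      refine splAt_mul (splAt_of_lsq _ ?_) (splAt_of_lsq _ (lsq_prod _ _ ?_))
      · have htl : ¬ LSq (fabv w) t := fun h => hw (splAt_of_lsq _ h)
        exact o_prod (hS.dy w (hT w hwT)) ht0 (htv w hwT hwv) (g w).ne_zero (hgS w hwT w (hT w hwT)) htl (hg1 w hwT)
      · intro j hj
        rw [Finset.mem_erase, hJ, Finset.mem_filter] at hj
        exact hg2 j hj.2.1 w hwT (Ne.symm hj.1)

theorem exists_S' {a : K} (hns : ∀ r : K, r ^ 2 ≠ a) {S : Finset (FP K)} (hS : Gd S) :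
    ∃ S' : Finset (FP K), S ⊆ S' ∧ (∀ v ∈ S', v ∉ S → LSq (fabv v) a) ∧ (SU S' ⊔ LS S).index ≠ 0 ∧ (SU S' ⊔ LS S).index ≤ 2 := by
  classical
  have hpos : 1 ≤ (PS S).card := by
    rw [PS_card]
    have : 0 < Fintype.card (InfinitePlace K) := Fintype.card_pos
    omega
  obtain ⟨T, hTc, hTS, hTa, hTg⟩ := exists_places hns S hS ((PS S).card - 1) (by omega)
  refine ⟨S ∪ T, Finset.subset_union_left, ?_, ?_⟩
  · intro v hv hvS
    rcases Finset.mem_union.1 hv with h | h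
    · exact absurd h hvS
    · exact hTa v h
  set s := (PS S).card with hs
  obtain ⟨hL0, hL4⟩ := LS_index S
  have h1 := Subgroup.relIndex_mul_index (le_sup_right : LS S ≤ SU (S ∪ T) ⊔ LS S)
  rw [Subgroup.relIndex_sup_right] at h1
  have h2 : (LS S).subgroupOf (SU (S ∪ T)) ≤ (powMonoidHom 2 : SU (S ∪ T) →* SU (S ∪ T)).range := by
    intro b hb
    rw [Subgroup.mem_subgroupOf, mem_LS] at hb
    exact SU_sq (lsq_is_sq hS hTS hTg (b : Kˣ).ne_zero b.2 hb)
  have h3 := Subgroup.index_dvd_of_le h2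
  have hcard : (PS (S ∪ T)).card = s + (s - 1) := by
    rw [PS_card, Finset.card_union_of_disjoint, hTc]
    · rw [PS_card] at hs; omega
    · rw [Finset.disjoint_right]; exact hTS
  rw [SU_sq_index, hcard] at h3
  have h4 : (LS S).relIndex (SU (S ∪ T)) ≠ 0 := by
    intro h; rw [h] at h1; simp at h1; exact hL0 h1.symm
  have h5 : 2 ^ (s + (s - 1)) ≤ (LS S).relIndex (SU (S ∪ T)) := Nat.le_of_dvd (Nat.pos_of_ne_zero h4) h3
  have h6 : (SU (S ∪ T) ⊔ LS S).index ≠ 0 := by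
    intro h; rw [h] at h1; simp at h1; exact hL0 h1.symm
  refine ⟨h6, ?_⟩
  have h7 : 2 ^ (s + (s - 1)) * (SU (S ∪ T) ⊔ LS S).index ≤ 2 ^ (s + (s - 1)) * 2 := by
    calc _ ≤ (LS S).relIndex (SU (S ∪ T)) * (SU (S ∪ T) ⊔ LS S).index := Nat.mul_le_mul_right _ h5
      _ = _ := h1
      _ ≤ 4 ^ s := hL4
      _ = _ := by
        rw [← pow_succ, show (4:ℕ) = 2 ^ 2 by norm_num, ← pow_mul]; congr 1; omega
  exact Nat.le_of_mul_le_mul_left h7 (by positivity)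

/-- Hasse norm theorem, S-unit form -/
theorem hasse_unit {a b : K} (hns : ∀ r : K, r ^ 2 ≠ a) {S : Finset (FP K)} (hS : Gd S)
    (ha : ∀ v ∉ S, od v a = 0) (hb0 : b ≠ 0) (hb : ∀ v ∉ S, od v b = 0) (h : ∀ v : Pl K, SplAt (pav v) a b) : Spl b a := by
  classical
  have ha0 : a ≠ 0 := by rintro rfl; exact hns 0 (by simp)
  obtain ⟨S', hSS, hS'a, hi0, hi2⟩ := exists_S' hns hS
  have hS' := hS.mono hSS
  obtain ⟨N, hN, hN0, hN2⟩ := unit_index hns hS'.cl hS'.dy (fun v hv => ha v fun h => hv (hSS h))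
  set R := NS a S' with hR
  have hRS : ∀ v ∈ R, v ∈ PS S := by
    intro v hv
    rw [hR, mem_NS] at hv
    rcases v with v | v
    · by_contra h
      simp only [inl_mem_PS] at h hv
      exact hv.2 (hS'a v hv.1 h)
    · simp
  set Nv : Subgroup Kˣ := ⨅ v : R, Nm (pav v.1) a with hNv
  have hNvm : ∀ x : Kˣ, x ∈ Nv ↔ ∀ v ∈ R, SplAt (pav v) a (x : K) := by
    intro x; simp [hNv, Subgroup.mem_iInf, mem_Nm]
  have hLN : LS S ≤ Nv := by
    intro x hx
    rw [mem_LS] at hx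
    rw [hNvm]
    intro v hv
    exact splAt_of_lsq _ (hx v (hRS v hv))
  have hNv0 : Nv.index ≠ 0 := fun h0 => by
    have := Subgroup.index_dvd_of_le hLN
    rw [h0] at this
    exact (LS_index S).1 (by simpa using this)
  have h1 : 2 ^ R.card ≤ Nv.index := by
    refine index_indep R (fun v => Nm (pav v) a) ?_ Nv ?_ hNv0
    · intro v hv
      obtain ⟨z, hz0, hz1, hz2⟩ := exists_sep_norm ha0 R (mem_NS.1 hv).2
      exact ⟨Units.mk0 z hz0, hz1, hz2⟩
    · intro v hv x hx
      exact (hNvm x).1 hx v hv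
  have h2 := Subgroup.relIndex_mul_index (le_sup_right : Nv ≤ SU S' ⊔ Nv)
  rw [Subgroup.relIndex_sup_right] at h2
  have h3 : (SU S' ⊔ Nv).index ≤ 2 := by
    have := Subgroup.index_dvd_of_le (sup_le_sup_left hLN (SU S'))
    exact (Nat.le_of_dvd (Nat.pos_of_ne_zero hi0) this).trans hi2
  set M : Subgroup (SU S') := Nv.subgroupOf (SU S') with hM
  have hNM : N ≤ M := by
    intro x hx
    rw [hM, Subgroup.mem_subgroupOf, hNvm]
    intro v _
    exact splAt_of_spl _ (hN x hx)
  have h4 : 2 ^ R.card ≤ M.index * 2 := by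
    refine h1.trans ?_
    rw [← h2]
    exact Nat.mul_le_mul_left _ h3
  have h5 : N.index ≤ M.index := by omega
  have h6 := Subgroup.relIndex_mul_index hNM
  have h7 : N.relIndex M = 1 := by
    have hr : N.relIndex M ≠ 0 := by intro h; rw [h] at h6; simp at h6; exact hN0 h6.symm
    by_contra hne
    have : 2 ≤ N.relIndex M := by omega
    have hM0 : 0 < M.index := Nat.pos_of_ne_zero (by intro h; rw [h] at h6; simp at h6; exact hN0 h6.symm)
    nlinarith
  have h8 : M ≤ N := Subgroup.relIndex_eq_one.1 h7
  have hbU : Units.mk0 b hb0 ∈ SU S' := fun v hv => hb v fun h => hv (hSS h)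
  have := hN ⟨Units.mk0 b hb0, hbU⟩ (h8 (by
    rw [hM, Subgroup.mem_subgroupOf, hNvm]
    intro v _; exact h v))
  exact this

/-- Hasse norm theorem -/
theorem hasse {a b : K} (ha0 : a ≠ 0) (hb0 : b ≠ 0) (h : ∀ v : Pl K, SplAt (pav v) a b) : Spl b a := by
  classical
  by_cases hns : ∀ r : K, r ^ 2 ≠ a
  · obtain ⟨S1, h1⟩ := exists_supp a ha0
    obtain ⟨S2, h2⟩ := exists_supp b hb0
    obtain ⟨S, hS12, hS⟩ := exists_gd (S1 ∪ S2)
    refine hasse_unit hns hS (fun v hv => h1 v fun h => hv (hS12 (Finset.mem_union_left _ h))) hb0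
      (fun v hv => h2 v fun h => hv (hS12 (Finset.mem_union_right _ h))) h
  · push Not at hns
    obtain ⟨r, rfl⟩ := hns
    have hr : r ≠ 0 := by rintro rfl; simp at ha0
    refine ⟨(b + 1) / 2, (b - 1) / (2 * r), ?_⟩
    field_simp; ring

/-- the group of elements split with `a` outside `S` has index at most two modulo local squares -/
theorem exists_E' {a : K} (hns : ∀ r : K, r ^ 2 ≠ a) {S : Finset (FP K)} (hS : Gd S)
    (ha : ∀ v ∉ S, od v a = 0) {z1 z2 : K} (h1 : z1 ≠ 0) (h2 : z2 ≠ 0) :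
    ∃ z ∈ ({z1, z2, z1 * z2} : Set K), ∃ b : K, b ≠ 0 ∧ (∀ v ∉ S, SplAt (fabv v) a b) ∧ ∀ v ∈ PS S, LSq (pav v) (b * z) := by
  classical
  have ha0 : a ≠ 0 := by rintro rfl; exact hns 0 (by simp)
  obtain ⟨S', hSS, hS'a, hi0, hi2⟩ := exists_S' hns hS
  have hm : ∀ z : K, ∀ hz : z ≠ 0, Units.mk0 z hz ∈ SU S' ⊔ LS S →
      ∃ b : K, b ≠ 0 ∧ (∀ v ∉ S, SplAt (fabv v) a b) ∧ ∀ v ∈ PS S, LSq (pav v) (b * z) := by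
    intro z hz h
    obtain ⟨b, hb, l, hl, hbl⟩ := Subgroup.mem_sup.1 h
    refine ⟨b, b.ne_zero, ?_, ?_⟩
    · intro v hv
      by_cases hv' : v ∈ S'
      · exact splAt_of_lsq_left b.ne_zero (hS'a v hv' hv)
      · exact o_spl (hS.dy v hv) ha0 (ha v hv) b.ne_zero (hb v hv')
    · intro v hv
      rw [mem_LS] at hl
      have hbl' : z = (b : K) * l := by rw [← Units.val_mul, hbl]; simp
      have := lsq_mul (lsq_sq (pav v) b.ne_zero) (hl v hv)
      rw [hbl']
      convert this using 1; ring
  by_cases c1 : Units.mk0 z1 h1 ∈ SU S' ⊔ LS S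
  · exact ⟨z1, by simp, hm _ _ c1⟩
  by_cases c2 : Units.mk0 z2 h2 ∈ SU S' ⊔ LS S
  · exact ⟨z2, by simp, hm _ _ c2⟩
  refine ⟨z1 * z2, by simp, hm _ (mul_ne_zero h1 h2) ?_⟩
  have hidx : (SU S' ⊔ LS S).index = 2 := by
    have : (SU S' ⊔ LS S).index ≠ 1 := by
      intro h
      rw [Subgroup.index_eq_one] at h
      exact c1 (by rw [h]; trivial)
    omega
  have := (Subgroup.mul_mem_iff_of_index_two hidx (a := Units.mk0 z1 h1) (b := Units.mk0 z2 h2)).2 (by tauto)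
  rwa [← Units.mk0_mul] at this
end Hasse
end NND

end

section

namespace NND
set_option linter.unusedSectionVars false
set_option linter.unusedVariables false
set_option linter.style.haveILetI false
open NumberField IsDedekindDomain WithZero

universe u

section Rep

/-- `m` is represented by the pure norm form of the quaternion algebra `(x, y)` -/
def Rp {F : Type*} [Field F] (x y m : F) : Prop := ∃ p q r : F, m = x * p ^ 2 + y * q ^ 2 - x * y * r ^ 2

variable {K : Type u} [Field K] [NumberField K]

theorem spl_of_rep_lsq {F : Type*} [Field F] [CharZero F] {v : AbsoluteValue F ℝ} {x y m : F} (hx : x ≠ 0) (hy : y ≠ 0)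
    (h : Rp x y m) (hm : LSq v m) : SplAt v x y := by
  obtain ⟨p, q, r, e⟩ := h
  obtain ⟨c, hc⟩ := chain_of_rep hx hy hm.1 e
  rw [chain_splAt v hx hy hc]
  exact splAt_of_lsq_left (chain_ne hx hy hc).2 hm

theorem rep_lemma {x y f : K} (hx : x ≠ 0) (hy : y ≠ 0) (hf : f ≠ 0)
    (h : ∀ v : Pl K, SplAt (pav v) x y ∨ ∃ m, Rp x y m ∧ LSq (pav v) (f * m)) : Rp x y f := by
  by_cases hns : ∀ r : K, r ^ 2 ≠ f
  · obtain ⟨E, _, _, _, ⟨q⟩⟩ := exists_qe f hns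
    have hinj : Function.Injective (algebraMap K E) := (algebraMap K E).injective
    have hx' : algebraMap K E x ≠ 0 := by simpa using hx
    have hy' : algebraMap K E y ≠ 0 := by simpa using hy
    have hsp : Spl (algebraMap K E x) (algebraMap K E y) := by
      refine spl_symm hy' (hasse hx' hy' ?_)
      intro V
      rcases h (pbel K V) with h1 | ⟨m, ⟨p, q', r, hm⟩, h1⟩
      · exact splAt_up V h1
      · have h2 := lsq_up V h1
        have hm0 : f * m ≠ 0 := h1.1
        refine spl_of_rep_lsq hx' hy' (m := algebraMap K E m) ⟨algebraMap K E p, algebraMap K E q', algebraMap K E r, ?_⟩ ?_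
        · rw [hm]; simp
        · have hs0 : q.s ≠ 0 := q.s_ne
          have h3 := lsq_mul h2 (lsq_sq (pav V) (inv_ne_zero hs0))
          convert h3 using 1
          rw [map_mul, ← q.hs]; field_simp
    obtain ⟨U, V, hUV⟩ := hsp
    obtain ⟨u0, u1, rfl⟩ := q.gen U
    obtain ⟨v0, v1, rfl⟩ := q.gen V
    have e : algebraMap K E (u0 ^ 2 + f * u1 ^ 2 - y * (v0 ^ 2 + f * v1 ^ 2)) + algebraMap K E (2 * (u0 * u1 - y * (v0 * v1))) * q.s
        = algebraMap K E x + algebraMap K E 0 * q.s := by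
      rw [hUV]
      simp only [map_sub, map_add, map_mul, map_pow, map_ofNat, map_zero, ← q.hs]
      ring
    have e' := congrArg q.σ e
    simp only [map_add, map_mul, AlgEquiv.commutes, AlgHom.commutes, q.hσ] at e'
    have e1 : u0 ^ 2 + f * u1 ^ 2 - y * (v0 ^ 2 + f * v1 ^ 2) = x := by
      apply q.inj
      have : (2 : E) ≠ 0 := two_ne_zero
      apply mul_left_cancel₀ this
      simp only [map_add, map_mul, map_sub, map_pow, map_ofNat, map_zero] at e e' ⊢
      linear_combination e + e'
    have e2 : 2 * (u0 * u1 - y * (v0 * v1)) = 0 := by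
      rw [e1] at e
      apply q.inj
      apply mul_right_cancel₀ q.s_ne
      linear_combination e
    refine rep_of_quad hx hy e1.symm ?_
    have : (2 : K) ≠ 0 := two_ne_zero
    have := (mul_eq_zero.1 e2).resolve_left this
    linear_combination this
  · push Not at hns
    obtain ⟨r, rfl⟩ := hns
    have hr : r ≠ 0 := by rintro rfl; simp at hf
    refine universal_of_spl hx hy (spl_symm hy (hasse hx hy ?_)) _
    intro v
    rcases h v with h1 | ⟨m, hm, h1⟩
    · exact h1
    · refine spl_of_rep_lsq hx hy hm ?_
      rwa [mul_comm, lsq_mul_sq hr] at h1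

theorem rp_x (x y : K) : Rp x y x := ⟨1, 0, 0, by ring⟩
theorem rp_y (x y : K) : Rp x y y := ⟨0, 1, 0, by ring⟩
theorem rp_xy (x y : K) : Rp x y (-(x * y)) := ⟨0, 0, 1, by ring⟩

/-- a pair ramified exactly at one odd place can be moved to have any given non-square slot -/
theorem move_single {v : FP K} (h2 : od v (2 : K) = 0) {x y f : K} (hx : x ≠ 0) (hy : y ≠ 0) (hf : f ≠ 0)
    (hfv : ¬ Even (od v f)) (hv : ¬ SplAt (fabv v) x y) (hw : ∀ w : Pl K, w ≠ Sum.inl v → SplAt (pav w) x y) :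
    ∃ β : K, β ≠ 0 ∧ ¬ SplAt (fabv v) f β ∧ ∀ w : Pl K, w ≠ Sum.inl v → SplAt (pav w) f β := by
  obtain ⟨κ, hκ0, hκ1, hκ2⟩ := exists_unit_nonres h2
  -- first move to a unit slot
  have key : ∀ x y f : K, x ≠ 0 → y ≠ 0 → f ≠ 0 → ¬ SplAt (fabv v) x y → (∀ w : Pl K, w ≠ Sum.inl v → SplAt (pav w) x y) →
      (∃ m, Rp x y m ∧ LSq (fabv v) (f * m)) →
      ∃ β : K, β ≠ 0 ∧ ¬ SplAt (fabv v) f β ∧ ∀ w : Pl K, w ≠ Sum.inl v → SplAt (pav w) f β := by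
    intro x y f hx hy hf hv hw hm
    obtain ⟨p, q, r, e⟩ := rep_lemma hx hy hf (fun w => by
      by_cases h : w = Sum.inl v
      · subst h; exact Or.inr hm
      · exact Or.inl (hw w h))
    obtain ⟨c, hc⟩ := chain_of_rep hx hy hf e
    refine ⟨c, (chain_ne hx hy hc).2, ?_, ?_⟩
    · rwa [← chain_splAt _ hx hy hc]
    · intro w h
      rw [← chain_splAt _ hx hy hc]; exact hw w h
  obtain ⟨c, hc0, hcv, hcw⟩ := key x y (κ : K) hx hy hκ0 hv hw (by
    rcases o_three h2 hκ0 hκ1 hκ2 hx hy hv with h | h | h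
    · exact ⟨x, rp_x x y, h⟩
    · exact ⟨y, rp_y x y, h⟩
    · exact ⟨_, rp_xy x y, by convert h using 1; ring⟩)
  have hcodd : ¬ Even (od v c) := by
    intro h; exact hcv (o_spl_even h2 hκ0 hc0 (by rw [hκ1]; simp) h)
  refine key (κ : K) c f hκ0 hc0 hf hcv hcw ?_
  obtain ⟨p, q, z, hz, e⟩ := o_spl_even h2 hκ0 (mul_ne_zero hf hc0) (by rw [hκ1]; simp) (by
    rw [od_mul v hf hc0]
    rw [Int.not_even_iff_odd] at hfv hcodd
    exact hfv.add_odd hcodd)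
  refine ⟨c * (p ^ 2 - κ * q ^ 2), ⟨0, p, q, by ring⟩, ?_⟩
  rw [← e]
  have := lsq_mul (lsq_sq (fabv v) (mul_ne_zero hf hc0)) hz
  convert this using 1; ring
end Rep
end NND

end

section

namespace NND
set_option linter.unusedSectionVars false
set_option linter.unusedVariables false
set_option linter.style.haveILetI false
open NumberField IsDedekindDomain WithZero

universe u

section Sign
variable {K : Type u} [Field K] [NumberField K]

/-- a totally positive element has positive norm -/
theorem norm_pos_of_real {x : K} (hx : x ≠ 0)
    (h : ∀ (w : InfinitePlace K) (hw : w.IsReal), 0 < InfinitePlace.embedding_of_isReal hw x) :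
    0 < Algebra.norm ℚ x := by
  classical
  have key : ∃ P : ℝ, 0 < P ∧ ((Algebra.norm ℚ x : ℚ) : ℂ) = (P : ℂ) := by
    have e := Algebra.norm_eq_prod_embeddings ℚ ℂ x
    rw [← Fintype.prod_equiv (RingHom.equivRatAlgHom K ℂ) (fun f => f x)
      (fun φ => φ x) (fun _ => by simp [RingHom.equivRatAlgHom_apply]),
      ← Finset.prod_fiberwise Finset.univ InfinitePlace.mk (fun φ => φ x)] at e
    have hf : ∀ w : InfinitePlace K, ∃ P : ℝ, 0 < P ∧
        ∏ φ ∈ (Finset.univ.filter (fun φ : K →+* ℂ => InfinitePlace.mk φ = w)), φ x = (P : ℂ) := by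
      intro w
      have hmem : ∀ φ : K →+* ℂ, φ ∈ (Finset.univ.filter (fun φ : K →+* ℂ => InfinitePlace.mk φ = w)) ↔
          φ ∈ ({w.embedding, ComplexEmbedding.conjugate w.embedding} : Finset (K →+* ℂ)) := by
        intro φ
        rw [Finset.mem_filter, Finset.mem_insert, Finset.mem_singleton]
        simp only [Finset.mem_univ, true_and]
        conv_lhs => rw [← InfinitePlace.mk_embedding w, InfinitePlace.mk_eq_iff]
        constructor
        · rintro (h | h)
          · exact Or.inl h
          · right; rw [← h, ComplexEmbedding.involutive_conjugate]
        · rintro (h | h)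
          · exact Or.inl h
          · right; rw [h, ComplexEmbedding.involutive_conjugate]
      rw [Finset.ext hmem]
      by_cases hw : w.IsReal
      · refine ⟨_, h w hw, ?_⟩
        have : ComplexEmbedding.conjugate w.embedding = w.embedding :=
          InfinitePlace.isReal_iff.1 hw
        rw [this]
        simp
      · have hne : w.embedding ≠ ComplexEmbedding.conjugate w.embedding := by
          intro hh; exact hw (InfinitePlace.isReal_iff.2 hh.symm)
        refine ⟨Complex.normSq (w.embedding x), Complex.normSq_pos.2 (by simpa using hx), ?_⟩
        rw [Finset.prod_pair hne, ComplexEmbedding.conjugate_coe_eq, Complex.mul_conj]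
    choose P hP0 hP using hf
    refine ⟨∏ w, P w, Finset.prod_pos (fun w _ => hP0 w), ?_⟩
    rw [eq_ratCast] at e
    rw [e, Complex.ofReal_prod]
    exact Finset.prod_congr rfl (fun w _ => hP w)
  obtain ⟨P, hP, e⟩ := key
  have : ((Algebra.norm ℚ x : ℚ) : ℝ) = P := by exact_mod_cast e
  have h3 : (0 : ℝ) < ((Algebra.norm ℚ x : ℚ) : ℝ) := by rw [this]; exact hP
  exact_mod_cast h3

end Sign

section Nres
/-- norms of non-squares in odd finite fields are non-squares -/
theorem norm_nsq {p : ℕ} [Fact p.Prime] (hp : p ≠ 2) {k : Type*} [Field k] [Finite k] [Algebra (ZMod p) k] {x : k}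
    (hx : ¬ IsSquare x) : ¬ IsSquare (Algebra.norm (ZMod p) x) := by
  classical
  haveI := Fintype.ofFinite k
  have hx0 : x ≠ 0 := by rintro rfl; exact hx (IsSquare.zero)
  have hn0 : Algebra.norm (ZMod p) x ≠ 0 := by
    rwa [Ne, Algebra.norm_eq_zero_iff]
  haveI : CharP k p := charP_of_injective_algebraMap (algebraMap (ZMod p) k).injective p
  have hc : ringChar k = p := ringChar.eq k p ▸ rfl
  have h2 : ringChar k ≠ 2 := by rw [hc]; exact hp
  intro hs
  have e1 := (ZMod.euler_criterion p hn0).1 hs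
  have e2 := congrArg (algebraMap (ZMod p) k) e1
  rw [map_pow, FiniteField.algebraMap_norm_eq_pow, ← pow_mul, map_one, Nat.card_zmod] at e2
  apply hx
  rw [FiniteField.isSquare_iff h2 hx0, ← Nat.card_eq_fintype_card]
  obtain ⟨n, hn⟩ : ∃ n, Nat.card k = p ^ n := by
    obtain ⟨n, hpr, hn⟩ := FiniteField.card k p
    exact ⟨n, by rw [Nat.card_eq_fintype_card, hn]⟩
  have hpo : Odd p := (Fact.out : p.Prime).odd_of_ne_two hp
  have hd : p - 1 ∣ Nat.card k - 1 := by
    rw [hn]; simpa using Nat.sub_dvd_pow_sub_pow p 1 n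
  have hqo : Odd (Nat.card k) := by rw [hn]; exact hpo.pow
  obtain ⟨c, hc'⟩ := hd
  have hp2 := (Fact.out : p.Prime).two_le
  have hp1 : 0 < p - 1 := by omega
  have : Nat.card k / 2 = (Nat.card k - 1) / (p - 1) * (p / 2) := by
    rw [hc', Nat.mul_div_cancel_left _ hp1]
    obtain ⟨m, hm⟩ := hpo
    obtain ⟨l, hl⟩ := hqo
    have h3 : p / 2 = m := by omega
    have h4 : Nat.card k / 2 = l := by omega
    rw [h3, h4]
    have h5 : 2 * l = 2 * m * c := by rw [hm, hl] at hc'; simpa using hc'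
    have : 2 * l = 2 * (c * m) := by rw [h5]; ring
    omega
  rw [this]; exact e2

/-- `f = p*`, the prime discriminant attached to `p` -/
def PStar (p : ℕ) (f : ℤ) : Prop := (p % 4 = 1 ∧ f = p) ∨ (p % 4 = 3 ∧ f = -p)

theorem qr_odd {p : ℕ} [Fact p.Prime] (hp : p ≠ 2) {f : ℤ} (hf : PStar p f) {F : Type*} [Field F] [Fintype F]
    (hF : ringChar F ≠ 2) (hFp : ringChar F ≠ p) (h : ¬ IsSquare ((Fintype.card F : ℕ) : ZMod p)) :
    ¬ IsSquare ((f : ℤ) : F) := by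
  classical
  have hzp : ringChar (ZMod p) ≠ 2 := by rwa [ZMod.ringChar_zmod_n]
  have h1 := quadraticChar_odd_prime hF (p := p) hp hFp
  have h2 := quadraticChar_neg_one (F := F) hF
  have h3 := quadraticChar_neg_one (F := ZMod p) hzp
  rw [ZMod.card] at h3
  have h4 : quadraticChar (ZMod p) ((Fintype.card F : ℕ) : ZMod p) = -1 := quadraticChar_neg_one_iff_not_isSquare.2 h
  rw [map_mul, h4] at h1
  rw [← quadraticChar_neg_one_iff_not_isSquare]
  have hodd := FiniteField.odd_card_of_char_ne_two hF
  have hc := ZMod.χ₄_nat_eq_if_mod_four (Fintype.card F)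
  have hcp := ZMod.χ₄_nat_eq_if_mod_four p
  have hcase : ZMod.χ₄ (Fintype.card F : ZMod 4) = 1 ∨ ZMod.χ₄ (Fintype.card F : ZMod 4) = -1 := by
    rw [hc, if_neg (by omega)]
    split_ifs
    · exact Or.inl rfl
    · exact Or.inr rfl
  rcases hf with ⟨hp4, rfl⟩ | ⟨hp4, rfl⟩
  · rw [hcp, if_neg (by omega), if_pos hp4] at h3
    rw [Int.cast_natCast, h1]
    rcases hcase with h | h
    · rw [h]; simp
    · rw [h]; simp [h3]
  · rw [hcp, if_neg (by omega), if_neg (by omega)] at h3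
    have : (((-(p : ℤ) : ℤ)) : F) = (-1) * (p : F) := by push_cast; ring
    rw [this, map_mul, h1, h2]
    rcases hcase with h | h
    · rw [h]; simp
    · rw [h]; simp [h3]

theorem qr_two {p : ℕ} [Fact p.Prime] (hp : p ≠ 2) {f : ℤ} (hf : PStar p f) {F : Type*} [Field F] [Fintype F]
    [CharP F 2] (h : ¬ IsSquare ((Fintype.card F : ℕ) : ZMod p)) :
    ∃ δ : ℤ, Odd δ ∧ f = 1 - 4 * δ ∧ ∀ t : F, t ^ 2 - t + 1 ≠ 0 := by
  obtain ⟨n, hpr, hn⟩ := FiniteField.card F 2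
  have hno : Odd (n : ℕ) := by
    rw [← Nat.not_even_iff_odd]
    intro he
    apply h
    rw [hn]
    push_cast
    exact he.isSquare_pow _
  have h2 : ¬ IsSquare (2 : ZMod p) := by
    intro h2
    apply h
    rw [hn]
    push_cast
    exact h2.pow _
  rw [ZMod.exists_sq_eq_two_iff hp] at h2
  have hpo : p % 2 = 1 := (Fact.out : p.Prime).eq_two_or_odd.resolve_left hp
  have : ∃ δ : ℤ, Odd δ ∧ f = 1 - 4 * δ := by
    rcases hf with ⟨h4, rfl⟩ | ⟨h4, rfl⟩
    · refine ⟨(1 - (p : ℤ)) / 4, ?_, ?_⟩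
      · rw [Int.odd_iff]; omega
      · omega
    · refine ⟨(1 + (p : ℤ)) / 4, ?_, ?_⟩
      · rw [Int.odd_iff]; omega
      · omega
  obtain ⟨δ, hδ, hδf⟩ := this
  refine ⟨δ, hδ, hδf, ?_⟩
  intro t ht
  have h20 : (2 : F) = 0 := by exact_mod_cast CharP.cast_eq_zero F 2
  have ht3 : t ^ 3 = 1 := by linear_combination (t + 1) * ht - h20
  have hq := FiniteField.pow_card t
  have hm : (2 : ℕ) ^ (n : ℕ) % 3 = 2 := by
    obtain ⟨k, hk⟩ := hno
    rw [hk, pow_succ, pow_mul, Nat.mul_mod, Nat.pow_mod]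
    norm_num
  rw [hn] at hq
  have hq2 : t ^ (2 ^ (n : ℕ)) = t ^ 2 := by
    conv_lhs => rw [← Nat.div_add_mod (2 ^ (n : ℕ)) 3, hm, pow_add, pow_mul, ht3, one_pow, one_mul]
  rw [hq2] at hq
  rw [hq] at ht
  simp at ht
end Nres
end NND

end

section

namespace NND
set_option linter.unusedSectionVars false
set_option linter.unusedVariables false
set_option linter.style.haveILetI false
open NumberField IsDedekindDomain WithZero TensorProduct

universe u

section NormMod

/-- The norm mod `p` of an element acting as the identity on an ideal `I` modulo `p`. -/
theorem norm_mod_aux {p : ℕ} [Fact p.Prime] {O k : Type*} [CommRing O] [Module.Free ℤ O] [Module.Finite ℤ O]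
    [Field k] [Algebra (ZMod p) k] (g : O →+* k) (hg : Function.Surjective g) (r : O)
    (h : ∀ x : O, g x = 0 → ∃ y : O, r * x - x = p * y) :
    ((Algebra.norm ℤ r : ℤ) : ZMod p) = Algebra.norm (ZMod p) (g r) := by
  let A := ZMod p ⊗[ℤ] O
  let G : A →ₐ[ZMod p] k := Algebra.TensorProduct.lift (Algebra.ofId (ZMod p) k) (g.toIntAlgHom) (fun _ _ => Commute.all _ _)
  have hG : ∀ x : O, G (1 ⊗ₜ x) = g x := by
    intro x
    change Algebra.ofId (ZMod p) k 1 * g x = g x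
    rw [map_one, one_mul]
  have hsur : ∀ a : A, ∃ x : O, a = 1 ⊗ₜ x := by
    intro a
    induction a using TensorProduct.induction_on with
    | zero => exact ⟨0, by simp⟩
    | tmul z x =>
      obtain ⟨n, rfl⟩ := ZMod.intCast_surjective z
      refine ⟨n • x, ?_⟩
      rw [← TensorProduct.smul_tmul]
      congr 1
      simp
    | add a b ha hb =>
      obtain ⟨x, rfl⟩ := ha
      obtain ⟨y, rfl⟩ := hb
      exact ⟨x + y, by rw [TensorProduct.tmul_add]⟩
  have hGs : Function.Surjective G := fun c => by
    obtain ⟨x, rfl⟩ := hg c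
    exact ⟨_, hG x⟩
  let e : A →ₗ[ZMod p] A := (LinearMap.mul (ZMod p) A) (1 ⊗ₜ r)
  let W : Submodule (ZMod p) A := LinearMap.ker G.toLinearMap
  have he : W ≤ W.comap e := by
    intro a ha
    simp only [W, Submodule.mem_comap, LinearMap.mem_ker, e] at ha ⊢
    have : G a = 0 := ha
    change G ((1 ⊗ₜ r) * a) = 0
    rw [map_mul, this, mul_zero]
  have hid : ∀ a ∈ W, e a = a := by
    intro a ha
    obtain ⟨x, rfl⟩ := hsur a
    have hx : g x = 0 := by rw [← hG]; exact ha
    obtain ⟨y, hy⟩ := h x hx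
    change (1 ⊗ₜ r : A) * (1 ⊗ₜ x) = 1 ⊗ₜ x
    rw [Algebra.TensorProduct.tmul_mul_tmul, one_mul]
    have : r * x = x + (p : ℤ) • y := by
      rw [zsmul_eq_mul]; push_cast; linear_combination hy
    rw [this, TensorProduct.tmul_add, ← TensorProduct.smul_tmul]
    simp
  have d1 := LinearMap.det_eq_det_mul_det W e he
  have d2 : e.restrict he = LinearMap.id := by
    ext a
    exact hid a.1 a.2
  have d3 : e.det = ((Algebra.norm ℤ r : ℤ) : ZMod p) := by
    have : e = (LinearMap.mul ℤ O r).baseChange (ZMod p) := by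
      ext x
      change (1 ⊗ₜ r : A) * (1 ⊗ₜ x) = (1 : ZMod p) ⊗ₜ (r * x)
      rw [Algebra.TensorProduct.tmul_mul_tmul, one_mul]
    rw [this, LinearMap.det_baseChange]
    rfl
  have d4 : (W.mapQ W e he).det = Algebra.norm (ZMod p) (g r) := by
    let E : (A ⧸ W) ≃ₗ[ZMod p] k := G.toLinearMap.quotKerEquivOfSurjective hGs
    rw [Algebra.norm_apply, ← LinearMap.det_conj _ E]
    congr 1
    ext c
    obtain ⟨a, rfl⟩ := hGs c
    have : E.symm (G a) = W.mkQ a := by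
      rw [LinearEquiv.symm_apply_eq]; rfl
    simp only [LinearMap.comp_apply, LinearEquiv.coe_coe]
    rw [this, Submodule.mkQ_apply, Submodule.mapQ_apply]
    change G ((1 ⊗ₜ r) * a) = g r * G a
    rw [map_mul, hG]
  rw [d2, LinearMap.det_id, one_mul, d3, d4] at d1
  exact d1

end NormMod

section AbsN
variable {K : Type u} [Field K] [NumberField K]

theorem absNorm_isSquare {p : ℕ} {r : 𝓞 K} (hr : r ≠ 0)
    (h : ∀ w : FP K, Even (od w (r : K)) ∨ IsSquare ((Ideal.absNorm w.asIdeal : ℕ) : ZMod p)) :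
    IsSquare ((Ideal.absNorm (Ideal.span {r}) : ℕ) : ZMod p) := by
  classical
  have hI : Ideal.span {r} ≠ 0 := by simpa using hr
  let F := UniqueFactorizationMonoid.normalizedFactors (Ideal.span {r})
  have e : F.prod = Ideal.span {r} := associated_iff_eq.1 (UniqueFactorizationMonoid.prod_normalizedFactors hI)
  rw [← e, Finset.prod_multiset_count, map_prod, Nat.cast_prod]
  apply Finset.isSquare_prod
  intro P hP
  rw [Multiset.mem_toFinset] at hP
  have hPp : Prime P := UniqueFactorizationMonoid.prime_of_normalized_factor P hP
  let w : FP K := ⟨P, Ideal.isPrime_of_prime hPp, hPp.ne_zero⟩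
  rw [map_pow, Nat.cast_pow]
  rcases h w with h | h
  · have : od w (r : K) = (F.count P : ℕ) := by
      have hle : ∀ n : ℕ, r ∈ P ^ n ↔ n ≤ F.count P := by
        intro n
        rw [← Ideal.dvd_span_singleton, UniqueFactorizationMonoid.dvd_iff_normalizedFactors_le_normalizedFactors
          (pow_ne_zero _ hPp.ne_zero) hI, UniqueFactorizationMonoid.normalizedFactors_pow,
          UniqueFactorizationMonoid.normalizedFactors_irreducible hPp.irreducible, normalize_eq, Multiset.nsmul_singleton,
          Multiset.le_count_iff_replicate_le]
      exact od_int_eq hr ((hle _).2 le_rfl) (by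
        intro hh
        have := (hle _).1 hh
        omega)
    rw [this] at h
    exact Even.isSquare_pow (by exact_mod_cast h) _
  · exact h.pow _
end AbsN
end NND

end

section

namespace NND
set_option linter.unusedSectionVars false
set_option linter.unusedVariables false
set_option linter.style.haveILetI false
open NumberField IsDedekindDomain WithZero

universe u

section RThm
variable {K : Type u} [Field K] [NumberField K]

theorem fin_approx (P : Finset (FP K)) (z : FP K → K) (n : FP K → ℤ) :
    ∃ x : K, ∀ w ∈ P, Ge w (n w) (x - z w) := by
  classical
  obtain ⟨x, hx⟩ := weak_approx' (P.image (Sum.inl : FP K → Pl K)) (fun v => Sum.elim z (fun _ => 0) v)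
    (fun v => Sum.elim (fun w : FP K => (Ideal.absNorm w.asIdeal : ℝ) ^ (- n w)) (fun _ => (1 : ℝ)) v) (by
      rintro (w | w)
      · exact eps_pos w _
      · exact one_pos)
  refine ⟨x, fun w hw => ?_⟩
  exact ge_of_fabv (hx (Sum.inl w) (Finset.mem_image_of_mem _ hw))

theorem ge_sq_approx (w : FP K) (c U0 : K) (m : ℤ) :
    ∃ n : ℤ, ∀ n' ≥ n, ∀ U, Ge w n' (U - U0) → Ge w m (c * U ^ 2 - c * U0 ^ 2) := by
  let D := min 0 (min (od w c) (od w (2 * U0)))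
  refine ⟨max 0 (m - 2 * D), fun n' hn' U hU => ?_⟩
  have hD0 : D ≤ 0 := min_le_left _ _
  have h1 : Ge w D c := ge_mono ((min_le_right _ _).trans (min_le_left _ _)) (ge_od w c)
  have h2 : Ge w D (2 * U0) := ge_mono ((min_le_right _ _).trans (min_le_right _ _)) (ge_od w _)
  have hm1 : (0:ℤ) ≤ max 0 (m - 2 * D) := le_max_left _ _
  have hm2 : m - 2 * D ≤ max 0 (m - 2 * D) := le_max_right _ _
  have h3 : Ge w D (U - U0) := ge_mono (by omega) hU
  have := ge_mul' (ge_mul h1 hU) (ge_add h3 h2) (k := m) (by omega)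
  convert this using 1; ring

theorem exists_int_of_ge {x : K} (h : ∀ w : FP K, Ge w 0 x) : ∃ r : 𝓞 K, (r : K) = x := by
  obtain ⟨r, hr⟩ := HeightOneSpectrum.mem_integers_of_valuation_le_one K x (fun w => by
    have := h w
    simpa [Ge] using this)
  exact ⟨r, hr⟩

theorem exists_den {p : ℕ} (hp : p.Prime) {γ : K} (h : ∀ w : FP K, Ge w 1 (p : K) → Ge w 0 γ) :
    ∃ d : ℤ, (p : ℤ) ∣ d - 1 ∧ d ≠ 0 ∧ ∃ r : 𝓞 K, (r : K) = (d : K) ^ 2 * γ := by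
  have hpK : (p : K) ≠ 0 := by exact_mod_cast hp.ne_zero
  obtain ⟨m, hm0, hm⟩ : ∃ m : ℕ, m ≠ 0 ∧ ∀ w : FP K, Ge w 0 ((m : K) * γ) := by
    obtain ⟨y, hy, hi⟩ := exists_integral_multiples ℤ ℚ ({γ} : Finset K)
    have h1 := hi γ (Finset.mem_singleton_self _)
    refine ⟨y.natAbs, by simpa using hy, fun w => ?_⟩
    have h2 := ge_int w (⟨y • γ, h1⟩ : 𝓞 K)
    have h3 : Ge w 0 ((y : K) * γ) := by
      rw [← zsmul_eq_mul]; exact h2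
    rcases Int.natAbs_eq y with e | e
    · rw [e] at h3; simpa using h3
    · rw [e] at h3
      have := ge_neg h3
      convert this using 1; rw [Int.cast_neg, Int.cast_natCast]; ring
  obtain ⟨e, m', hm', rfl⟩ := Nat.exists_eq_pow_mul_and_not_dvd hm0 p hp.ne_one
  have hm'' : ∀ w : FP K, Ge w 0 ((m' : K) * γ) := by
    intro w
    by_cases hw : Ge w 1 (p : K)
    · exact ge_mul' (ge_nat w m') (h w hw) (by norm_num)
    · have h0 : od w (p : K) = 0 := by
        have := od_nat_nonneg w p
        rw [ge_iff w hpK] at hw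
        omega
      have h1 : Ge w 0 (((p : K) ^ e)⁻¹) := by
        rw [ge_iff w (inv_ne_zero (pow_ne_zero _ hpK)), od_inv, od_pow, h0]; simp
      have := ge_mul' h1 (hm w) (k := 0) (by norm_num)
      convert this using 1
      push_cast; field_simp
  have hcop : IsCoprime (m' : ℤ) (p : ℤ) := by
    rw [Nat.isCoprime_iff_coprime]
    exact ((Nat.Prime.coprime_iff_not_dvd hp).2 hm').symm
  obtain ⟨s, t, hst⟩ := hcop
  refine ⟨s * m', ⟨-t, by linear_combination hst⟩, ?_, ?_⟩
  · intro h0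
    rw [h0, zero_add] at hst
    have : (p : ℤ) ∣ 1 := ⟨t, by rw [← hst]; ring⟩
    have := Int.natCast_dvd_natCast.1 (by simpa using this : ((p : ℕ) : ℤ) ∣ ((1 : ℕ) : ℤ))
    exact hp.one_lt.ne' (Nat.dvd_one.1 this)
  · refine exists_int_of_ge fun w => ?_
    have hs : Ge w 0 ((s : ℤ) : K) := by
      have := ge_int w ((s : ℤ) : 𝓞 K)
      simpa using this
    have := ge_mul' (ge_mul' (ge_mul' hs hs (k := 0) (by norm_num)) (ge_nat w m') (k := 0) (by norm_num)) (hm'' w) (k := 0) (by norm_num)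
    convert this using 1
    push_cast; ring

theorem good_approx {p : ℕ} (hp : p.Prime) {v : FP K} {f β : K} (hβ : β ≠ 0)
    (hf : f ≠ 0) (hv : od v f = 1) (hs : ∀ w : FP K, Ge w 1 (p : K) → w ≠ v → SplAt (fabv w) f β) :
    ∃ N : K, N ≠ 0 ∧ Spl N f ∧ od v (β * N) = 0 ∧ ∀ w : FP K, Ge w 1 (p : K) → w ≠ v → Ge w 1 (β * N - 1) := by
  classical
  have hpK : (p : K) ≠ 0 := by exact_mod_cast hp.ne_zero
  have hloc : ∀ w : FP K, ∃ U W : K, (w = v ∨ Ge w 1 (p : K)) → ((w = v → β * (U ^ 2 - f * W ^ 2) ≠ 0 ∧ od w (β * (U ^ 2 - f * W ^ 2)) = 0) ∧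
      (w ≠ v → Ge w 1 (β * (U ^ 2 - f * W ^ 2) - 1))) := by
    intro w
    by_cases hwv : w = v
    · subst hwv
      obtain ⟨π, hπ0, hπ1⟩ := exists_unif w
      rcases Int.even_or_odd (od w β) with ⟨k, hk⟩ | ⟨k, hk⟩
      · refine ⟨(π : K) ^ (-k), 0, fun _ => ⟨fun _ => ?_, fun h => absurd rfl h⟩⟩
        have h1 : (π : K) ^ (-k) ≠ 0 := zpow_ne_zero _ hπ0
        have e : β * (((π : K) ^ (-k)) ^ 2 - f * 0 ^ 2) = β * ((π : K) ^ (-k)) ^ 2 := by ring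
        rw [e]
        refine ⟨mul_ne_zero hβ (pow_ne_zero _ h1), ?_⟩
        rw [od_mul w hβ (pow_ne_zero _ h1), od_pow, od_zpow, hπ1]
        push_cast; omega
      · refine ⟨0, (π : K) ^ (-k-1), fun _ => ⟨fun _ => ?_, fun h => absurd rfl h⟩⟩
        have h1 : (π : K) ^ (-k-1) ≠ 0 := zpow_ne_zero _ hπ0
        have e : β * (0 ^ 2 - f * ((π : K) ^ (-k-1)) ^ 2) = -(β * (f * ((π : K) ^ (-k-1)) ^ 2)) := by ring
        have h2 := mul_ne_zero hf (pow_ne_zero 2 h1)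
        rw [e]
        refine ⟨neg_ne_zero.2 (mul_ne_zero hβ h2), ?_⟩
        rw [od_neg, od_mul w hβ h2, od_mul w hf (pow_ne_zero _ h1), od_pow, od_zpow, hπ1, hv]
        push_cast; omega
    · by_cases hwp : Ge w 1 (p : K)
      · obtain ⟨P, Q, z, hz, e⟩ := hs w hwp hwv
        obtain ⟨y, hy⟩ := exists_of_lsq_fin hz 1
        refine ⟨y * P / β, y * Q / β, fun _ => ⟨fun h => absurd h hwv, fun _ => ?_⟩⟩
        convert hy using 1
        have : β * ((y * P / β) ^ 2 - f * (y * Q / β) ^ 2) = y ^ 2 * (P ^ 2 - f * Q ^ 2) / β := by field_simp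
        rw [this, ← e]; field_simp
      · exact ⟨0, 0, fun h => by tauto⟩
  choose U0 W0 h0 using hloc
  have hn : ∀ w : FP K, ∃ n : ℤ, ∀ U W, Ge w n (U - U0 w) → Ge w n (W - W0 w) →
      Ge w 1 (β * (U ^ 2 - f * W ^ 2) - β * (U0 w ^ 2 - f * W0 w ^ 2)) := by
    intro w
    obtain ⟨n1, hn1⟩ := ge_sq_approx w β (U0 w) 1
    obtain ⟨n2, hn2⟩ := ge_sq_approx w (β * f) (W0 w) 1
    refine ⟨max n1 n2, fun U W hU hW => ?_⟩
    have := ge_sub (hn1 _ (le_max_left _ _) U hU) (hn2 _ (le_max_right _ _) W hW)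
    convert this using 1; ring
  choose n hn using hn
  have hfin : {w : FP K | w = v ∨ Ge w 1 (p : K)}.Finite := by
    refine ((Set.finite_singleton v).union (finite_od hpK)).subset ?_
    rintro w (h | h)
    · exact Or.inl h
    · right
      rw [ge_iff w hpK] at h
      change od w (p : K) ≠ 0
      omega
  obtain ⟨U, hU⟩ := fin_approx hfin.toFinset U0 n
  obtain ⟨W, hW⟩ := fin_approx hfin.toFinset W0 n
  have hmain : ∀ w : FP K, (w = v ∨ Ge w 1 (p : K)) → Ge w 1 (β * (U ^ 2 - f * W ^ 2) - β * (U0 w ^ 2 - f * W0 w ^ 2)) := by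
    intro w hw
    exact hn w U W (hU w (by simpa using hw)) (hW w (by simpa using hw))
  have hvv : β * (U ^ 2 - f * W ^ 2) ≠ 0 ∧ od v (β * (U ^ 2 - f * W ^ 2)) = 0 := by
    obtain ⟨h1, h2⟩ := (h0 v (Or.inl rfl)).1 rfl
    have := hmain v (Or.inl rfl)
    have h3 := od_add_eq h1 (by rw [h2]; simpa using this)
    rw [add_sub_cancel, h2] at h3
    exact h3
  refine ⟨U ^ 2 - f * W ^ 2, right_ne_zero_of_mul hvv.1, ⟨U, W, rfl⟩, hvv.2, ?_⟩
  intro w hw hwv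
  have h1 := hmain w (Or.inr hw)
  have h2 := (h0 w (Or.inr hw)).2 hwv
  have := ge_add h1 h2
  convert this using 1; ring

/-- a finite place is good if it lies over an odd unramified rational prime -/
def Good (v : FP K) : Prop :=
  ∃ p : ℕ, p.Prime ∧ p ≠ 2 ∧ Ge v 1 (p : K) ∧ ∀ w : FP K, Ge w 1 (p : K) → od w (p : K) = 1

theorem od_nat_of_ne {w : FP K} {p q : ℕ} (hp : p.Prime) (hq : q.Prime) (hpq : p ≠ q) (h : Ge w 1 (p : K)) :
    od w (q : K) = 0 := by
  have hqK : (q : K) ≠ 0 := by exact_mod_cast hq.ne_zero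
  by_contra hne
  have h1 : Ge w 1 (q : K) := by
    rw [ge_iff w hqK]
    have := od_nat_nonneg w q
    omega
  have hcop : IsCoprime (p : ℤ) (q : ℤ) := by
    rw [Nat.isCoprime_iff_coprime]
    exact (Nat.coprime_primes hp hq).2 hpq
  obtain ⟨s, t, hst⟩ := hcop
  have hintg : ∀ s : ℤ, Ge w 0 ((s : ℤ) : K) := by
    intro s
    have := ge_int w ((s : ℤ) : 𝓞 K)
    simpa using this
  have h2 := ge_add (ge_mul' (hintg s) h (k := 1) (by norm_num)) (ge_mul' (hintg t) h1 (k := 1) (by norm_num))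
  have h3 : (s : K) * (p : K) + t * (q : K) = 1 := by exact_mod_cast congrArg (Int.cast : ℤ → K) hst
  rw [h3, ge_iff w one_ne_zero, od_one] at h2
  omega

theorem Good.od_two {v : FP K} (h : Good v) : od v (2 : K) = 0 := by
  obtain ⟨p, hp, hp2, hv, -⟩ := h
  exact_mod_cast od_nat_of_ne hp Nat.prime_two hp2 hv

theorem even_of_nres {p : ℕ} [Fact p.Prime] (hp : p ≠ 2) {f : ℤ} (hf : PStar p f) {w : FP K} (hw : ¬ Ge w 1 (p : K))
    {r : K} (hr : r ≠ 0) (hs : SplAt (fabv w) ((f : ℤ) : K) r)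
    (hn : ¬ IsSquare ((Ideal.absNorm w.asIdeal : ℕ) : ZMod p)) : Even (od w r) := by
  classical
  haveI : Fintype (kf w) := Fintype.ofFinite _
  have hcard : Ideal.absNorm w.asIdeal = Fintype.card (kf w) := by
    rw [← Nat.card_eq_fintype_card]; rfl
  rw [hcard] at hn
  have hpp : p.Prime := Fact.out
  have hpK : (p : K) ≠ 0 := by exact_mod_cast hpp.ne_zero
  have hp0 : od w (p : K) = 0 := by
    have := od_nat_nonneg w p
    rw [ge_iff w hpK] at hw
    omega
  have hfK : ((f : ℤ) : K) ≠ 0 ∧ od w ((f : ℤ) : K) = 0 := by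
    rcases hf with ⟨_, rfl⟩ | ⟨_, rfl⟩
    · exact ⟨by simpa using hpK, by simpa using hp0⟩
    · exact ⟨by simpa using hpK, by simpa using hp0⟩
  apply unr_even _ hr hs
  by_cases h2 : od w (2 : K) = 0
  · apply o_unr h2 hfK.1 hfK.2
    rw [o_sq h2 hfK.1 hfK.2 (r := ((f : ℤ) : 𝓞 K)) (by simpa using ge_zero w 1)]
    rw [map_intCast]
    refine qr_odd hp hf (kf_two h2) ?_ hn
    intro hc
    have : ((p : ℕ) : kf w) = 0 := by rw [← hc]; exact ringChar.Nat.cast_ringChar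
    have h3 : (Ideal.Quotient.mk w.asIdeal ((p : ℕ) : 𝓞 K)) = Ideal.Quotient.mk w.asIdeal 0 := by
      rw [map_natCast, map_zero]; exact this
    rw [red_eq_iff] at h3
    apply hw
    simpa using h3
  · have h2' : Ge w 1 (2 : K) := by
      rw [ge_iff w two_ne_zero]
      have := od_nat_nonneg w 2
      push_cast at this
      omega
    haveI : CharP (kf w) 2 := by
      apply CharTwo.of_one_ne_zero_of_two_eq_zero one_ne_zero
      have h3 : (Ideal.Quotient.mk w.asIdeal (2 : 𝓞 K)) = Ideal.Quotient.mk w.asIdeal 0 := by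
        rw [red_eq_iff]
        have : ((2 : 𝓞 K) : K) = 2 := map_ofNat (algebraMap (𝓞 K) K) 2
        rw [this]; simpa using h2'
      rw [map_zero] at h3
      exact h3
    obtain ⟨δ, hδ, hδf, ht⟩ := qr_two hp hf hn
    refine ⟨(δ : K), ?_, ?_, ?_⟩
    · have := ge_int w ((δ : ℤ) : 𝓞 K)
      simpa using this
    · rw [hδf]; push_cast; ring
    · intro t ht0 hh
      obtain ⟨s, hs⟩ := exists_int_approx w ht0 1
      apply ht (Ideal.Quotient.mk w.asIdeal s)
      have hsI : Ge w 1 (((s ^ 2 - s + 1 : 𝓞 K) : K) - ((0 : 𝓞 K) : K)) := by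
        obtain ⟨m, hm⟩ := hδ
        have hs0 := ge_int w s
        have h1 : Ge w 1 ((t - s) * (t + s - 1)) :=
          ge_mul' hs (ge_sub (ge_add ht0 hs0) (ge_one w)) (by norm_num)
        have hm0 : Ge w 0 ((m : ℤ) : K) := by
          have := ge_int w ((m : ℤ) : 𝓞 K)
          simpa using this
        have h3 := ge_mul' h2' hm0 (k := 1) (by norm_num)
        have := ge_sub (ge_sub hh h1) h3
        convert this using 1
        rw [hm]; push_cast; ring
      rw [← red_eq_iff] at hsI
      simpa using hsI

/-- reciprocity: no quaternion algebra is ramified at exactly one good place -/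
theorem recip {v : FP K} (hv : Good v) {x y : K} (hx : x ≠ 0) (hy : y ≠ 0) (hn : ¬ SplAt (fabv v) x y)
    (hs : ∀ w : Pl K, w ≠ Sum.inl v → SplAt (pav w) x y) : False := by
  classical
  have h2 := hv.od_two
  obtain ⟨p, hp, hp2, hpv, hpw⟩ := hv
  haveI : Fact p.Prime := ⟨hp⟩
  have hpK : (p : K) ≠ 0 := by exact_mod_cast hp.ne_zero
  obtain ⟨f, hf⟩ : ∃ f : ℤ, PStar p f := by
    have : p % 2 = 1 := hp.eq_two_or_odd.resolve_left hp2
    rcases (by omega : p % 4 = 1 ∨ p % 4 = 3) with h | h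
    · exact ⟨p, Or.inl ⟨h, rfl⟩⟩
    · exact ⟨-p, Or.inr ⟨h, rfl⟩⟩
  have hfK : ((f : ℤ) : K) ≠ 0 ∧ od v ((f : ℤ) : K) = 1 := by
    have := hpw v hpv
    rcases hf with ⟨_, rfl⟩ | ⟨_, rfl⟩
    · exact ⟨by simpa using hpK, by simpa using this⟩
    · exact ⟨by simpa using hpK, by simpa using this⟩
  obtain ⟨β, hβ0, hβv, hβw⟩ := move_single h2 hx hy hfK.1 (by rw [hfK.2]; decide) hn hs
  obtain ⟨N, hN0, hNs, hNv, hNw⟩ := good_approx hp hβ0 hfK.1 hfK.2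
    (fun w _ hwv => hβw (Sum.inl w) (by simpa using hwv))
  obtain ⟨d, hd1, hd0, r, hr⟩ := exists_den hp (γ := β * N) (by
    intro w hw
    by_cases hwv : w = v
    · rw [hwv, ge_iff v (mul_ne_zero hβ0 hN0), hNv]
    · have := ge_add (ge_mono (by norm_num) (hNw w hw hwv)) (ge_one w)
      simpa using this)
  have hdK : (d : K) ≠ 0 := by exact_mod_cast hd0
  have hr0 : (r : K) ≠ 0 := by rw [hr]; exact mul_ne_zero (pow_ne_zero _ hdK) (mul_ne_zero hβ0 hN0)
  have hr0' : r ≠ 0 := by rintro rfl; simp at hr0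
  have hdp : ∀ w : FP K, Ge w 1 (p : K) → Ge w 1 ((d : K) - 1) := by
    intro w hw
    obtain ⟨e, he⟩ := hd1
    have : (d : K) - 1 = (p : K) * (e : K) := by exact_mod_cast congrArg (Int.cast : ℤ → K) he
    rw [this]
    have h3 := ge_int w ((e : ℤ) : 𝓞 K)
    exact ge_mul' hw (by simpa using h3) (by norm_num)
  -- splitting of `(f, r)`
  have hsplit : ∀ w : Pl K, SplAt (pav w) (f : K) (r : K) ↔ SplAt (pav w) (f : K) β := by
    intro w
    have e : (r : K) = β * (N * (d : K) ^ 2) := by rw [hr]; ring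
    rw [e]
    refine splAt_mul_iff (mul_ne_zero hN0 (pow_ne_zero _ hdK)) ?_
    exact splAt_mul (splAt_of_spl _ hNs) (splAt_of_lsq _ (lsq_sq _ hdK))
  have hrv : od v (r : K) = 0 := by
    rw [hr, od_mul v (pow_ne_zero _ hdK) (mul_ne_zero hβ0 hN0), hNv, od_pow, (unit_of_near (hdp v hpv)).2]; simp
  -- `r` is a non-residue at `v`
  have hrn : ¬ IsSquare (Ideal.Quotient.mk v.asIdeal r) := by
    rw [← o_sq h2 hr0 hrv (r := r) (by simpa using ge_zero v 1)]
    intro h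
    exact hβv ((hsplit (Sum.inl v)).1 (splAt_of_lsq _ h))
  have hr1 : ∀ w : FP K, Ge w 1 (p : K) → w ≠ v → Ge w 1 ((r : K) - 1) := by
    intro w hw hwv
    have h1 := hNw w hw hwv
    have h3 := hdp w hw
    have hd0 : Ge w 0 (d : K) := by
      have h3 := ge_int w ((d : ℤ) : 𝓞 K)
      simpa using h3
    have := ge_add (ge_mul' (ge_mul' hd0 hd0 (k := 0) (by norm_num)) h1 (k := 1) (by norm_num))
      (ge_mul' (ge_add hd0 (ge_one w)) h3 (k := 1) (by norm_num))
    convert this using 1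
    rw [hr]; ring
  -- the norm of `r` mod `p`
  haveI : CharP (kf v) p := by
    rw [CharP.charP_iff_prime_eq_zero hp]
    have h3 : (Ideal.Quotient.mk v.asIdeal ((p : ℕ) : 𝓞 K)) = Ideal.Quotient.mk v.asIdeal 0 := by
      rw [red_eq_iff]; simpa using hpv
    rwa [map_natCast, map_zero] at h3
  letI : Algebra (ZMod p) (kf v) := ZMod.algebra _ p
  have hnorm : ((Algebra.norm ℤ r : ℤ) : ZMod p) = Algebra.norm (ZMod p) ((Ideal.Quotient.mk v.asIdeal r : kf v)) := by
    refine norm_mod_aux (Ideal.Quotient.mk v.asIdeal) Ideal.Quotient.mk_surjective r ?_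
    intro z hz
    have hzv : Ge v 1 (z : K) := by
      rw [ge_one_iff_mem]; exact Ideal.Quotient.eq_zero_iff_mem.1 hz
    obtain ⟨y, hy⟩ := exists_int_of_ge (x := ((r : K) * z - z) / p) (by
      intro w
      by_cases hw : Ge w 1 (p : K)
      · have hp1 := hpw w hw
        have : Ge w 1 ((r : K) * z - z) := by
          by_cases hwv : w = v
          · subst hwv
            exact ge_sub (ge_mul' (ge_int w r) hzv (by norm_num)) hzv
          · have := ge_mul' (hr1 w hw hwv) (ge_int w z) (k := 1) (by norm_num)
            convert this using 1; ring
        rw [div_eq_mul_inv]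
        refine ge_mul' (n := -1) this ?_ (by norm_num)
        rw [ge_iff w (inv_ne_zero hpK), od_inv, hp1]
      · have h0 : od w (p : K) = 0 := by
          have := od_nat_nonneg w p
          rw [ge_iff w hpK] at hw
          omega
        rw [div_eq_mul_inv]
        refine ge_mul' (m := 0) (n := 0) ?_ ?_ (by norm_num)
        · have := ge_int w (r * z - z)
          simpa using this
        · rw [ge_iff w (inv_ne_zero hpK), od_inv, h0]; simp)
    refine ⟨y, ?_⟩
    apply RingOfIntegers.coe_injective
    push_cast
    have e3 : (p : K) * (y : K) = (r : K) * z - z := by rw [hy]; field_simp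
    exact e3.symm
  have hns : ¬ IsSquare ((Algebra.norm ℤ r : ℤ) : ZMod p) := by
    rw [hnorm]; exact norm_nsq hp2 hrn
  -- the absolute norm is a square mod `p`
  have hab : IsSquare ((Ideal.absNorm (Ideal.span {r}) : ℕ) : ZMod p) := by
    apply absNorm_isSquare hr0'
    intro w
    by_cases hw : Ge w 1 (p : K)
    · left
      by_cases hwv : w = v
      · rw [hwv, hrv]; exact Even.zero
      · rw [(unit_of_near (hr1 w hw hwv)).2]; exact Even.zero
    · by_contra hcon
      push Not at hcon
      apply hcon.1
      refine even_of_nres hp2 hf hw hr0 ?_ hcon.2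
      exact (hsplit (Sum.inl w)).2 (hβw (Sum.inl w) (by
        intro h
        exact hw (by rw [Sum.inl.inj h]; exact hpv)))
  rw [Ideal.absNorm_span_singleton] at hab
  apply hns
  rcases hf with ⟨h4, rfl⟩ | ⟨h4, rfl⟩
  · have hm1 : IsSquare (-1 : ZMod p) := by rw [ZMod.exists_sq_eq_neg_one_iff]; omega
    rcases Int.natAbs_eq (Algebra.norm ℤ r) with e | e
    · rw [e]; simpa using hab
    · rw [e]
      have := hm1.mul hab
      simpa using this
  · have hpos : 0 < Algebra.norm ℚ (r : K) := by
      apply norm_pos_of_real hr0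
      intro w hw
      by_contra hle
      have hlt : InfinitePlace.embedding_of_isReal hw (r : K) < 0 :=
        lt_of_le_of_ne (not_lt.1 hle) (by simpa using hr0')
      refine not_splAt_real hw (a := ((-(p : ℤ) : ℤ) : K)) ?_ hlt ((hsplit (Sum.inr w)).2 (hβw (Sum.inr w) (by simp)))
      rw [map_intCast]
      push_cast
      have : (0 : ℝ) < p := by exact_mod_cast hp.pos
      linarith
    have hz : 0 < Algebra.norm ℤ r := by
      rw [← Algebra.coe_norm_int] at hpos
      exact_mod_cast hpos
    have e : ((Algebra.norm ℤ r).natAbs : ℤ) = Algebra.norm ℤ r := Int.natAbs_of_nonneg hz.le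
    rw [← e]; simpa using hab
end RThm
end NND

end

section

namespace NND
set_option linter.unusedSectionVars false
set_option linter.unusedVariables false
set_option linter.style.haveILetI false
open NumberField IsDedekindDomain WithZero

universe u

section GoodPlaces
variable {K : Type u} [Field K] [NumberField K]

theorem exists_prime_below (v : FP K) : ∃ p : ℕ, p.Prime ∧ Ge v 1 (p : K) := by
  obtain ⟨p, hp⟩ := CharP.exists (kf v)
  refine ⟨p, CharP.char_is_prime (kf v) p, ?_⟩
  have h3 : (Ideal.Quotient.mk v.asIdeal ((p : ℕ) : 𝓞 K)) = Ideal.Quotient.mk v.asIdeal 0 := by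
    rw [map_natCast, map_zero]
    exact CharP.cast_eq_zero (kf v) p
  rw [red_eq_iff] at h3
  simpa using h3

theorem finite_bad : {v : FP K | ¬ Good v}.Finite := by
  classical
  choose P hP hPv using exists_prime_below (K := K)
  have hD : differentIdeal ℤ (𝓞 K) ≠ ⊥ := differentIdeal_ne_bot
  have hT := Ideal.finite_factors (R := 𝓞 K) (I := differentIdeal ℤ (𝓞 K)) hD
  have hn : ∀ n : ℕ, n.Prime → {v : FP K | od v (n : K) ≠ 0}.Finite := fun n hn => finite_od (by exact_mod_cast hn.ne_zero)
  refine ((hn 2 Nat.prime_two).union (hT.biUnion (t := fun w => {v : FP K | od v (P w : K) ≠ 0}) (fun w _ => hn _ (hP w)))).subset ?_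
  intro v hv
  have hPK : ∀ v, (P v : K) ≠ 0 := fun v => by exact_mod_cast (hP v).ne_zero
  have hod : ∀ v, od v (P v : K) ≠ 0 := by
    intro v
    have := hPv v
    rw [ge_iff v (hPK v)] at this
    omega
  by_cases h2 : P v = 2
  · left
    have := hod v
    rw [h2] at this
    exact this
  · right
    have hv' : ¬ Good v := hv
    have : ∃ w : FP K, Ge w 1 (P v : K) ∧ od w (P v : K) ≠ 1 := by
      by_contra hcon
      push Not at hcon
      exact hv' ⟨P v, hP v, h2, hPv v, hcon⟩
    obtain ⟨w, hw1, hw2⟩ := this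
    have heq : P w = P v := by
      by_contra hne
      have := od_nat_of_ne (hP w) (hP v) hne (hPv w)
      rw [ge_iff w (hPK v)] at hw1
      omega
    rw [Set.mem_iUnion₂]
    refine ⟨w, ?_, ?_⟩
    · change w.asIdeal ∣ differentIdeal ℤ (𝓞 K)
      have hge : Ge w (2 : ℕ) (((P v : ℕ) : 𝓞 K) : K) := by
        have : (((P v : ℕ) : 𝓞 K) : K) = (P v : K) := by simp
        rw [this, ge_iff w (hPK v)]
        rw [ge_iff w (hPK v)] at hw1
        push_cast
        omega
      rw [ge_iff_mem] at hge
      haveI : (Ideal.span {(P v : ℤ)}).IsMaximal :=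
        PrincipalIdealRing.isMaximal_of_irreducible (Nat.prime_iff_prime_int.1 (hP v)).irreducible
      have h3 := pow_sub_one_dvd_differentIdeal (A := ℤ) (B := 𝓞 K) (p := Ideal.span {(P v : ℤ)}) w.asIdeal 2
        (by simpa using (hP v).ne_zero) (by
          rw [Ideal.map_span, Set.image_singleton, Ideal.dvd_span_singleton]
          simpa using hge)
      simpa using h3
    · change od v (P w : K) ≠ 0
      rw [heq]; exact hod v

theorem exists_place_notin (S : Finset (FP K)) : ∃ v : FP K, v ∉ S := by
  have hnf := RingOfIntegers.not_isField K
  rw [Ring.not_isField_iff_exists_prime] at hnf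
  obtain ⟨I, hI, hIp⟩ := hnf
  let v0 : FP K := ⟨I, hIp, hI⟩
  obtain ⟨π, hπ0, hπ1⟩ := exists_unif v0
  obtain ⟨v, hv, -⟩ := exists_nonres (b := (π : K)) (fun r hr => by
    have := congrArg (od v0) hr
    rw [od_pow, hπ1] at this
    push_cast at this
    omega) S
  exact ⟨v, hv⟩

theorem exists_good_notin (S : Finset (FP K)) : ∃ v : FP K, v ∉ S ∧ Good v := by
  classical
  obtain ⟨v, hv⟩ := exists_place_notin (S ∪ (finite_bad (K := K)).toFinset)
  rw [Finset.mem_union, not_or] at hv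
  refine ⟨v, hv.1, ?_⟩
  have := hv.2
  simpa using this

/-- pairs with prescribed first slot ramified at a given place and at most one auxiliary good place -/
theorem exists_pair {a : K} (ha : a ≠ 0) {v : Pl K} {v0 : FP K} (hg : Good v0) (hne : v ≠ Sum.inl v0)
    (hv : ¬ LSq (pav v) a) (hv0 : ¬ LSq (fabv v0) a) :
    ∃ b : K, b ≠ 0 ∧ ¬ SplAt (pav v) a b ∧ ∀ w : Pl K, w ≠ v → w ≠ Sum.inl v0 → SplAt (pav w) a b := by
  classical
  have hns : ∀ r : K, r ^ 2 ≠ a := by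
    rintro r rfl
    exact hv0 (lsq_sq _ (by rintro rfl; simp at ha))
  obtain ⟨S1, hS1⟩ := exists_supp a ha
  obtain ⟨S2, hS2⟩ : ∃ S2 : Finset (FP K), v ∈ PS S2 := by
    rcases v with v | v
    · exact ⟨{v}, by simp⟩
    · exact ⟨∅, by simp⟩
  obtain ⟨S, hS, hG⟩ := exists_gd (S1 ∪ S2 ∪ {v0})
  have hvS : v ∈ PS S := PS_mono ((Finset.subset_union_right.trans Finset.subset_union_left).trans hS) hS2
  have hv0S : (Sum.inl v0 : Pl K) ∈ PS S := by
    rw [inl_mem_PS]; exact hS (by simp)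
  obtain ⟨z1, hz1, hz1v, hz1w⟩ := exists_sep_norm ha (PS S) hv
  obtain ⟨z2, hz2, hz2v, hz2w⟩ := exists_sep_norm ha (PS S) (v := Sum.inl v0) hv0
  obtain ⟨z, hz, b, hb, hbS, hbz⟩ := exists_E' hns hG (fun w hw => hS1 w (fun h => hw (hS (by simp [h])))) hz1 hz2
  have hz0 : z ≠ 0 := by
    rcases hz with rfl | rfl | rfl
    · exact hz1
    · exact hz2
    · exact mul_ne_zero hz1 hz2
  have hiff : ∀ w ∈ PS S, (SplAt (pav w) a b ↔ SplAt (pav w) a z) := fun w hw => splAt_congr hb hz0 (hbz w hw)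
  have hout : ∀ w ∉ PS S, SplAt (pav w) a b := by
    rintro (w | w) hw
    · exact hbS w (by simpa using hw)
    · simp at hw
  rcases hz with rfl | rfl | rfl
  · refine ⟨b, hb, by rwa [hiff v hvS], fun w hw _ => ?_⟩
    by_cases hwS : w ∈ PS S
    · rw [hiff w hwS]; exact hz1w w hwS hw
    · exact hout w hwS
  · exfalso
    refine recip hg ha hb (fun h => hz2v ((hiff _ hv0S).1 h)) (fun w hw => ?_)
    by_cases hwS : w ∈ PS S
    · rw [hiff w hwS]; exact hz2w w hwS hw
    · exact hout w hwS
  · refine ⟨b, hb, ?_, fun w hw hw0 => ?_⟩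
    · rw [hiff v hvS, splAt_mul_iff hz2 (hz2w v hvS hne)]; exact hz1v
    · by_cases hwS : w ∈ PS S
      · rw [hiff w hwS]; exact splAt_mul (hz1w w hwS hw) (hz2w w hwS hw0)
      · exact hout w hwS

end GoodPlaces
end NND

end

section

namespace NND
set_option linter.unusedSectionVars false
set_option linter.unusedVariables false
set_option linter.style.haveILetI false
open NumberField IsDedekindDomain WithZero

universe u

section Small
variable {K : Type u} [Field K] [NumberField K]

/-- smallness condition on `t` at the places where `(κ, π)` is ramified -/
def Qs (κ π t : K) : Prop := Rp κ π (t ^ 2 + 4 * π)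

theorem qs_bound {v : AbsoluteValue K ℝ} {κ π t : K} (hκ : κ ≠ 0) (hπ : π ≠ 0) (hn : ¬ SplAt v κ π) (h : Qs κ π t) :
    rad v * v t ^ 2 ≤ v (4 * π) := by
  by_contra hcon
  push Not at hcon
  have ht : t ≠ 0 := by
    rintro rfl
    have := v.nonneg (4 * π)
    simp only [map_zero] at hcon
    nlinarith
  apply hn
  refine spl_of_rep_lsq hκ hπ h ?_
  have h1 : LSq v ((t ^ 2 + 4 * π) / t ^ 2) := by
    refine lsq_of_near (pow_ne_zero 2 ht) ?_
    rw [add_sub_cancel_left, map_pow]; exact hcon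
  rw [lsq_ratio_iff (pow_ne_zero 2 ht)] at h1
  exact (lsq_mul_sq ht).1 h1

theorem qs_of_small {κ π t : K} (hκ : κ ≠ 0) (hπ : π ≠ 0)
    (h : ∀ v : Pl K, SplAt (pav v) κ π ∨ LSq (pav v) ((t ^ 2 + 4 * π) * (4 * π))) : Qs κ π t := by
  by_cases h0 : t ^ 2 + 4 * π = 0
  · unfold Qs; rw [h0]; exact ⟨0, 0, 0, by ring⟩
  refine rep_lemma hκ hπ h0 ?_
  intro v
  refine (h v).imp id fun h => ⟨π, rp_y _ _, ?_⟩
  rw [← lsq_mul_sq (c := (2 : K)) two_ne_zero]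
  convert h using 1; ring

theorem lsq_small {v : AbsoluteValue K ℝ} {t π : K} (hπ : π ≠ 0) (h : v t ^ 2 < rad v * v (4 * π)) :
    LSq v ((t ^ 2 + 4 * π) * (4 * π)) := by
  have h4 : 4 * π ≠ 0 := mul_ne_zero (show (4 : K) ≠ 0 by norm_num) hπ
  rw [← lsq_ratio_iff h4]
  refine lsq_of_near h4 ?_
  rw [add_sub_cancel_right, map_pow]; exact h

theorem exists_small (v : Pl K) {ε : ℝ} (hε : 0 < ε) : ∃ c : K, c ≠ 0 ∧ pav v c < ε := by
  classical
  obtain ⟨v', hv', _⟩ := exists_good_notin (K := K) (match v with | Sum.inl w => {w} | Sum.inr _ => ∅)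
  have hne : v ≠ Sum.inl v' := by
    rintro rfl; simp at hv'
  obtain ⟨c, hc⟩ := weak_approx' {v, Sum.inl v'} (fun w => if w = v then 0 else 1) (fun w => min ε 1) (fun _ => lt_min hε one_pos)
  have h1 := hc v (by simp)
  have h2 := hc (Sum.inl v') (by simp)
  rw [if_neg hne.symm] at h2
  rw [if_pos rfl, sub_zero] at h1
  refine ⟨c, ?_, h1.trans_le (min_le_left _ _)⟩
  rintro rfl
  have := h2.trans_le (min_le_right _ _)
  simp at this

/-- a pair ramified exactly at `v` (small second entry there) and perhaps one extra good place -/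
theorem exists_pair_small {v : Pl K} {v' : FP K} (hg : Good v') (hne : v ≠ Sum.inl v')
    {z : K} (hz0 : z ≠ 0) (hz : ¬ LSq (pav v) z) {ε : ℝ} (hε : 0 < ε) :
    ∃ κ π : K, κ ≠ 0 ∧ π ≠ 0 ∧ ¬ SplAt (pav v) κ π ∧ pav v (4 * π) < ε ∧
      ∀ w, w ≠ v → w ≠ Sum.inl v' → SplAt (pav w) κ π := by
  classical
  obtain ⟨z', hz'0, _, hz'⟩ := exists_unit_nonres hg.od_two
  obtain ⟨κ, hκ0, hκ⟩ := exists_class' {v, Sum.inl v'} (fun w => if w = v then z else (z' : K)) (by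
    intro w _; split_ifs
    · exact hz0
    · exact hz'0)
  have h1 := hκ v (by simp)
  have h2 := hκ (Sum.inl v') (by simp)
  rw [if_pos rfl] at h1
  rw [if_neg hne.symm] at h2
  have key : ∀ {w : AbsoluteValue K ℝ} {a b : K}, a ≠ 0 → LSq w (a * b) → ¬ LSq w b → ¬ LSq w a := by
    intro w a b ha h hb ha'
    apply hb
    have := lsq_mul h ha'
    rw [show a * b * a = b * a ^ 2 by ring, lsq_mul_sq ha] at this
    exact this
  obtain ⟨π, hπ0, hπ, hπ'⟩ := exists_pair hκ0 hg hne (key hκ0 h1 hz) (key hκ0 h2 hz')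
  have hpos : 0 < pav v (4 * π) := (pav v).pos (mul_ne_zero (show (4 : K) ≠ 0 by norm_num) hπ0)
  obtain ⟨c, hc0, hc⟩ := exists_small v (ε := min 1 (ε / pav v (4 * π))) (lt_min one_pos (by positivity))
  have hcl : ∀ w : AbsoluteValue K ℝ, SplAt w κ (π * c ^ 2) ↔ SplAt w κ π := by
    intro w
    refine splAt_congr (mul_ne_zero hπ0 (pow_ne_zero 2 hc0)) hπ0 ?_
    rw [show π * c ^ 2 * π = (π * c) ^ 2 by ring]
    exact lsq_sq w (mul_ne_zero hπ0 hc0)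
  refine ⟨κ, π * c ^ 2, hκ0, mul_ne_zero hπ0 (pow_ne_zero 2 hc0), by rwa [hcl], ?_, fun w h h' => (hcl _).2 (hπ' w h h')⟩
  rw [← mul_assoc, map_mul, map_pow]
  have hc1 := hc.trans_le (min_le_left _ _)
  have hc2 := hc.trans_le (min_le_right _ _)
  rw [lt_div_iff₀ hpos] at hc2
  have := (pav v).nonneg c
  nlinarith [mul_nonneg hpos.le (mul_nonneg this (sub_nonneg.2 hc1.le))]

theorem lsq_char (v : Pl K) : (∀ x : K, x ≠ 0 → LSq (pav v) x) ∨ ∃ κ π κ' π' : K, ∀ x : K,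
    LSq (pav v) x ↔ x ≠ 0 ∧ ∃ s t t' : K, x * s ^ 2 - 1 = t + t' ∧ Qs κ π t ∧ Qs κ' π' t' := by
  classical
  by_cases hall : ∀ x : K, x ≠ 0 → LSq (pav v) x
  · exact Or.inl hall
  right
  push Not at hall
  obtain ⟨z, hz0, hz⟩ := hall
  obtain ⟨v1, hv1, hg1⟩ := exists_good_notin (K := K) (match v with | Sum.inl w => {w} | Sum.inr _ => ∅)
  have hne1 : v ≠ Sum.inl v1 := by
    rintro rfl; simp at hv1
  obtain ⟨v2, hv2, hg2⟩ := exists_good_notin (K := K) (match v with | Sum.inl w => {w, v1} | Sum.inr _ => {v1})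
  have hne2 : v ≠ Sum.inl v2 := by
    rintro rfl; simp at hv2
  have hne12 : v2 ≠ v1 := by
    rintro rfl; rcases v with w | w <;> simp at hv2
  have hr := rad_pos (pav v)
  set r := rad (pav v) with hrd
  obtain ⟨κ, π, hκ, hπ, hn, hsm, hs⟩ := exists_pair_small hg1 hne1 hz0 hz (ε := r * (r / 2) ^ 2) (by positivity)
  obtain ⟨κ', π', hκ', hπ', hn', hsm', hs'⟩ := exists_pair_small hg2 hne2 hz0 hz (ε := r * (r / 2) ^ 2) (by positivity)
  have hb : ∀ {t : K} {p : K}, r * pav v t ^ 2 ≤ pav v (4 * p) → pav v (4 * p) < r * (r / 2) ^ 2 → pav v t < r / 2 := by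
    intro t p h1 h2
    have h3 : pav v t ^ 2 < (r / 2) ^ 2 := lt_of_mul_lt_mul_left (h1.trans_lt h2) hr.le
    exact lt_of_pow_lt_pow_left₀ 2 (by positivity) h3
  refine ⟨κ, π, κ', π', fun x => ⟨fun hx => ⟨hx.1, ?_⟩, ?_⟩⟩
  · -- choose the approximation
    let δ : Pl K → ℝ := fun w => min (rad (pav w) * pav w (4 * π)) (min (rad (pav w) * pav w (4 * π')) 1) / 2
    have hpos : ∀ w : Pl K, 0 < rad (pav w) * pav w (4 * π) := fun w => mul_pos (rad_pos _) ((pav w).pos (mul_ne_zero (show (4 : K) ≠ 0 by norm_num) hπ))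
    have hpos' : ∀ w : Pl K, 0 < rad (pav w) * pav w (4 * π') := fun w => mul_pos (rad_pos _) ((pav w).pos (mul_ne_zero (show (4 : K) ≠ 0 by norm_num) hπ'))
    have hδ : ∀ w, 0 < δ w := fun w => half_pos (lt_min (hpos w) (lt_min (hpos' w) one_pos))
    have hlt : ∀ w (t : K), pav w t < 2 * δ w → pav w t ^ 2 < rad (pav w) * pav w (4 * π) ∧ pav w t ^ 2 < rad (pav w) * pav w (4 * π') := by
      intro w t ht
      have ht' : pav w t < min (rad (pav w) * pav w (4 * π)) (min (rad (pav w) * pav w (4 * π')) 1) := by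
        have : 2 * δ w = min (rad (pav w) * pav w (4 * π)) (min (rad (pav w) * pav w (4 * π')) 1) := by simp only [δ]; ring
        rwa [this] at ht
      rw [lt_min_iff, lt_min_iff] at ht'
      have := (pav w).nonneg t
      constructor <;> nlinarith
    obtain ⟨s, hs1⟩ := hx.2 (δ v) (hδ v)
    set T := x * s ^ 2 - 1 with hT
    obtain ⟨t, ht⟩ := weak_approx' {v, Sum.inl v1, Sum.inl v2} (fun w => if w = Sum.inl v2 then T else 0) δ hδ
    have htv := ht v (by simp)
    have ht1 := ht (Sum.inl v1) (by simp)
    have ht2 := ht (Sum.inl v2) (by simp)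
    rw [if_neg hne2, sub_zero] at htv
    rw [if_neg (by simpa using hne12.symm), sub_zero] at ht1
    rw [if_pos rfl] at ht2
    refine ⟨s, t, T - t, by ring, ?_, ?_⟩
    · refine qs_of_small hκ hπ ?_
      intro w
      by_cases h1 : w = v
      · subst h1; right; exact lsq_small hπ (hlt _ _ (by linarith [hδ w])).1
      by_cases h2 : w = Sum.inl v1
      · subst h2; right; exact lsq_small hπ (hlt _ _ (by linarith [hδ (Sum.inl v1)])).1
      exact Or.inl (hs w h1 h2)
    · refine qs_of_small hκ' hπ' ?_
      intro w
      by_cases h1 : w = v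
      · subst h1; right
        refine lsq_small hπ' (hlt _ _ ?_).2
        have h3 := (pav w).add_le T (-t)
        rw [(pav w).map_neg, ← sub_eq_add_neg] at h3
        linarith
      by_cases h2 : w = Sum.inl v2
      · subst h2; right
        refine lsq_small hπ' (hlt _ _ ?_).2
        rw [(pav _).map_sub]
        linarith [hδ (Sum.inl v2)]
      exact Or.inl (hs' w h1 h2)
  · rintro ⟨hx, s, t, t', e, h1, h2⟩
    have b1 := hb (qs_bound hκ hπ hn h1) hsm
    have b2 := hb (qs_bound hκ' hπ' hn' h2) hsm'
    have h3 : LSq (pav v) (x * s ^ 2) := by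
      refine lsq_of_close ?_
      rw [e]
      have := (pav v).add_le t t'
      linarith
    have hs0 : s ≠ 0 := by
      rintro rfl
      exact h3.1 (by ring)
    exact (lsq_mul_sq hs0).1 h3

end Small
end NND

end

section

namespace NND
set_option linter.unusedSectionVars false
set_option linter.unusedVariables false
set_option linter.style.haveILetI false
open NumberField IsDedekindDomain WithZero

universe u

section Cert
variable {K : Type u} [Field K] [NumberField K]

/-- the certificate for ramification outside `B` -/
def CertB (v0 : FP K) (B : Finset (FP K)) (h x y : K) : Prop :=
  ∃ x' y' b u : K, Chain 3 x y x' y' ∧ b ≠ 0 ∧ ¬ SplAt (fabv v0) x' b ∧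
    (∀ w ∈ PS B, w ≠ Sum.inl v0 → SplAt (pav w) x' b) ∧ Rp x' b (1 - 4 * u / h) ∧
    Qs x' (y' * b) u ∧ Qs x' (y' * b)⁻¹ u ∧ Qs x' (-(x' * (y' * b))) u ∧ Qs x' (-(x' * (y' * b)))⁻¹ u

theorem qs_ge1 {w : FP K} (h2 : od w (2 : K) = 0) {κ π t : K} (hκ : κ ≠ 0) (hπ : π ≠ 0) (hn : ¬ SplAt (fabv w) κ π)
    (h : Qs κ π t) (hod : 1 ≤ od w π) : Ge w 1 t := by
  by_contra hcon
  have ht : t ≠ 0 := by rintro rfl; exact hcon (ge_zero w 1)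
  rw [ge_iff w ht] at hcon
  have h40 : (4 : K) ≠ 0 := by norm_num
  have h4 : od w (4 : K) = 0 := by rw [od4, h2]; simp
  have hp : od w (4 * π / t ^ 2) = od w π - 2 * od w t := by
    rw [od_div w (mul_ne_zero h40 hπ) (pow_ne_zero 2 ht), od_mul w h40 hπ, h4, od_pow]; push_cast; ring
  apply hn
  refine spl_of_rep_lsq hκ hπ h ?_
  have hge : Ge w 1 (4 * π / t ^ 2) := by
    rw [ge_iff w (div_ne_zero (mul_ne_zero h40 hπ) (pow_ne_zero 2 ht)), hp]; omega
  have hne : t ^ 2 + 4 * π ≠ 0 := by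
    have h1 := (unit_of_near (v := w) (x := 1 + 4 * π / t ^ 2) (by rwa [add_sub_cancel_left])).1
    intro h0
    apply h1
    field_simp
    rw [h0, mul_zero]
  refine lsq_fin_of (y := t⁻¹) hne ?_
  rw [h4, zero_add]
  convert hge using 1
  field_simp
  ring

theorem splAt_inv_iff {v : AbsoluteValue K ℝ} {a b : K} (hb : b ≠ 0) : SplAt v a b⁻¹ ↔ SplAt v a b := by
  refine splAt_congr (inv_ne_zero hb) hb ?_
  rw [inv_mul_cancel₀ hb]; exact lsq_one v

theorem splAt_negmul_iff {v : AbsoluteValue K ℝ} {a b : K} (ha : a ≠ 0) : SplAt v a (-(a * b)) ↔ SplAt v a b := by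
  rw [show -(a * b) = b * (-a) by ring]
  exact splAt_mul_iff (neg_ne_zero.2 ha) (splAt_neg_self v a)

theorem qs_four {w : FP K} (h2 : od w (2 : K) = 0) {x c u : K} (hx : x ≠ 0) (hc : c ≠ 0) (hn : ¬ SplAt (fabv w) x c)
    (h1 : Qs x c u) (h1' : Qs x c⁻¹ u) (h3 : Qs x (-(x * c)) u) (h3' : Qs x (-(x * c))⁻¹ u) : Ge w 1 u := by
  have hxc : -(x * c) ≠ 0 := neg_ne_zero.2 (mul_ne_zero hx hc)
  have hn' : ¬ SplAt (fabv w) x (-(x * c)) := by rwa [splAt_negmul_iff hx]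
  by_cases h0 : od w c = 0
  · by_cases h00 : od w (-(x * c)) = 0
    · exfalso
      apply hn
      rw [od_neg, od_mul w hx hc, h0, add_zero] at h00
      exact o_spl h2 hx h00 hc h0
    · rcases lt_or_gt_of_ne h00 with h | h
      · refine qs_ge1 h2 hx (inv_ne_zero hxc) (by rwa [splAt_inv_iff hxc]) h3' ?_
        rw [od_inv]; omega
      · exact qs_ge1 h2 hx hxc hn' h3 h
  · rcases lt_or_gt_of_ne h0 with h | h
    · refine qs_ge1 h2 hx (inv_ne_zero hc) (by rwa [splAt_inv_iff hc]) h1' ?_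
      rw [od_inv]; omega
    · exact qs_ge1 h2 hx hc hn h1 h

theorem cert_sound {v0 : FP K} (hv0 : Good v0) {B : Finset (FP K)} {h : K} (h0 : h ≠ 0)
    (hB : ∀ w, w ∉ B → Good w ∧ od w h = 0) {x y : K} (hx : x ≠ 0) (hy : y ≠ 0)
    (hc : CertB v0 B h x y) (hs : ∀ w : Pl K, SplAt (pav w) x y) : False := by
  obtain ⟨x', y', b, u, hch, hb, hn, hsB, hR, q1, q2, q3, q4⟩ := hc
  obtain ⟨hx', hy'⟩ := chain_ne hx hy hch
  have hs' : ∀ w : Pl K, SplAt (pav w) x' y' := fun w => (chain_splAt _ hx hy hch).1 (hs w)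
  refine recip hv0 hx' hb hn ?_
  intro w hw
  by_cases hwB : w ∈ PS B
  · exact hsB w hwB hw
  rcases w with w | w
  · rw [inl_mem_PS] at hwB
    by_contra hcon
    obtain ⟨hg, hh⟩ := hB w hwB
    have h2 := hg.od_two
    have hyb : ¬ SplAt (fabv w) x' (y' * b) := by
      rw [mul_comm, splAt_mul_iff (v := fabv w) hy' (hs' (Sum.inl w))]; exact hcon
    have hu := qs_four h2 hx' (mul_ne_zero hy' hb) hyb q1 q2 q3 q4
    apply hcon
    refine spl_of_rep_lsq hx' hb hR ?_
    have h40 : (4 : K) ≠ 0 := by norm_num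
    have h4 : od w (4 : K) = 0 := by rw [od4, h2]; simp
    have hge : Ge w 1 (4 * u / h) := by
      rw [div_eq_mul_inv]
      refine ge_mul' (n := 0) (ge_mul' (m := 0) (n := 1) ?_ hu le_rfl) ?_ le_rfl
      · rw [ge_iff w h40, h4]
      · rw [ge_iff w (inv_ne_zero h0), od_inv, hh]; simp
    have hge' : Ge w 1 (1 - 4 * u / h - 1) := by
      rw [show 1 - 4 * u / h - 1 = -(4 * u / h) by ring]; exact ge_neg hge
    refine lsq_fin_of (y := 1) (unit_of_near hge').1 ?_
    rw [h4, zero_add, one_pow, mul_one]; exact hge'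
  · simp at hwB

theorem o_two {w : FP K} (h2 : od w (2 : K) = 0) {a b b' : K} (ha : a ≠ 0) (hb : b ≠ 0) (hb' : b' ≠ 0)
    (h : ¬ SplAt (fabv w) a b) (h' : ¬ SplAt (fabv w) a b') : SplAt (fabv w) a (b * b') := by
  by_cases hev : Even (od w a)
  · have h1 : ¬ Even (od w b) := fun h1 => h (o_spl_even h2 ha hb hev h1)
    have h1' : ¬ Even (od w b') := fun h1 => h' (o_spl_even h2 ha hb' hev h1)
    refine o_spl_even h2 ha (mul_ne_zero hb hb') hev ?_
    rw [od_mul w hb hb', Int.even_add]; tauto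
  · have key : ∀ b : K, b ≠ 0 → ∃ c : K, c ≠ 0 ∧ SplAt (fabv w) a c ∧ Even (od w (b * c)) := by
      intro b hb
      by_cases hbe : Even (od w b)
      · exact ⟨1, one_ne_zero, splAt_of_lsq _ (lsq_one _), by rwa [mul_one]⟩
      · refine ⟨-a, neg_ne_zero.2 ha, splAt_neg_self _ _, ?_⟩
        rw [od_mul w hb (neg_ne_zero.2 ha), od_neg, Int.even_add]; tauto
    obtain ⟨c, hc, hs, he⟩ := key b hb
    obtain ⟨c', hc', hs', he'⟩ := key b' hb'
    obtain ⟨κ, hκ, hκ0, hκ1⟩ := exists_unit_nonres h2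
    rw [← splAt_mul_iff hc hs] at h
    rw [← splAt_mul_iff hc' hs'] at h'
    have l1 := lsq_of_even h2 hκ hκ0 hκ1 (mul_ne_zero hb hc) he (fun hl => h (splAt_of_lsq _ hl))
    have l2 := lsq_of_even h2 hκ hκ0 hκ1 (mul_ne_zero hb' hc') he' (fun hl => h' (splAt_of_lsq _ hl))
    have l3 := lsq_mul l1 l2
    rw [show (κ : K) * (b * c) * (κ * (b' * c')) = b * b' * (c * c') * (κ : K) ^ 2 by ring, lsq_mul_sq hκ] at l3
    rw [← splAt_mul_iff (mul_ne_zero hc hc') (splAt_mul hs hs')]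
    exact splAt_of_lsq _ l3

theorem lsq_pm1 {w : FP K} (h2 : od w (2 : K) = 0) {t e : K} (he : e ≠ 0) (ht : Ge w 1 t) (hod : od w e ≤ 1) :
    LSq (fabv w) ((t ^ 2 + 4 * e) * (4 * e)) := by
  have h40 : (4 : K) ≠ 0 := by norm_num
  have h4 : od w (4 : K) = 0 := by rw [od4, h2]; simp
  have hne : 4 * e ≠ 0 := mul_ne_zero h40 he
  have hge : Ge w 1 ((t ^ 2 + 4 * e) / (4 * e) - 1) := by
    rw [show (t ^ 2 + 4 * e) / (4 * e) - 1 = t * t * (4 * e)⁻¹ by field_simp; ring]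
    refine ge_mul' (ge_mul ht ht) (ge_od w _) ?_
    rw [od_inv, od_mul w h40 he, h4]; omega
  rw [← lsq_ratio_iff hne]
  refine lsq_fin_of (y := 1) (unit_of_near hge).1 ?_
  rw [h4, zero_add, one_pow, mul_one]; exact hge

theorem cert_complete {v0 : FP K} (hv0 : Good v0) {B : Finset (FP K)} (hv0B : v0 ∈ B) {h : K} (h0 : h ≠ 0)
    (hh : Ge v0 1 h) (hB : ∀ w, w ∉ B → Good w ∧ od w h = 0) {x y : K} (hx : x ≠ 0) (hy : y ≠ 0)
    (hA : ∀ w ∈ PS B, SplAt (pav w) x y) {v : Pl K} (hv : ¬ SplAt (pav v) x y) : CertB v0 B h x y := by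
  classical
  have h2 := hv0.od_two
  have h40 : (4 : K) ≠ 0 := by norm_num
  have h4 : od v0 (4 : K) = 0 := by rw [od4, h2]; simp
  have supp : ∀ a b : K, a ≠ 0 → b ≠ 0 → ∃ T : Finset (Pl K), (∀ w ∈ T, w ∉ PS B) ∧
      ∀ w, w ∉ PS B → w ∉ T → SplAt (pav w) a b := by
    intro a b ha hb
    obtain ⟨Sa, hSa⟩ := exists_supp a ha
    obtain ⟨Sb, hSb⟩ := exists_supp b hb
    refine ⟨((Sa ∪ Sb) \ B).image Sum.inl, ?_, ?_⟩
    · intro w hw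
      obtain ⟨w', hw', rfl⟩ := Finset.mem_image.1 hw
      rw [inl_mem_PS]; exact (Finset.mem_sdiff.1 hw').2
    · rintro (w | w) hw hw'
      · rw [inl_mem_PS] at hw
        have hw2 : w ∉ Sa ∪ Sb := fun hm => hw' (Finset.mem_image_of_mem _ (Finset.mem_sdiff.2 ⟨hm, hw⟩))
        rw [Finset.mem_union, not_or] at hw2
        exact o_spl (hB w hw).1.od_two ha (hSa w hw2.1) hb (hSb w hw2.2)
      · simp at hw
  have hv0P : (Sum.inl v0 : Pl K) ∈ PS B := by simpa using hv0B
  have hvB : v ∉ PS B := fun hm => hv (hA v hm)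
  have hvne : v ≠ Sum.inl v0 := fun e => hvB (e ▸ hv0P)
  -- the new first entry
  obtain ⟨κ, hκ, hκ0, hκ1⟩ := exists_unit_nonres h2
  obtain ⟨T, hT, hT'⟩ := supp x y hx hy
  obtain ⟨x', hx', hcl⟩ := exists_class (insert (Sum.inl v0) T) (Finset.insert_nonempty _ _)
    (fun w => if w = Sum.inl v0 then (κ : K) else x) (by intro w; split_ifs; exacts [hκ, hx])
    (fun _ => 1) (fun _ => one_pos)
  have hx'0 := hcl (Sum.inl v0) (by simp)
  rw [if_pos rfl] at hx'0
  have hge0 : Ge v0 1 (x' - κ) := (fabv_lt_one_iff v0).1 hx'0.2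
  have hodx' : od v0 x' = 0 := by
    have := (od_add_eq (v := v0) hκ (by rw [hκ0]; exact hge0)).2
    rw [add_sub_cancel, hκ0] at this
    exact this
  have hnl : ¬ LSq (fabv v0) x' := by
    intro hl
    apply hκ1
    have := lsq_mul hl hx'0.1
    rw [show x' * (x' * (κ : K)) = κ * x' ^ 2 by ring] at this
    exact (lsq_mul_sq hx').1 this
  have hR : Rp x y x' := by
    refine rep_lemma hx hy hx' ?_
    intro w
    by_cases hw : w ∈ PS B
    · exact Or.inl (hA w hw)
    by_cases hwT : w ∈ T
    · right
      refine ⟨x, rp_x _ _, ?_⟩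
      have := (hcl w (by simp [hwT])).1
      rwa [if_neg (fun e : w = Sum.inl v0 => hw (e ▸ hv0P))] at this
    · exact Or.inl (hT' w hw hwT)
  obtain ⟨p, q, r, e⟩ := hR
  obtain ⟨y', hch⟩ := chain_of_rep hx hy hx' e
  have hy' := (chain_ne hx hy hch).2
  have hiff : ∀ w : Pl K, SplAt (pav w) x y ↔ SplAt (pav w) x' y' := fun w => chain_splAt _ hx hy hch
  have hvl : ¬ LSq (pav v) x' := fun hl => hv ((hiff v).2 (splAt_of_lsq_left hy' hl))
  obtain ⟨b0, hb0, hb0v, hb0w⟩ := exists_pair hx' hv0 hvne hvl hnl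
  -- v is a good finite place
  obtain ⟨v, rfl⟩ : ∃ v' : FP K, v = Sum.inl v' := by
    rcases v with v | v
    · exact ⟨v, rfl⟩
    · simp at hvB
  have hvB' : v ∉ B := by simpa using hvB
  have hvg := (hB v hvB').1
  have hb00 : ¬ SplAt (fabv v0) x' b0 := by
    intro hs
    refine recip hvg hx' hb0 hb0v ?_
    intro w hw
    by_cases hw0 : w = Sum.inl v0
    · subst hw0; exact hs
    · exact hb0w w hw hw0
  have hyev : Even (od v0 y') := unr_even (o_unr h2 hx' hodx' hnl) hy' ((hiff _).1 (hA _ hv0P))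
  have hbodd : ¬ Even (od v0 b0) := fun hev => hb00 (o_spl_even h2 hx' hb0 (by rw [hodx']; exact Even.zero) hev)
  obtain ⟨n, hn⟩ : Odd (od v0 (y' * b0)) := by
    rw [← Int.not_even_iff_odd, od_mul v0 hy' hb0, Int.even_add]; tauto
  obtain ⟨ϖ, hϖ, hϖ1⟩ := exists_unif v0
  set s : K := (ϖ : K) ^ (-n) with hsd
  have hs0 : s ≠ 0 := zpow_ne_zero _ hϖ
  have hods : od v0 s = -n := by rw [hsd, od_zpow, hϖ1]; ring
  set b := b0 * s ^ 2 with hbd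
  have hb : b ≠ 0 := mul_ne_zero hb0 (pow_ne_zero 2 hs0)
  have hbi : ∀ w : AbsoluteValue K ℝ, SplAt w x' b ↔ SplAt w x' b0 := by
    intro w
    refine splAt_congr hb hb0 ?_
    rw [hbd, show b0 * s ^ 2 * b0 = (b0 * s) ^ 2 by ring]
    exact lsq_sq w (mul_ne_zero hb0 hs0)
  set c := y' * b with hcd
  have hc : c ≠ 0 := mul_ne_zero hy' hb
  have hodc : od v0 c = 1 := by
    rw [hcd, hbd, ← mul_assoc, od_mul v0 (mul_ne_zero hy' hb0) (pow_ne_zero 2 hs0), hn, od_pow, hods]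
    push_cast; ring
  have hxc : -(x' * c) ≠ 0 := neg_ne_zero.2 (mul_ne_zero hx' hc)
  have hodxc : od v0 (-(x' * c)) = 1 := by rw [od_neg, od_mul v0 hx' hc, hodx', hodc, zero_add]
  obtain ⟨T2, hT2, hT2'⟩ := supp x' c hx' hc
  have hcv : SplAt (pav (Sum.inl v)) x' c :=
    o_two hvg.od_two hx' hy' hb (fun hs => hv ((hiff _).2 hs)) (fun hs => hb0v ((hbi _).1 hs))
  have hcB : ∀ w ∈ PS B, w ≠ Sum.inl v0 → SplAt (pav w) x' c := by
    intro w hw hw0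
    exact splAt_mul ((hiff w).1 (hA w hw)) ((hbi _).2 (hb0w w (fun e => hvB (e ▸ hw)) hw0))
  -- choice of u
  let m : Pl K → K → ℝ := fun w e => rad (pav w) * pav w (4 * e)
  have hm : ∀ w e, e ≠ 0 → 0 < m w e := fun w e he => mul_pos (rad_pos _) ((pav w).pos (mul_ne_zero h40 he))
  let ε : Pl K → ℝ := fun w => min 1 (min (m w c) (min (m w c⁻¹) (min (m w (-(x' * c))) (min (m w (-(x' * c))⁻¹)
    (rad (pav w) * pav w x' * pav w (h / 4))))))
  have hε : ∀ w, 0 < ε w := by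
    intro w
    refine lt_min one_pos (lt_min (hm w _ hc) (lt_min (hm w _ (inv_ne_zero hc)) (lt_min (hm w _ hxc) (lt_min (hm w _ (inv_ne_zero hxc)) ?_))))
    exact mul_pos (mul_pos (rad_pos _) ((pav w).pos hx')) ((pav w).pos (div_ne_zero h0 h40))
  have hεs : ∀ w, ε w ≤ 1 ∧ ε w ≤ m w c ∧ ε w ≤ m w c⁻¹ ∧ ε w ≤ m w (-(x' * c)) ∧ ε w ≤ m w (-(x' * c))⁻¹ ∧
      ε w ≤ rad (pav w) * pav w x' * pav w (h / 4) := by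
    intro w
    have := le_refl (ε w)
    simp only [ε, le_min_iff] at this ⊢
    tauto
  obtain ⟨u, hu⟩ := weak_approx' (insert (Sum.inl v0) (insert (Sum.inl v) T2))
    (fun w => if w = Sum.inl v0 ∨ w = Sum.inl v then h * (1 - x') / 4 else 0) ε hε
  have hu0 := hu (Sum.inl v0) (by simp)
  have huv := hu (Sum.inl v) (by simp)
  rw [if_pos (Or.inl rfl)] at hu0
  rw [if_pos (Or.inr rfl)] at huv
  have hgu : Ge v0 1 u := by
    have h1 : Ge v0 1 (u - h * (1 - x') / 4) := (fabv_lt_one_iff v0).1 (hu0.trans_le (hεs _).1)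
    have h3 : Ge v0 1 (h * (1 - x') / 4) := by
      rw [div_eq_mul_inv]
      refine ge_mul' (n := 0) (ge_mul' (n := 0) hh ?_ le_rfl) ?_ le_rfl
      · refine ge_sub (ge_one v0) ?_
        rw [ge_iff v0 hx', hodx']
      · rw [ge_iff v0 (inv_ne_zero h40), od_inv, h4]; simp
    simpa using ge_add h1 h3
  have key : ∀ e : K, e ≠ 0 → (∀ w : AbsoluteValue K ℝ, SplAt w x' e ↔ SplAt w x' c) → od v0 e ≤ 1 →
      (∀ w, ε w ≤ m w e) → Qs x' e u := by
    intro e he hi ho hle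
    refine qs_of_small hx' he ?_
    intro w
    by_cases hw0 : w = Sum.inl v0
    · subst hw0; exact Or.inr (lsq_pm1 h2 he hgu ho)
    by_cases hwv : w = Sum.inl v
    · subst hwv; exact Or.inl ((hi _).2 hcv)
    by_cases hwB : w ∈ PS B
    · exact Or.inl ((hi _).2 (hcB w hwB hw0))
    by_cases hwT : w ∈ T2
    · right
      have := hu w (by simp [hwT])
      rw [if_neg (by tauto), sub_zero] at this
      refine lsq_small he ?_
      have h1 := this.trans_le (hεs w).1
      have h2 := this.trans_le (hle w)
      have h3 := (pav w).nonneg u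
      simp only [m] at h2
      nlinarith
    · exact Or.inl ((hi _).2 (hT2' w hwB hwT))
  refine ⟨x', y', b, u, hch, hb, by rwa [hbi], ?_, ?_, ?_, ?_, ?_, ?_⟩
  · intro w hw hw0
    exact (hbi _).2 (hb0w w (fun e => hvB (e ▸ hw)) hw0)
  · by_cases hf : 1 - 4 * u / h = 0
    · rw [hf]; exact ⟨0, 0, 0, by ring⟩
    refine rep_lemma hx' hb hf ?_
    have hl : ∀ w : Pl K, pav w (u - h * (1 - x') / 4) < ε w → LSq (pav w) ((1 - 4 * u / h) * x') := by
      intro w hw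
      rw [← lsq_ratio_iff hx']
      refine lsq_of_near hx' ?_
      have hpos : 0 < pav w (h / 4) := (pav w).pos (div_ne_zero h0 h40)
      refine lt_of_mul_lt_mul_right ?_ hpos.le
      rw [← map_mul]
      refine lt_of_eq_of_lt ?_ (hw.trans_le (hεs w).2.2.2.2.2)
      rw [← (pav w).map_neg]
      congr 1
      field_simp
      ring
    intro w
    by_cases hw0 : w = Sum.inl v0
    · subst hw0; exact Or.inr ⟨x', rp_x _ _, hl _ hu0⟩
    by_cases hwv : w = Sum.inl v
    · subst hwv; exact Or.inr ⟨x', rp_x _ _, hl _ huv⟩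
    exact Or.inl ((hbi _).2 (hb0w w hwv hw0))
  · exact key c hc (fun w => Iff.rfl) hodc.le (fun w => (hεs w).2.1)
  · exact key _ (inv_ne_zero hc) (fun w => splAt_inv_iff hc) (by rw [od_inv, hodc]; norm_num) (fun w => (hεs w).2.2.1)
  · exact key _ hxc (fun w => splAt_negmul_iff hx') hodxc.le (fun w => (hεs w).2.2.2.1)
  · exact key _ (inv_ne_zero hxc) (fun w => (splAt_inv_iff hxc).trans (splAt_negmul_iff hx'))
      (by rw [od_inv, hodxc]; norm_num) (fun w => (hεs w).2.2.2.2.1)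

/-- the main arithmetic equivalence -/
theorem exists_cert : ∃ (v0 : FP K) (B : Finset (FP K)) (h : K), ∀ x y : K, x ≠ 0 → y ≠ 0 →
    (¬ Spl x y ↔ ((∃ w ∈ PS B, ¬ SplAt (pav w) x y) ∨ CertB v0 B h x y)) := by
  classical
  obtain ⟨v0, -, hv0⟩ := exists_good_notin (K := K) ∅
  obtain ⟨p, hp, hp2, hpv, hpw⟩ := id hv0
  have hp0 : (p : K) ≠ 0 := by exact_mod_cast hp.ne_zero
  refine ⟨v0, (finite_bad (K := K)).toFinset ∪ (finite_od hp0).toFinset, p, ?_⟩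
  set B := (finite_bad (K := K)).toFinset ∪ (finite_od hp0).toFinset with hBd
  have hB : ∀ w, w ∉ B → Good w ∧ od w (p : K) = 0 := by
    intro w hw
    rw [hBd, Finset.mem_union, not_or] at hw
    simpa using hw
  have hv0B : v0 ∈ B := by
    rw [hBd, Finset.mem_union]
    right
    have := hpw v0 hpv
    simp [this]
  intro x y hx hy
  constructor
  · intro hns
    by_cases hA : ∃ w ∈ PS B, ¬ SplAt (pav w) x y
    · exact Or.inl hA
    right
    push Not at hA
    have : ∃ v : Pl K, ¬ SplAt (pav v) x y := by
      by_contra hcon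
      push Not at hcon
      exact hns (spl_symm hy (hasse hx hy hcon))
    obtain ⟨v, hv⟩ := this
    exact cert_complete hv0 hv0B hp0 hpv hB hx hy hA hv
  · intro hd hs
    have hall : ∀ w : Pl K, SplAt (pav w) x y := fun w => splAt_of_spl _ (spl_symm hx hs)
    rcases hd with ⟨w, _, hw⟩ | hd
    · exact hw (hall w)
    · exact cert_sound hv0 hp0 hB hx hy hd hall

end Cert
end NND

end

section

namespace NND
set_option linter.unusedSectionVars false
set_option linter.unusedVariables false
set_option linter.style.haveILetI false
open NumberField IsDedekindDomain WithZero

universe u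

section DioDefs
variable {K : Type u} [Field K] {ι γ : Type}

/-- polynomial functions -/
def Po (g : (ι → K) → K) : Prop := ∃ p : MvPolynomial ι K, ∀ a, g a = MvPolynomial.eval a p

theorem po_var (i : ι) : Po (fun a : ι → K => a i) := ⟨MvPolynomial.X i, fun a => by simp⟩
theorem po_const (c : K) : Po (fun _ : ι → K => c) := ⟨MvPolynomial.C c, fun a => by simp⟩
theorem po_add {f g : (ι → K) → K} (hf : Po f) (hg : Po g) : Po (fun a => f a + g a) := by
  obtain ⟨p, hp⟩ := hf
  obtain ⟨q, hq⟩ := hg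
  exact ⟨p + q, fun a => by simp [hp, hq]⟩
theorem po_mul {f g : (ι → K) → K} (hf : Po f) (hg : Po g) : Po (fun a => f a * g a) := by
  obtain ⟨p, hp⟩ := hf
  obtain ⟨q, hq⟩ := hg
  exact ⟨p * q, fun a => by simp [hp, hq]⟩
theorem po_sub {f g : (ι → K) → K} (hf : Po f) (hg : Po g) : Po (fun a => f a - g a) := by
  obtain ⟨p, hp⟩ := hf
  obtain ⟨q, hq⟩ := hg
  exact ⟨p - q, fun a => by simp [hp, hq]⟩
theorem po_neg {f : (ι → K) → K} (hf : Po f) : Po (fun a => - f a) := by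
  obtain ⟨p, hp⟩ := hf
  exact ⟨-p, fun a => by simp [hp]⟩
theorem po_pow {f : (ι → K) → K} (hf : Po f) (n : ℕ) : Po (fun a => f a ^ n) := by
  obtain ⟨p, hp⟩ := hf
  exact ⟨p ^ n, fun a => by simp [hp]⟩

/-- diophantine predicates -/
def Dio (P : (ι → K) → Prop) : Prop :=
  ∃ (m : ℕ) (f : MvPolynomial (ι ⊕ Fin m) K), ∀ a : ι → K, P a ↔ ∃ x : Fin m → K, MvPolynomial.eval (Sum.elim a x) f = 0

theorem dio_of {β : Type} [Finite β] {P : (ι → K) → Prop} (f : MvPolynomial (ι ⊕ β) K)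
    (h : ∀ a, P a ↔ ∃ x : β → K, MvPolynomial.eval (Sum.elim a x) f = 0) : Dio P := by
  obtain ⟨m, ⟨e⟩⟩ := Finite.exists_equiv_fin β
  refine ⟨m, MvPolynomial.rename (Sum.map id e) f, fun a => ?_⟩
  rw [h]
  constructor
  · rintro ⟨x, hx⟩
    refine ⟨x ∘ e.symm, ?_⟩
    rw [MvPolynomial.eval_rename]
    convert hx using 2
    refine congrArg _ ?_
    funext i; rcases i with i | i <;> simp
  · rintro ⟨x, hx⟩
    refine ⟨x ∘ e, ?_⟩
    rw [MvPolynomial.eval_rename] at hx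
    convert hx using 2
    refine congrArg _ ?_
    funext i; rcases i with i | i <;> simp

theorem dio_congr {P Q : (ι → K) → Prop} (h : Dio Q) (e : ∀ a, P a ↔ Q a) : Dio P := by
  obtain ⟨m, f, hf⟩ := h
  exact ⟨m, f, fun a => (e a).trans (hf a)⟩

theorem dio_eq {f g : (ι → K) → K} (hf : Po f) (hg : Po g) : Dio (fun a => f a = g a) := by
  obtain ⟨p, hp⟩ := po_sub hf hg
  refine dio_of (β := Empty) (MvPolynomial.rename Sum.inl p) fun a => ?_
  have : ∀ x : Empty → K, MvPolynomial.eval (Sum.elim a x) (MvPolynomial.rename Sum.inl p) = f a - g a := by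
    intro x
    rw [MvPolynomial.eval_rename, Sum.elim_comp_inl, ← hp]
  simp only [this, sub_eq_zero]
  simp

theorem dio_subst {P : (γ → K) → Prop} (h : Dio P) (g : γ → (ι → K) → K) (hg : ∀ c, Po (g c)) :
    Dio (fun a => P (fun c => g c a)) := by
  obtain ⟨m, f, hf⟩ := h
  choose p hp using hg
  refine ⟨m, MvPolynomial.bind₁ (Sum.elim (fun c => MvPolynomial.rename Sum.inl (p c)) (fun i => MvPolynomial.X (Sum.inr i))) f, fun a => ?_⟩
  refine (hf _).trans (exists_congr fun x => ?_)
  have key : MvPolynomial.eval (Sum.elim a x) (MvPolynomial.bind₁ (Sum.elim (fun c => MvPolynomial.rename Sum.inl (p c)) (fun i => MvPolynomial.X (Sum.inr i))) f)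
      = MvPolynomial.eval (Sum.elim (fun c => g c a) x) f := by
    rw [MvPolynomial.eval, MvPolynomial.eval₂Hom_bind₁, MvPolynomial.eval]
    congr 2
    funext i
    rcases i with i | i
    · have := hp i a
      simp only [Sum.elim_inl, this]
      change MvPolynomial.eval (Sum.elim a x) _ = _
      rw [MvPolynomial.eval_rename, Sum.elim_comp_inl]
    · simp
  rw [key]

theorem dio_ex {P : (ι → K) → K → Prop} (h : Dio (fun b : Option ι → K => P (fun i => b (some i)) (b none))) :
    Dio (fun a => ∃ x, P a x) := by
  obtain ⟨m, f, hf⟩ := h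
  refine dio_of (β := Option (Fin m))
    (MvPolynomial.rename (Sum.elim (fun o => Option.elim o (Sum.inr none) Sum.inl) (fun i => Sum.inr (some i))) f) fun a => ?_
  constructor
  · rintro ⟨x, hx⟩
    obtain ⟨t, ht⟩ := (hf (fun o => Option.elim o x a)).1 hx
    refine ⟨fun o => Option.elim o x t, ?_⟩
    rw [MvPolynomial.eval_rename]
    convert ht using 2
    refine congrArg _ ?_
    funext i; rcases i with (_ | i) | i <;> simp
  · rintro ⟨x, hx⟩
    refine ⟨x none, ?_⟩
    refine (hf (fun o => Option.elim o (x none) a)).2 ⟨fun i => x (some i), ?_⟩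
    rw [MvPolynomial.eval_rename] at hx
    convert hx using 2
    refine congrArg _ ?_
    funext i; rcases i with (_ | i) | i <;> simp

theorem dio_or {P Q : (ι → K) → Prop} (hP : Dio P) (hQ : Dio Q) : Dio (fun a => P a ∨ Q a) := by
  obtain ⟨m, f, hf⟩ := hP
  obtain ⟨n, g, hg⟩ := hQ
  refine dio_of (β := Fin m ⊕ Fin n)
    (MvPolynomial.rename (Sum.map id Sum.inl) f * MvPolynomial.rename (Sum.map id Sum.inr) g) fun a => ?_
  have e1 : ∀ x : Fin m ⊕ Fin n → K, MvPolynomial.eval (Sum.elim a x) (MvPolynomial.rename (Sum.map id Sum.inl) f)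
      = MvPolynomial.eval (Sum.elim a (x ∘ Sum.inl)) f := fun x => by
    rw [MvPolynomial.eval_rename, Sum.elim_comp_map, Function.comp_id]
  have e2 : ∀ x : Fin m ⊕ Fin n → K, MvPolynomial.eval (Sum.elim a x) (MvPolynomial.rename (Sum.map id Sum.inr) g)
      = MvPolynomial.eval (Sum.elim a (x ∘ Sum.inr)) g := fun x => by
    rw [MvPolynomial.eval_rename, Sum.elim_comp_map, Function.comp_id]
  simp only [map_mul, e1, e2, mul_eq_zero]
  rw [hf, hg]
  constructor
  · rintro (⟨x, hx⟩ | ⟨x, hx⟩)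
    · exact ⟨Sum.elim x 0, Or.inl (by simpa using hx)⟩
    · exact ⟨Sum.elim 0 x, Or.inr (by simpa using hx)⟩
  · rintro ⟨x, hx | hx⟩
    · exact Or.inl ⟨_, hx⟩
    · exact Or.inr ⟨_, hx⟩

end DioDefs

section DioNF
variable {K : Type u} [Field K] [NumberField K] {ι γ : Type}

theorem exists_nonsq : ∃ d : K, ∀ r : K, r ^ 2 ≠ d := by
  obtain ⟨v, -, hv⟩ := exists_good_notin (K := K) ∅
  obtain ⟨κ, h0, -, h1⟩ := exists_unit_nonres hv.od_two
  refine ⟨κ, fun r hr => h1 ?_⟩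
  rw [← hr]
  refine lsq_sq _ ?_
  rintro rfl
  exact h0 (by rw [← hr]; ring)

theorem dio_and {P Q : (ι → K) → Prop} (hP : Dio P) (hQ : Dio Q) : Dio (fun a => P a ∧ Q a) := by
  obtain ⟨d, hd⟩ := exists_nonsq (K := K)
  have hz : ∀ s t : K, s ^ 2 - d * t ^ 2 = 0 ↔ s = 0 ∧ t = 0 := by
    intro s t
    constructor
    · intro h
      by_cases ht : t = 0
      · subst ht; exact ⟨by simpa using h, rfl⟩
      · exfalso
        refine hd (s / t) ?_
        rw [div_pow, div_eq_iff (pow_ne_zero 2 ht)]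
        linear_combination h
    · rintro ⟨rfl, rfl⟩; ring
  obtain ⟨m, f, hf⟩ := hP
  obtain ⟨n, g, hg⟩ := hQ
  refine dio_of (β := Fin m ⊕ Fin n)
    (MvPolynomial.rename (Sum.map id Sum.inl) f ^ 2 - MvPolynomial.C d * MvPolynomial.rename (Sum.map id Sum.inr) g ^ 2) fun a => ?_
  have e1 : ∀ x : Fin m ⊕ Fin n → K, MvPolynomial.eval (Sum.elim a x) (MvPolynomial.rename (Sum.map id Sum.inl) f)
      = MvPolynomial.eval (Sum.elim a (x ∘ Sum.inl)) f := fun x => by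
    rw [MvPolynomial.eval_rename, Sum.elim_comp_map, Function.comp_id]
  have e2 : ∀ x : Fin m ⊕ Fin n → K, MvPolynomial.eval (Sum.elim a x) (MvPolynomial.rename (Sum.map id Sum.inr) g)
      = MvPolynomial.eval (Sum.elim a (x ∘ Sum.inr)) g := fun x => by
    rw [MvPolynomial.eval_rename, Sum.elim_comp_map, Function.comp_id]
  simp only [map_mul, map_sub, map_pow, e1, e2, MvPolynomial.eval_C, hz]
  rw [hf, hg]
  constructor
  · rintro ⟨⟨x, hx⟩, ⟨y, hy⟩⟩
    exact ⟨Sum.elim x y, by simpa using hx, by simpa using hy⟩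
  · rintro ⟨x, hx, hy⟩
    exact ⟨⟨_, hx⟩, ⟨_, hy⟩⟩

theorem dio_true : Dio (fun _ : ι → K => True) :=
  dio_congr (dio_eq (po_const (0 : K)) (po_const 0)) (by simp)
theorem dio_false : Dio (fun _ : ι → K => False) :=
  dio_congr (dio_eq (po_const (0 : K)) (po_const 1)) (by simp)

theorem dio_ne {f g : (ι → K) → K} (hf : Po f) (hg : Po g) : Dio (fun a => f a ≠ g a) := by
  have h : Dio (fun a : ι → K => ∃ t : K, (f a - g a) * t = 1) := by
    refine dio_ex ?_
    obtain ⟨p, hp⟩ := po_sub hf hg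
    refine dio_eq (po_mul ⟨MvPolynomial.rename some p, fun a => ?_⟩ (po_var none)) (po_const 1)
    rw [hp, MvPolynomial.eval_rename]; rfl
  refine dio_congr h fun a => ?_
  rw [← sub_ne_zero]
  exact ⟨fun h => ⟨_, mul_inv_cancel₀ h⟩, fun ⟨t, ht⟩ h0 => by simp [h0] at ht⟩

theorem dio_bigor {α : Type*} (s : Finset α) {P : α → (ι → K) → Prop} (h : ∀ i ∈ s, Dio (P i)) :
    Dio (fun a => ∃ i ∈ s, P i a) := by
  classical
  induction s using Finset.induction_on with
  | empty => exact dio_congr dio_false (by simp)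
  | insert i s hi ih =>
    refine dio_congr (dio_or (h i (by simp)) (ih fun j hj => h j (by simp [hj]))) fun a => ?_
    simp

theorem dio_bigand {α : Type*} (s : Finset α) {P : α → (ι → K) → Prop} (h : ∀ i ∈ s, Dio (P i)) :
    Dio (fun a => ∀ i ∈ s, P i a) := by
  classical
  induction s using Finset.induction_on with
  | empty => exact dio_congr dio_true (by simp)
  | insert i s hi ih =>
    refine dio_congr (dio_and (h i (by simp)) (ih fun j hj => h j (by simp [hj]))) fun a => ?_
    simp

/-- unary diophantine relations -/
def D1 (R : K → Prop) : Prop := Dio (fun a : Fin 1 → K => R (a 0))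
/-- binary diophantine relations -/
def D2 (R : K → K → Prop) : Prop := Dio (fun a : Fin 2 → K => R (a 0) (a 1))
/-- ternary diophantine relations -/
def D3 (R : K → K → K → Prop) : Prop := Dio (fun a : Fin 3 → K => R (a 0) (a 1) (a 2))
/-- quaternary diophantine relations -/
def D4 (R : K → K → K → K → Prop) : Prop := Dio (fun a : Fin 4 → K => R (a 0) (a 1) (a 2) (a 3))

theorem D1.comp {R : K → Prop} (h : D1 R) {f : (ι → K) → K} (hf : Po f) : Dio (fun a => R (f a)) :=
  dio_subst h ![f] (by intro c; fin_cases c; exact hf)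
theorem D2.comp {R : K → K → Prop} (h : D2 R) {f g : (ι → K) → K} (hf : Po f) (hg : Po g) : Dio (fun a => R (f a) (g a)) :=
  dio_subst h ![f, g] (by intro c; fin_cases c; exacts [hf, hg])
theorem D3.comp {R : K → K → K → Prop} (h : D3 R) {f g k : (ι → K) → K} (hf : Po f) (hg : Po g) (hk : Po k) :
    Dio (fun a => R (f a) (g a) (k a)) :=
  dio_subst h ![f, g, k] (by intro c; fin_cases c; exacts [hf, hg, hk])
theorem D4.comp {R : K → K → K → K → Prop} (h : D4 R) {f g k l : (ι → K) → K} (hf : Po f) (hg : Po g) (hk : Po k) (hl : Po l) :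
    Dio (fun a => R (f a) (g a) (k a) (l a)) :=
  dio_subst h ![f, g, k, l] (by intro c; fin_cases c; exacts [hf, hg, hk, hl])

end DioNF
end NND

end

section

namespace NND
set_option linter.unusedSectionVars false
set_option linter.unusedVariables false
set_option linter.style.haveILetI false
open NumberField IsDedekindDomain WithZero

universe u

section DioFinal
variable {K : Type u} [Field K] [NumberField K] {ι γ : Type}

theorem d3_Rp : D3 (Rp : K → K → K → Prop) := by
  unfold D3 Rp
  refine dio_ex (dio_ex (dio_ex (dio_eq ?_ ?_))) <;>
    repeat' first | exact po_var _ | exact po_const _ | apply po_add | apply po_sub | apply po_mul | apply po_pow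

theorem d3_Qs : D3 (Qs : K → K → K → Prop) := by
  unfold D3 Qs
  refine d3_Rp.comp ?_ ?_ ?_ <;>
    repeat' first | exact po_var _ | exact po_const _ | apply po_add | apply po_sub | apply po_mul | apply po_pow

theorem d1_LSq (v : Pl K) : D1 (LSq (pav v)) := by
  rcases lsq_char v with h | ⟨κ, π, κ', π', h⟩
  · refine dio_congr (dio_ne (po_var 0) (po_const 0)) fun a => ⟨fun h => h.1, h _⟩
  · refine dio_congr (dio_and (dio_ne (po_var 0) (po_const 0)) (dio_ex (dio_ex (dio_ex
      (P := fun b t' => b (some (some 0)) * b (some none) ^ 2 - 1 = b none + t' ∧ Qs κ π (b none) ∧ Qs κ' π' t')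
      (dio_and (dio_eq ?_ ?_) (dio_and (d3_Qs.comp ?_ ?_ ?_) (d3_Qs.comp ?_ ?_ ?_))))))) (fun a => h (a 0)) <;>
    repeat' first | exact po_var _ | exact po_const _ | apply po_add | apply po_sub | apply po_mul | apply po_pow

theorem exists_reps (v : Pl K) : ∃ s : Finset K, (∀ r ∈ s, r ≠ 0) ∧ ∀ x : K, x ≠ 0 → ∃ r ∈ s, LSq (pav v) (x * r) := by
  classical
  haveI : Finite (Kˣ ⧸ LSg (pav v)) := Subgroup.finiteIndex_iff_finite_quotient.1 ⟨pl_index_ne v⟩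
  haveI := Fintype.ofFinite (Kˣ ⧸ LSg (pav v))
  refine ⟨Finset.univ.image (fun q : Kˣ ⧸ LSg (pav v) => ((Quotient.out q : Kˣ) : K)), ?_, ?_⟩
  · intro r hr
    obtain ⟨q, -, rfl⟩ := Finset.mem_image.1 hr
    exact Units.ne_zero _
  · intro x hx
    set y : Kˣ := Units.mk0 x hx
    refine ⟨_, Finset.mem_image_of_mem _ (Finset.mem_univ ((y : Kˣ) : Kˣ ⧸ LSg (pav v))), ?_⟩
    set r : Kˣ := Quotient.out ((y : Kˣ) : Kˣ ⧸ LSg (pav v)) with hr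
    have h1 : ((r : Kˣ) : Kˣ ⧸ LSg (pav v)) = y := Quotient.out_eq' _
    rw [QuotientGroup.eq] at h1
    have h2 := mem_LSg.1 h1
    have h3 := lsq_mul h2 (lsq_sq (pav v) (Units.ne_zero r))
    convert h3 using 1
    simp only [Units.val_mul, Units.val_inv_eq_inv_val]
    have := Units.ne_zero r
    field_simp
    simp [y]

theorem d2_inv (v : Pl K) (P : K → K → Prop)
    (hP : ∀ x x' y y' : K, x ≠ 0 → x' ≠ 0 → y ≠ 0 → y' ≠ 0 → LSq (pav v) (x * x') → LSq (pav v) (y * y') → P x y → P x' y') :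
    D2 (fun x y => x ≠ 0 ∧ y ≠ 0 ∧ P x y) := by
  classical
  obtain ⟨s, hs, hs'⟩ := exists_reps v
  refine dio_congr (dio_bigor ((s ×ˢ s).filter (fun p => P p.1 p.2))
    (P := fun p a => LSq (pav v) (a 0 * p.1) ∧ LSq (pav v) (a 1 * p.2))
    (fun p _ => dio_and ((d1_LSq v).comp (po_mul (po_var 0) (po_const _))) ((d1_LSq v).comp (po_mul (po_var 1) (po_const _))))) ?_
  intro a
  constructor
  · rintro ⟨h0, h1, h⟩
    obtain ⟨r, hr, hl⟩ := hs' _ h0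
    obtain ⟨r', hr', hl'⟩ := hs' _ h1
    refine ⟨(r, r'), ?_, hl, hl'⟩
    rw [Finset.mem_filter, Finset.mem_product]
    exact ⟨⟨hr, hr'⟩, hP _ _ _ _ h0 (hs _ hr) h1 (hs _ hr') hl hl' h⟩
  · rintro ⟨⟨r, r'⟩, hm, hl, hl'⟩
    rw [Finset.mem_filter, Finset.mem_product] at hm
    obtain ⟨⟨hr, hr'⟩, h⟩ := hm
    have h0 : a 0 ≠ 0 := left_ne_zero_of_mul hl.1
    have h1 : a 1 ≠ 0 := left_ne_zero_of_mul hl'.1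
    refine ⟨h0, h1, hP _ _ _ _ (hs _ hr) h0 (hs _ hr') h1 ?_ ?_ h⟩
    · rw [mul_comm]; exact hl
    · rw [mul_comm]; exact hl'

theorem splAt_congr2 {v : AbsoluteValue K ℝ} {x x' y y' : K} (hx : x ≠ 0) (hx' : x' ≠ 0) (hy : y ≠ 0) (hy' : y' ≠ 0)
    (h : LSq v (x * x')) (h' : LSq v (y * y')) : SplAt v x y ↔ SplAt v x' y' :=
  (splAt_congr hy hy' h').trans (splAt_congr_left hx hx' hy' h)

theorem d2_spl (v : Pl K) : D2 (fun x y : K => x ≠ 0 ∧ y ≠ 0 ∧ SplAt (pav v) x y) :=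
  d2_inv v _ fun x x' y y' hx hx' hy hy' h h' hs => (splAt_congr2 hx hx' hy hy' h h').1 hs
theorem d2_nspl (v : Pl K) : D2 (fun x y : K => x ≠ 0 ∧ y ≠ 0 ∧ ¬ SplAt (pav v) x y) :=
  d2_inv v _ fun x x' y y' hx hx' hy hy' h h' hs => fun hc => hs ((splAt_congr2 hx hx' hy hy' h h').2 hc)

theorem d4_mv : D4 (Mv : K → K → K → K → Prop) := by
  unfold D4 Mv
  refine dio_ex (dio_ex (dio_and (dio_ne ?_ ?_) (dio_or (dio_and (dio_eq ?_ ?_) (dio_eq ?_ ?_)) (dio_and (dio_eq ?_ ?_) (dio_eq ?_ ?_))))) <;>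
    repeat' first | exact po_var _ | exact po_const _ | apply po_add | apply po_sub | apply po_mul | apply po_pow

theorem d4_chain (n : ℕ) : D4 (Chain n : K → K → K → K → Prop) := by
  induction n with
  | zero => exact dio_and (dio_eq (po_var 0) (po_var 2)) (dio_eq (po_var 1) (po_var 3))
  | succ n ih =>
    exact dio_ex (dio_ex (dio_and (d4_mv.comp (po_var _) (po_var _) (po_var _) (po_var _))
      (ih.comp (po_var _) (po_var _) (po_var _) (po_var _))))

theorem d2_cert (v0 : FP K) (B : Finset (FP K)) (h : K) : D2 (fun x y : K => x ≠ 0 ∧ y ≠ 0 ∧ CertB v0 B h x y) := by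
  classical
  have key : D2 (fun x y : K => x ≠ 0 ∧ y ≠ 0 ∧ ∃ x' y' b u c c' e e' : K, Chain 3 x y x' y' ∧
      (x' ≠ 0 ∧ b ≠ 0 ∧ ¬ SplAt (pav (Sum.inl v0)) x' b) ∧
      (∀ w ∈ (PS B).erase (Sum.inl v0), x' ≠ 0 ∧ b ≠ 0 ∧ SplAt (pav w) x' b) ∧ Rp x' b (1 - 4 * u * h⁻¹) ∧
      c = y' * b ∧ c * c' = 1 ∧ e = -(x' * (y' * b)) ∧ e * e' = 1 ∧ Qs x' c u ∧ Qs x' c' u ∧ Qs x' e u ∧ Qs x' e' u) := by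
    refine dio_and (dio_ne (po_var 0) (po_const 0)) (dio_and (dio_ne (po_var 1) (po_const 0)) ?_)
    refine dio_ex (dio_ex (dio_ex (dio_ex (dio_ex (dio_ex (dio_ex (dio_ex ?_)))))))
    refine dio_and ((d4_chain 3).comp (po_var _) (po_var _) (po_var _) (po_var _)) ?_
    refine dio_and ((d2_nspl (Sum.inl v0)).comp (po_var _) (po_var _)) ?_
    refine dio_and (dio_bigand _ fun w _ => (d2_spl w).comp (po_var _) (po_var _)) ?_
    refine dio_and (d3_Rp.comp (po_var _) (po_var _) (po_sub (po_const _) (po_mul (po_mul (po_const _) (po_var _)) (po_const _)))) ?_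
    refine dio_and (dio_eq (po_var _) (po_mul (po_var _) (po_var _))) ?_
    refine dio_and (dio_eq (po_mul (po_var _) (po_var _)) (po_const _)) ?_
    refine dio_and (dio_eq (po_var _) (po_neg (po_mul (po_var _) (po_mul (po_var _) (po_var _))))) ?_
    refine dio_and (dio_eq (po_mul (po_var _) (po_var _)) (po_const _)) ?_
    exact dio_and (d3_Qs.comp (po_var _) (po_var _) (po_var _)) (dio_and (d3_Qs.comp (po_var _) (po_var _) (po_var _))
      (dio_and (d3_Qs.comp (po_var _) (po_var _) (po_var _)) (d3_Qs.comp (po_var _) (po_var _) (po_var _))))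
  refine dio_congr key fun a => ?_
  refine and_congr_right fun hx => and_congr_right fun hy => ?_
  constructor
  · rintro ⟨x', y', b, u, hch, hb, hn, hsB, hR, q1, q2, q3, q4⟩
    obtain ⟨hx', hy'⟩ := chain_ne hx hy hch
    have hc : y' * b ≠ 0 := mul_ne_zero hy' hb
    have he : -(x' * (y' * b)) ≠ 0 := neg_ne_zero.2 (mul_ne_zero hx' hc)
    refine ⟨x', y', b, u, _, _, _, _, hch, ⟨hx', hb, hn⟩, ?_, by rwa [← div_eq_mul_inv], rfl, mul_inv_cancel₀ hc, rfl, mul_inv_cancel₀ he, q1, q2, q3, q4⟩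
    intro w hw
    exact ⟨hx', hb, hsB w (Finset.mem_of_mem_erase hw) (Finset.ne_of_mem_erase hw)⟩
  · rintro ⟨x', y', b, u, c, c', e, e', hch, ⟨hx', hb, hn⟩, hsB, hR, rfl, h1, rfl, h2, q1, q2, q3, q4⟩
    rw [eq_inv_of_mul_eq_one_right h1] at q2
    rw [eq_inv_of_mul_eq_one_right h2] at q4
    exact ⟨x', y', b, u, hch, hb, hn, fun w hw hw0 => (hsB w (Finset.mem_erase.2 ⟨hw0, hw⟩)).2.2, by rwa [div_eq_mul_inv], q1, q2, q3, q4⟩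

theorem d2_nonspl : D2 (fun x y : K => x ≠ 0 ∧ y ≠ 0 ∧ ¬ Spl x y) := by
  obtain ⟨v0, B, h, hc⟩ := exists_cert (K := K)
  refine dio_congr (dio_or (dio_bigor (PS B) fun w _ => d2_nspl w) (d2_cert v0 B h)) fun a => ?_
  constructor
  · rintro ⟨hx, hy, hn⟩
    rcases (hc _ _ hx hy).1 hn with ⟨w, hw, hw'⟩ | hn
    · exact Or.inl ⟨w, hw, hx, hy, hw'⟩
    · exact Or.inr ⟨hx, hy, hn⟩
  · rintro (⟨w, hw, hx, hy, hw'⟩ | ⟨hx, hy, hn⟩)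
    · exact ⟨hx, hy, (hc _ _ hx hy).2 (Or.inl ⟨w, hw, hw'⟩)⟩
    · exact ⟨hx, hy, (hc _ _ hx hy).2 (Or.inr hn)⟩

theorem main_dio : Dio (fun a : Fin 2 → K => ¬ ∃ u v : K, a 0 = u ^ 2 - a 1 * v ^ 2) := by
  refine dio_congr (dio_or (d2_nonspl.comp (po_var 0) (po_var 1)) (dio_and (dio_eq (po_var 1) (po_const 0))
    (dio_ex (P := fun a t => a 0 ≠ 0 ∧ t ≠ 0 ∧ ¬ Spl (a 0) t) (d2_nonspl.comp (po_var _) (po_var _))))) fun a => ?_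
  constructor
  · intro hn
    have hx : a 0 ≠ 0 := fun h0 => hn ⟨0, 0, by rw [h0]; ring⟩
    by_cases hy : a 1 = 0
    · right
      refine ⟨hy, ?_⟩
      have hns : ∀ r : K, r ^ 2 ≠ a 0 := fun r hr => hn ⟨r, 0, by rw [← hr]; ring⟩
      obtain ⟨v, -, hv⟩ := exists_nonres hns ∅
      obtain ⟨t, ht, hnt⟩ := nondeg (v := Sum.inl v) hx hv
      exact ⟨t, hx, ht, fun hs => hnt (splAt_of_spl _ (spl_symm hx hs))⟩
    · exact Or.inl ⟨hx, hy, hn⟩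
  · rintro (⟨hx, hy, hn⟩ | ⟨hy, t, hx, ht, hn⟩)
    · exact hn
    · rintro ⟨u, v, e⟩
      exact hn ⟨u, 0, by rw [e, hy]; ring⟩

end DioFinal
end NND

end

/-- Over a number field `K`, the set of pairs `(x, y) ∈ K²` such that `x` is not a norm
from `K(√y)` to `K` (i.e. not of the form `u² − y·v²`) is diophantine over `K`. -/
theorem nonnorm_diophantine_numberField
    (K : Type*) [Field K] [NumberField K] :
    IsDiophantine {p : Fin 2 → K | ¬ ∃ u v : K, p 0 = u ^ 2 - p 1 * v ^ 2} :=
  NND.main_dio
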